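/- Let a ≥ 7 and b ≥ 7 be integers and let φ be a proper 5-coloring of the triangulated toroidal grid T[a×b]. If φ contains a pair, then φ is nice, i.e., φ is Kempe 5-equivalent to a proper 5-coloring of T[a×b] that contains a good 4-template. -/

import Mathlib

namespace KempePaper

variable {V : Type*}

/-- A proper `k`-coloring: adjacent vertices receive distinct colors. -/
def Proper (G : SimpleGraph V) {k : ℕ} (c : V → Fin k) : Prop :=
  ∀ ⦃u v : V⦄, G.Adj u v → c u ≠ c v

/-- The subgraph of `G` induced by the vertices colored `α` or `β` under `c`
(as a graph on all of `V`, with edges only between such vertices). -/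
def kempeGraph (G : SimpleGraph V) {k : ℕ} (c : V → Fin k) (α β : Fin k) :
    SimpleGraph V :=
  SimpleGraph.fromRel (fun u v =>
    G.Adj u v ∧ (c u = α ∨ c u = β) ∧ (c v = α ∨ c v = β))

/-- `c₂` is obtained from `c₁` by a single Kempe swap: the colors `α` and `β`
are interchanged on the connected component (of the subgraph induced by the
vertices colored `α` or `β`) containing some vertex `w`, and nothing else changes. -/
def KempeStep (G : SimpleGraph V) {k : ℕ} (c₁ c₂ : V → Fin k) : Prop :=
  ∃ (α β : Fin k) (w : V),
    (∀ v : V, (kempeGraph G c₁ α β).Reachable w v → c₂ v = Equiv.swap α β (c₁ v)) ∧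
    (∀ v : V, ¬ (kempeGraph G c₁ α β).Reachable w v → c₂ v = c₁ v)

/-- Two `k`-colorings are Kempe `k`-equivalent if one can be obtained from the
other by a finite sequence of Kempe swaps. -/
def KempeEquiv (G : SimpleGraph V) {k : ℕ} (c₁ c₂ : V → Fin k) : Prop :=
  Relation.ReflTransGen (KempeStep G) c₁ c₂

/-- The triangulated toroidal grid `T[a×b]`. -/
def triGrid (a b : ℕ) : SimpleGraph (ZMod a × ZMod b) :=
  SimpleGraph.fromRel (fun u v =>
    u - v ∈ ({(0,1), (0,-1), (1,0), (-1,0), (1,-1), (-1,1)} : Set (ZMod a × ZMod b)))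

/-- `G` is `d`-degenerate: every nonempty finite set `S` of vertices contains a
vertex with at most `d` neighbors inside `S`. -/
def Degenerate (G : SimpleGraph V) (d : ℕ) : Prop :=
  ∀ S : Set V, S.Finite → S.Nonempty → ∃ v ∈ S, (S ∩ G.neighborSet v).ncard ≤ d

/-- `S` is an independent set in `G`. -/
def Indep (G : SimpleGraph V) (S : Set V) : Prop :=
  ∀ u ∈ S, ∀ v ∈ S, ¬ G.Adj u v

/-- The relation identifying all the vertices of `S`. -/
def identifyRel (S : Set V) (u v : V) : Prop :=
  u = v ∨ (u ∈ S ∧ v ∈ S)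

/-- The identification `G/S`: the vertices of `S` are merged into a single vertex,
and two distinct resulting vertices are adjacent iff some representatives are
adjacent in `G`. -/
def Identify (G : SimpleGraph V) (S : Set V) :
    SimpleGraph (Quot (identifyRel S)) :=
  SimpleGraph.fromRel (fun x y =>
    ∃ u v : V, Quot.mk (identifyRel S) u = x ∧ Quot.mk (identifyRel S) v = y ∧ G.Adj u v)

/-- A good 4-template: an independent set of exactly 4 vertices whose
identification yields a 4-degenerate graph. -/
def GoodFourTemplate (G : SimpleGraph V) (S : Set V) : Prop :=
  Indep G S ∧ S.ncard = 4 ∧ Degenerate (Identify G S) 4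

/-- A coloring is monochromatic on `S`. -/
def Mono {k : ℕ} (c : V → Fin k) (S : Set V) : Prop :=
  ∀ u ∈ S, ∀ v ∈ S, c u = c v

/-- `φ` is nice: it is Kempe 5-equivalent to a proper 5-coloring of `T[a×b]`
containing a good 4-template. -/
def Nice (a b : ℕ) (c : ZMod a × ZMod b → Fin 5) : Prop :=
  ∃ c' : ZMod a × ZMod b → Fin 5,
    Proper (triGrid a b) c' ∧ KempeEquiv (triGrid a b) c c' ∧
    ∃ S : Set (ZMod a × ZMod b), GoodFourTemplate (triGrid a b) S ∧ Mono c' S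

/-- The relation identifying the vertices within each color of the template `T`. -/
def contractRel (T : Set (Set V)) (u v : V) : Prop :=
  u = v ∨ ∃ C ∈ T, u ∈ C ∧ v ∈ C

/-- The contraction `G_T`: the vertices within each color of `T` are identified,
and two distinct resulting vertices are adjacent iff some representatives are
adjacent in `G`. -/
def Contract (G : SimpleGraph V) (T : Set (Set V)) :
    SimpleGraph (Quot (contractRel T)) :=
  SimpleGraph.fromRel (fun x y =>
    ∃ u v : V, Quot.mk (contractRel T) u = x ∧ Quot.mk (contractRel T) v = y ∧ G.Adj u v)

/-- `T` is a template in `G`: a finite collection of pairwise disjoint nonempty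
independent sets of vertices. -/
def IsTemplate (G : SimpleGraph V) (T : Set (Set V)) : Prop :=
  T.Finite ∧ (∀ C ∈ T, C.Nonempty) ∧ T.Pairwise (fun C D => Disjoint C D) ∧
    ∀ C ∈ T, Indep G C

/-- A coloring contains the template `T` if each color of `T` is monochromatic. -/
def ContainsTemplate {k : ℕ} (c : V → Fin k) (T : Set (Set V)) : Prop :=
  ∀ C ∈ T, Mono c C

open Classical in
/-- The coloring obtained from `c` by exchanging the colors `α` and `β` on the set `S`. -/
noncomputable def swapOn {k : ℕ} (S : Set V) (α β : Fin k) (c : V → Fin k) : V → Fin k :=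
  fun v => if v ∈ S then Equiv.swap α β (c v) else c v

/-- No edge of the `α`-`β` subgraph of `c` leaves `S`. -/
def KempeClosed (G : SimpleGraph V) {k : ℕ} (c : V → Fin k) (α β : Fin k) (S : Set V) : Prop :=
  ∀ ⦃u v : V⦄, G.Adj u v → u ∈ S → (c u = α ∨ c u = β) → (c v = α ∨ c v = β) → v ∈ S

lemma swap_mem_pair {k : ℕ} {α β x : Fin k} :
    (Equiv.swap α β x = α ∨ Equiv.swap α β x = β) ↔ (x = α ∨ x = β) := by
  rw [Equiv.swap_apply_def]
  split_ifs <;> simp_all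

lemma swapOn_mem_pair {k : ℕ} {S : Set V} {α β : Fin k} {c : V → Fin k} {v : V} :
    (swapOn S α β c v = α ∨ swapOn S α β c v = β) ↔ (c v = α ∨ c v = β) := by
  unfold swapOn
  split_ifs
  · exact swap_mem_pair
  · rfl

lemma Proper.swapOn {G : SimpleGraph V} {k : ℕ} {c : V → Fin k} {α β : Fin k} {S : Set V}
    (hc : Proper G c) (hS : KempeClosed G c α β S) : Proper G (swapOn S α β c) := by
  have key : ∀ u v, G.Adj u v → u ∈ S → v ∉ S → Equiv.swap α β (c u) ≠ c v := by
    intro u v huv hu hv h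
    by_cases hcu : c u = α ∨ c u = β
    · exact hv (hS huv hu hcu (h ▸ swap_mem_pair.2 hcu))
    · push Not at hcu
      rw [Equiv.swap_apply_of_ne_of_ne hcu.1 hcu.2] at h
      exact hc huv h
  intro u v huv
  unfold KempePaper.swapOn
  split_ifs with hu hv hv
  · exact fun h => hc huv ((Equiv.swap α β).injective h)
  · exact key u v huv hu hv
  · exact fun h => key v u huv.symm hv hu h.symm
  · exact hc huv

lemma KempeClosed.kempeEquiv [Finite V] {G : SimpleGraph V} {k : ℕ} {α β : Fin k} {S : Set V}
    {c : V → Fin k} (hS : KempeClosed G c α β S) : KempeEquiv G c (swapOn S α β c) := by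
  induction h : S.ncard using Nat.strong_induction_on generalizing S c with
  | _ n ih =>
    rcases S.eq_empty_or_nonempty with rfl | ⟨w, hw⟩
    · have : swapOn ∅ α β c = c := by ext v; simp [swapOn]
      rw [this]
      exact Relation.ReflTransGen.refl
    · set K : Set V := {v | (kempeGraph G c α β).Reachable w v} with hK
      have hadj : ∀ u v, (kempeGraph G c α β).Adj u v →
          G.Adj u v ∧ (c u = α ∨ c u = β) ∧ (c v = α ∨ c v = β) := by
        intro u v huv
        rw [kempeGraph, SimpleGraph.fromRel_adj] at huv
        rcases huv.2 with h | h
        · exact h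
        · exact ⟨h.1.symm, h.2.2, h.2.1⟩
      have hKS : K ⊆ S := by
        rintro v ⟨p⟩
        have : ∀ {x y : V}, (kempeGraph G c α β).Walk x y → x ∈ S → y ∈ S := by
          intro x y p
          induction p with
          | nil => exact id
          | cons e _ ih =>
            intro hx
            obtain ⟨h1, h2, h3⟩ := hadj _ _ e
            exact ih (hS h1 hx h2 h3)
        exact this p hw
      have hKw : w ∈ K := SimpleGraph.Reachable.refl w
      have hKcl : ∀ ⦃u v : V⦄, G.Adj u v → u ∈ K → (c u = α ∨ c u = β) →
          (c v = α ∨ c v = β) → v ∈ K := by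
        intro u v huv hu h1 h2
        refine SimpleGraph.Reachable.trans hu (SimpleGraph.Adj.reachable ?_)
        rw [kempeGraph, SimpleGraph.fromRel_adj]
        exact ⟨huv.ne, Or.inl ⟨huv, h1, h2⟩⟩
      have step : KempeStep G c (swapOn K α β c) := by
        refine ⟨α, β, w, fun v hv => ?_, fun v hv => ?_⟩
        · exact if_pos hv
        · exact if_neg hv
      have hcl : KempeClosed G (swapOn K α β c) α β (S \ K) := by
        intro u v huv hu h1 h2
        rw [swapOn_mem_pair] at h1 h2
        exact ⟨hS huv hu.1 h1 h2, fun hv => hu.2 (hKcl huv.symm hv h2 h1)⟩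
      have hlt : (S \ K).ncard < n := by
        rw [← h]
        exact Set.ncard_lt_ncard ⟨Set.sdiff_subset, fun h' => (h' hw).2 hKw⟩ (Set.toFinite _)
      have := ih _ hlt hcl rfl
      have heq : swapOn (S \ K) α β (swapOn K α β c) = swapOn S α β c := by
        ext v
        by_cases h1 : v ∈ K
        · simp [swapOn, h1, hKS h1]
        · by_cases h2 : v ∈ S <;> simp [swapOn, h1, h2]
      rw [heq] at this
      exact Relation.ReflTransGen.head step this

lemma Nice.of_kempeClosed {a b : ℕ} [NeZero a] [NeZero b] {c : ZMod a × ZMod b → Fin 5}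
    {α β : Fin 5} {S : Set (ZMod a × ZMod b)} (hS : KempeClosed (triGrid a b) c α β S)
    (h : Nice a b (swapOn S α β c)) : Nice a b c := by
  obtain ⟨c', h1, h2, h3⟩ := h
  exact ⟨c', h1, hS.kempeEquiv.trans h2, h3⟩

/-- The six unit vectors of the triangular lattice. -/
def hexDirs : Finset (ℤ × ℤ) := {(1, 0), (0, 1), (-1, 1), (-1, 0), (0, -1), (1, -1)}

lemma mem_hexDirs {d : ℤ × ℤ} : d ∈ hexDirs ↔ d = (1, 0) ∨ d = (0, 1) ∨ d = (-1, 1) ∨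
    d = (-1, 0) ∨ d = (0, -1) ∨ d = (1, -1) := by
  simp [hexDirs]

/-- The projection of the triangular lattice onto the torus. -/
def toTorus (a b : ℕ) : ℤ × ℤ →+ ZMod a × ZMod b :=
  AddMonoidHom.prodMap (Int.castAddHom (ZMod a)) (Int.castAddHom (ZMod b))

lemma toTorus_apply (a b : ℕ) (p : ℤ × ℤ) : toTorus a b p = ((p.1 : ZMod a), (p.2 : ZMod b)) := rfl

lemma toTorus_eq_zero {a b : ℕ} {p : ℤ × ℤ} :
    toTorus a b p = 0 ↔ (a : ℤ) ∣ p.1 ∧ (b : ℤ) ∣ p.2 := by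
  rw [toTorus_apply, Prod.mk_eq_zero, ZMod.intCast_zmod_eq_zero_iff_dvd,
    ZMod.intCast_zmod_eq_zero_iff_dvd]

lemma toTorus_surjective (a b : ℕ) : Function.Surjective (toTorus a b) := by
  rintro ⟨x, y⟩
  obtain ⟨m, rfl⟩ := ZMod.intCast_surjective x
  obtain ⟨n, rfl⟩ := ZMod.intCast_surjective y
  exact ⟨(m, n), rfl⟩

lemma eq_zero_of_toTorus {a b : ℕ} (ha : 7 ≤ a) (hb : 7 ≤ b) {p : ℤ × ℤ}
    (h1 : |p.1| ≤ 6) (h2 : |p.2| ≤ 6) (h : toTorus a b p = 0) : p = 0 := by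
  rw [toTorus_eq_zero] at h
  have e1 : p.1 = 0 := Int.eq_zero_of_abs_lt_dvd h.1 (by omega)
  have e2 : p.2 = 0 := Int.eq_zero_of_abs_lt_dvd h.2 (by omega)
  exact Prod.ext e1 e2

lemma triGrid_adj {a b : ℕ} (ha : 7 ≤ a) (hb : 7 ≤ b) {u v : ZMod a × ZMod b} :
    (triGrid a b).Adj u v ↔ ∃ d ∈ hexDirs, v = u + toTorus a b d := by
  rw [triGrid, SimpleGraph.fromRel_adj]
  have hset : ∀ x : ZMod a × ZMod b, x ∈ ({(0,1), (0,-1), (1,0), (-1,0), (1,-1), (-1,1)} :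
      Set (ZMod a × ZMod b)) ↔ ∃ d ∈ hexDirs, x = toTorus a b d := by
    intro x
    simp only [Set.mem_insert_iff, Set.mem_singleton_iff, hexDirs, Finset.mem_insert,
      Finset.mem_singleton, exists_eq_or_imp, exists_eq_left, toTorus_apply]
    push_cast
    tauto
  have hneg : ∀ d ∈ hexDirs, -d ∈ hexDirs := by decide
  constructor
  · rintro ⟨-, h | h⟩
    · obtain ⟨d, hd, h⟩ := (hset _).1 h
      refine ⟨-d, hneg d hd, ?_⟩
      rw [map_neg, ← h]
      abel
    · obtain ⟨d, hd, h⟩ := (hset _).1 h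
      refine ⟨d, hd, ?_⟩
      rw [← h]
      abel
  · rintro ⟨d, hd, rfl⟩
    refine ⟨fun h => ?_, Or.inr ((hset _).2 ⟨d, hd, by abel⟩)⟩
    have h0 : toTorus a b d = 0 := by simpa using h.symm
    have hb' : ∀ d ∈ hexDirs, |d.1| ≤ 6 ∧ |d.2| ≤ 6 ∧ d ≠ 0 := by decide
    obtain ⟨h1, h2, h3⟩ := hb' d hd
    exact h3 (eq_zero_of_toTorus ha hb h1 h2 h0)

/-- A covering map of the torus by the triangular lattice that respects adjacency and whose
periods are the multiples of `a` and of `b` in the two coordinates. -/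
structure Chart (a b : ℕ) (e : ℤ × ℤ → ZMod a × ZMod b) : Prop where
  adj : ∀ p v, (triGrid a b).Adj (e p) v ↔ ∃ d ∈ hexDirs, v = e (p + d)
  eq_iff : ∀ p q, e p = e q ↔ (a : ℤ) ∣ p.1 - q.1 ∧ (b : ℤ) ∣ p.2 - q.2
  surj : Function.Surjective e

lemma chart_translate {a b : ℕ} (ha : 7 ≤ a) (hb : 7 ≤ b) (v : ZMod a × ZMod b) :
    Chart a b (fun p => v + toTorus a b p) where
  adj p u := by
    rw [triGrid_adj ha hb]
    simp only [map_add, add_assoc]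
  eq_iff p q := by
    rw [add_right_inj, ← sub_eq_zero, ← map_sub, toTorus_eq_zero]
    rfl
  surj u := by
    obtain ⟨p, hp⟩ := toTorus_surjective a b (u - v)
    exact ⟨p, by simp [hp]⟩

lemma chart_reflect {a b : ℕ} (ha : 7 ≤ a) (hb : 7 ≤ b) (v : ZMod a × ZMod b) :
    Chart a b (fun p => v - toTorus a b p) where
  adj p u := by
    have hneg : ∀ d ∈ hexDirs, -d ∈ hexDirs := by decide
    rw [triGrid_adj ha hb]
    constructor
    · rintro ⟨d, hd, rfl⟩
      exact ⟨-d, hneg d hd, by rw [map_add, map_neg]; abel⟩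
    · rintro ⟨d, hd, rfl⟩
      exact ⟨-d, hneg d hd, by rw [map_add, map_neg]; abel⟩
  eq_iff p q := by
    rw [sub_right_inj, ← sub_eq_zero, ← map_sub, toTorus_eq_zero]
    rfl
  surj u := by
    obtain ⟨p, hp⟩ := toTorus_surjective a b (v - u)
    exact ⟨p, by simp [hp]⟩

lemma Chart.eq_of_near {a b : ℕ} (ha : 7 ≤ a) (hb : 7 ≤ b) {e : ℤ × ℤ → ZMod a × ZMod b}
    (he : Chart a b e) {p q : ℤ × ℤ} (h1 : |p.1 - q.1| ≤ 6) (h2 : |p.2 - q.2| ≤ 6)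
    (h : e p = e q) : p = q := by
  rw [he.eq_iff] at h
  have e1 := Int.eq_zero_of_abs_lt_dvd h.1 (by omega)
  have e2 := Int.eq_zero_of_abs_lt_dvd h.2 (by omega)
  exact Prod.ext (by omega) (by omega)

lemma quot_identifyRel {S : Set V} {u v : V} :
    Quot.mk (identifyRel S) u = Quot.mk (identifyRel S) v ↔ u = v ∨ (u ∈ S ∧ v ∈ S) := by
  constructor
  · intro h
    rw [Quot.eq] at h
    induction h with
    | rel _ _ h => exact h
    | refl _ => exact Or.inl rfl
    | symm _ _ _ ih => rcases ih with rfl | ih; exacts [Or.inl rfl, Or.inr ih.symm]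
    | trans _ _ _ _ _ ih1 ih2 =>
      rcases ih1 with rfl | ih1
      · exact ih2
      · rcases ih2 with rfl | ih2
        exacts [Or.inr ih1, Or.inr ⟨ih1.1, ih2.2⟩]
  · exact fun h => Quot.sound h

/-- A set `R` of lattice cells is closed for the configuration `S` when it contains each cell of
the window outside `S` that has two neighbors in `R`, or one neighbor in `R` and two in `S`. -/
def FillClosed (S : Finset (ℤ × ℤ)) (R : Set (ℤ × ℤ)) : Prop :=
  ∀ x : ℤ × ℤ, -2 ≤ x.1 → x.1 ≤ 6 → -2 ≤ x.2 → x.2 ≤ 6 → x ∉ S →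
    ((∃ d₁ ∈ hexDirs, ∃ d₂ ∈ hexDirs, d₁ ≠ d₂ ∧ x + d₁ ∈ R ∧ x + d₂ ∈ R) ∨
      ∃ d₁ ∈ hexDirs, ∃ d₂ ∈ hexDirs, ∃ d₃ ∈ hexDirs,
        d₂ ≠ d₃ ∧ x + d₁ ∈ R ∧ x + d₂ ∈ S ∧ x + d₃ ∈ S) → x ∈ R

/-- The conditions on a four-element configuration of lattice cells guaranteeing that it projects
to a good template. -/
structure Fillable (S : Finset (ℤ × ℤ)) : Prop where
  card : S.card = 4
  window : ∀ p ∈ S, 0 ≤ p.1 ∧ p.1 ≤ 4 ∧ 0 ≤ p.2 ∧ p.2 ≤ 4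
  indep : ∀ p ∈ S, ∀ q ∈ S, p - q ∉ hexDirs
  fill : ∃ w : ℤ × ℤ, (0 ≤ w.1 ∧ w.1 ≤ 4 ∧ 0 ≤ w.2 ∧ w.2 ≤ 4) ∧ w ∉ S ∧
    (∃ d₁ ∈ hexDirs, ∃ d₂ ∈ hexDirs, ∃ d₃ ∈ hexDirs, d₁ ≠ d₂ ∧ d₁ ≠ d₃ ∧ d₂ ≠ d₃ ∧
      w + d₁ ∈ S ∧ w + d₂ ∈ S ∧ w + d₃ ∈ S) ∧
    ∀ R : Set (ℤ × ℤ), w ∈ R → FillClosed S R →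
      ∀ x : ℤ × ℤ, 0 ≤ x.1 → x.1 ≤ 6 → 0 ≤ x.2 → x.2 ≤ 6 → x ∉ S → x ∈ R

section Degeneracy

variable {a b : ℕ} {e : ℤ × ℤ → ZMod a × ZMod b} {S : Finset (ℤ × ℤ)}

lemma ncard_neighbors_le {T : Set (ZMod a × ZMod b)} (he : Chart a b e) {x : ℤ × ℤ}
    (hx : e x ∉ T) (X : Set (Quot (identifyRel T))) {d₁ d₂ : ℤ × ℤ} (h₁ : d₁ ∈ hexDirs)
    (h₂ : d₂ ∈ hexDirs) (h : d₁ ≠ d₂)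
    (hX : ∀ d, d = d₁ ∨ d = d₂ → Quot.mk (identifyRel T) (e (x + d)) ∈ X →
      e (x + d) ∈ T ∧ ∃ f ∈ hexDirs, f ≠ d₁ ∧ f ≠ d₂ ∧ e (x + f) ∈ T) :
    (X ∩ (Identify (triGrid a b) T).neighborSet (Quot.mk _ (e x))).ncard ≤ 4 := by
  set F := (hexDirs.erase d₁).erase d₂
  have hF : F.card = 4 := by
    rw [Finset.card_erase_of_mem (Finset.mem_erase.2 ⟨h.symm, h₂⟩), Finset.card_erase_of_mem h₁]
    rfl
  classical
  have hsub : X ∩ (Identify (triGrid a b) T).neighborSet (Quot.mk _ (e x)) ⊆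
      (F.image fun f => Quot.mk (identifyRel T) (e (x + f)) : Finset _) := by
    rintro y ⟨hy, hadj⟩
    have : ∃ v, Quot.mk (identifyRel T) v = y ∧ (triGrid a b).Adj (e x) v := by
      rw [SimpleGraph.mem_neighborSet, Identify, SimpleGraph.fromRel_adj] at hadj
      rcases hadj.2 with ⟨u, v, hu, hv, huv⟩ | ⟨u, v, hu, hv, huv⟩
      · rcases quot_identifyRel.1 hu with rfl | hu
        · exact ⟨v, hv, huv⟩
        · exact absurd hu.2 hx
      · rcases quot_identifyRel.1 hv with rfl | hv
        · exact ⟨u, hu, huv.symm⟩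
        · exact absurd hv.2 hx
    obtain ⟨v, rfl, hv⟩ := this
    obtain ⟨d, hd, rfl⟩ := (he.adj _ _).1 hv
    rw [Finset.coe_image, Set.mem_image]
    by_cases hd12 : d = d₁ ∨ d = d₂
    · obtain ⟨h3, f, hf, hf1, hf2, hf3⟩ := hX d hd12 hy
      exact ⟨f, by simp [F, hf, hf1, hf2], quot_identifyRel.2 (Or.inr ⟨hf3, h3⟩)⟩
    · push Not at hd12
      exact ⟨d, by simp [F, hd, hd12], rfl⟩
  calc _ ≤ (F.image fun f => Quot.mk (identifyRel T) (e (x + f))).card := by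
        rw [← Set.ncard_coe_finset]
        exact Set.ncard_le_ncard hsub (Finset.finite_toSet _)
    _ ≤ F.card := Finset.card_image_le
    _ = 4 := hF

theorem Fillable.good (hS : Fillable S) (ha : 7 ≤ a) (hb : 7 ≤ b) (he : Chart a b e) :
    GoodFourTemplate (triGrid a b) (e '' S) := by
  have hinj : ∀ x : ℤ × ℤ, -2 ≤ x.1 → x.1 ≤ 6 → -2 ≤ x.2 → x.2 ≤ 6 → e x ∈ e '' S → x ∈ S := by
    rintro x h1 h2 h3 h4 ⟨p, hp, hpx⟩
    have hw := hS.window p hp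
    have := he.eq_of_near ha hb (p := p) (q := x) (by rw [abs_le]; omega) (by rw [abs_le]; omega)
      hpx
    exact this ▸ hp
  refine ⟨?_, ?_, ?_⟩
  · rintro _ ⟨p, hp, rfl⟩ _ ⟨q, hq, rfl⟩ hadj
    obtain ⟨d, hd, hqd⟩ := (he.adj _ _).1 hadj
    have h1 := hS.window p hp
    have h2 := hS.window q hq
    have hdb : ∀ d ∈ hexDirs, |d.1| ≤ 1 ∧ |d.2| ≤ 1 := by decide
    obtain ⟨hd1, hd2⟩ := hdb d hd
    rw [abs_le] at hd1 hd2
    have := he.eq_of_near ha hb (by rw [abs_le, Prod.fst_add]; omega)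
      (by rw [abs_le, Prod.snd_add]; omega) hqd
    exact hS.indep q hq p hp (by rwa [this, add_sub_cancel_left])
  · rw [Set.InjOn.ncard_image, Set.ncard_coe_finset, hS.card]
    intro p hp q hq hpq
    have h1 := hS.window p hp
    have h2 := hS.window q hq
    exact he.eq_of_near ha hb (by rw [abs_le]; omega) (by rw [abs_le]; omega) hpq
  · obtain ⟨T, hT⟩ : ∃ T, T = e '' (S : Set (ℤ × ℤ)) := ⟨_, rfl⟩
    rw [← hT] at hinj ⊢
    intro X _ hXne
    by_contra hX
    push Not at hX
    set R : Set (ℤ × ℤ) := {x | e x ∉ T ∧ Quot.mk (identifyRel T) (e x) ∉ X} with hR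
    have rule : ∀ x : ℤ × ℤ, e x ∉ T → ∀ d₁ ∈ hexDirs, ∀ d₂ ∈ hexDirs, d₁ ≠ d₂ →
        (∀ d, d = d₁ ∨ d = d₂ → x + d ∈ R ∨ (e (x + d) ∈ T ∧
          ∃ f ∈ hexDirs, f ≠ d₁ ∧ f ≠ d₂ ∧ e (x + f) ∈ T)) → x ∈ R := by
      intro x hx d₁ h₁ d₂ h₂ hne h
      refine ⟨hx, fun hxX => ?_⟩
      refine absurd (ncard_neighbors_le he hx X h₁ h₂ hne fun d hd hdX => ?_)
        (not_le.2 (hX _ hxX))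
      rcases h d hd with h' | h'
      · exact absurd hdX h'.2
      · exact h'
    have rule2 : ∀ x : ℤ × ℤ, e x ∉ T → ∀ d₁ ∈ hexDirs, ∀ d₂ ∈ hexDirs, d₁ ≠ d₂ →
        x + d₁ ∈ R → x + d₂ ∈ R → x ∈ R := by
      intro x hx d₁ h₁ d₂ h₂ hne hd₁ hd₂
      refine rule x hx d₁ h₁ d₂ h₂ hne fun d hd => Or.inl ?_
      rcases hd with rfl | rfl <;> assumption
    have hmem : ∀ p ∈ S, e p ∈ T := fun p hp => hT ▸ ⟨p, hp, rfl⟩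
    have hclosed : FillClosed S R := by
      intro x h1 h2 h3 h4 hxS h
      have hx : e x ∉ T := fun h => hxS (hinj x h1 h2 h3 h4 h)
      rcases h with ⟨d₁, h₁, d₂, h₂, hne, hd₁, hd₂⟩ | ⟨d₁, h₁, d₂, h₂, d₃, h₃, hne, hd₁, hd₂, hd₃⟩
      · exact rule2 x hx d₁ h₁ d₂ h₂ hne hd₁ hd₂
      · have h12 : d₁ ≠ d₂ := by
          rintro rfl
          exact hd₁.1 (hmem _ hd₂)
        have h13 : d₃ ≠ d₁ := by
          rintro rfl
          exact hd₁.1 (hmem _ hd₃)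
        refine rule x hx d₁ h₁ d₂ h₂ h12 ?_
        rintro d (rfl | rfl)
        · exact Or.inl hd₁
        · exact Or.inr ⟨hmem _ hd₂, d₃, h₃, h13, hne.symm, hmem _ hd₃⟩
    obtain ⟨w, hw, hwS, ⟨d₁, h₁, d₂, h₂, d₃, h₃, h12, h13, h23, hd₁, hd₂, hd₃⟩, hfill⟩ := hS.fill
    have hwR : w ∈ R := by
      have hx : e w ∉ T := fun h => hwS (hinj w (by omega) (by omega) (by omega) (by omega) h)
      refine rule w hx d₁ h₁ d₂ h₂ h12 ?_
      rintro d (rfl | rfl)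
      · exact Or.inr ⟨hmem _ hd₁, d₃, h₃, h13.symm, h23.symm, hmem _ hd₃⟩
      · exact Or.inr ⟨hmem _ hd₂, d₃, h₃, h13.symm, h23.symm, hmem _ hd₃⟩
    have hbox := hfill R hwR hclosed
    have hfree1 : ∀ k l : ℤ, 5 ≤ k → k < a → e (k, l) ∉ T := by
      rw [hT]
      rintro k l hk hka ⟨p, hp, hpe⟩
      have hwin := hS.window p hp
      have := Int.eq_zero_of_abs_lt_dvd ((he.eq_iff _ _).1 hpe).1 (by simp only [abs_lt]; omega)
      simp only at this
      omega
    have hfree2 : ∀ k l : ℤ, 5 ≤ l → l < b → e (k, l) ∉ T := by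
      rw [hT]
      rintro k l hk hka ⟨p, hp, hpe⟩
      have hwin := hS.window p hp
      have := Int.eq_zero_of_abs_lt_dvd ((he.eq_iff _ _).1 hpe).2 (by simp only [abs_lt]; omega)
      simp only at this
      omega
    have hout1 : ∀ k l : ℤ, 5 ≤ k → k ≤ 6 → 0 ≤ l → l ≤ 6 → (k, l) ∈ R := fun k l h1 h2 h3 h4 =>
      hbox _ (by simp only; omega) h2 h3 h4 fun h => by have := hS.window _ h; simp only at this; omega
    have hout2 : ∀ k l : ℤ, 5 ≤ l → l ≤ 6 → 0 ≤ k → k ≤ 6 → (k, l) ∈ R := fun k l h1 h2 h3 h4 =>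
      hbox _ h3 h4 (by simp only; omega) h2 fun h => by have := hS.window _ h; simp only at this; omega
    have cols : ∀ n : ℕ, ((5 : ℤ), (n : ℤ)) ∈ R ∧ ((6 : ℤ), (n : ℤ)) ∈ R := by
      intro n
      induction n with
      | zero => exact ⟨hout1 _ _ (by omega) (by omega) (by simp) (by simp),
          hout1 _ _ (by omega) (by omega) (by simp) (by simp)⟩
      | succ n ih =>
        have h5 : ((5 : ℤ), ((n + 1 : ℕ) : ℤ)) ∈ R := by
          refine rule2 _ (hfree1 _ _ (by omega) (by omega)) (0, -1) (by decide) (1, -1) (by decide)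
            (by decide) ?_ ?_
          · convert ih.1 using 1; simp
          · convert ih.2 using 1; simp
        refine ⟨h5, rule2 _ (hfree1 _ _ (by omega) (by omega)) (0, -1) (by decide) (-1, 0)
            (by decide) (by decide) ?_ ?_⟩
        · convert ih.2 using 1; simp
        · convert h5 using 1; simp
    have rows : ∀ n : ℕ, ((n : ℤ), (5 : ℤ)) ∈ R ∧ ((n : ℤ), (6 : ℤ)) ∈ R := by
      intro n
      induction n with
      | zero => exact ⟨hout2 _ _ (by omega) (by omega) (by simp) (by simp),
          hout2 _ _ (by omega) (by omega) (by simp) (by simp)⟩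
      | succ n ih =>
        have h5 : (((n + 1 : ℕ) : ℤ), (5 : ℤ)) ∈ R := by
          refine rule2 _ (hfree2 _ _ (by omega) (by omega)) (-1, 0) (by decide) (-1, 1) (by decide)
            (by decide) ?_ ?_
          · convert ih.1 using 1; simp
          · convert ih.2 using 1; simp
        refine ⟨h5, rule2 _ (hfree2 _ _ (by omega) (by omega)) (-1, 0) (by decide) (0, -1)
            (by decide) (by decide) ?_ ?_⟩
        · convert ih.2 using 1; simp
        · convert h5 using 1; simp
    have allcols : ∀ m n : ℕ, m + 5 < a → (((m + 5 : ℕ) : ℤ), (n : ℤ)) ∈ R := by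
      intro m
      induction m with
      | zero => exact fun n _ => (cols n).1
      | succ m ih =>
        intro n hm
        refine rule2 _ (hfree1 _ _ (by omega) (by omega)) (-1, 0) (by decide) (-1, 1) (by decide)
            (by decide) ?_ ?_
        · convert ih n (by omega) using 1; ext <;> simp; omega
        · convert ih (n + 1) (by omega) using 1; ext <;> simp; omega
    have allrows : ∀ n m : ℕ, n + 5 < b → ((m : ℤ), ((n + 5 : ℕ) : ℤ)) ∈ R := by
      intro n
      induction n with
      | zero => exact fun n _ => (rows n).1
      | succ n ih =>
        intro m hn
        refine rule2 _ (hfree2 _ _ (by omega) (by omega)) (0, -1) (by decide) (1, -1) (by decide)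
            (by decide) ?_ ?_
        · convert ih m (by omega) using 1; ext <;> simp; omega
        · convert ih (m + 1) (by omega) using 1; ext <;> simp; omega
    have hall : ∀ v, v ∉ T → Quot.mk (identifyRel T) v ∉ X := by
      intro v hv
      obtain ⟨p, rfl⟩ := he.surj v
      have hpe : e p = e (p.1 % a, p.2 % b) := by
        rw [he.eq_iff]
        exact ⟨Int.dvd_self_sub_emod, Int.dvd_self_sub_emod⟩
      rw [hpe] at hv ⊢
      have b1 := Int.emod_nonneg p.1 (b := a) (by omega)
      have b2 := Int.emod_lt_of_pos p.1 (b := a) (by omega)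
      have b3 := Int.emod_nonneg p.2 (b := b) (by omega)
      have b4 := Int.emod_lt_of_pos p.2 (b := b) (by omega)
      generalize p.1 % (a : ℤ) = k at *
      generalize p.2 % (b : ℤ) = l at *
      suffices (k, l) ∈ R from this.2
      lift k to ℕ using b1
      lift l to ℕ using b3
      by_cases hk : 5 ≤ k
      · obtain ⟨m, rfl⟩ := Nat.exists_eq_add_of_le' hk
        exact allcols m l (by omega)
      by_cases hl : 5 ≤ l
      · obtain ⟨n, rfl⟩ := Nat.exists_eq_add_of_le' hl
        exact allrows n k (by omega)
      exact hbox _ (by simp) (by simp only; omega) (by simp) (by simp only; omega)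
        fun h => hv (hmem _ h)
    obtain ⟨x, hx⟩ := hXne
    induction x using Quot.ind with
    | mk v =>
      have hvT : v ∈ T := by
        by_contra hv
        exact hall v hv hx
      have hempty : X ∩ (Identify (triGrid a b) T).neighborSet (Quot.mk _ v) = ∅ := by
        rw [Set.eq_empty_iff_forall_notMem]
        rintro y ⟨hy, hadj⟩
        induction y using Quot.ind with
        | mk u =>
          have huT : u ∈ T := by
            by_contra hu
            exact hall u hu hy
          rw [SimpleGraph.mem_neighborSet] at hadj
          exact hadj.ne (quot_identifyRel.2 (Or.inr ⟨hvT, huT⟩))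
      have := hX _ hx
      rw [hempty, Set.ncard_empty] at this
      omega

end Degeneracy

/-- The bit position of a cell with both coordinates between `-8` and `7`. -/
def gridIdx (x : ℤ × ℤ) : ℕ := (16 * (x.1 + 8) + (x.2 + 8)).toNat

/-- The cells with both coordinates between `-8` and `7`. -/
def InGrid (x : ℤ × ℤ) : Prop := (-8 ≤ x.1 ∧ x.1 ≤ 7) ∧ -8 ≤ x.2 ∧ x.2 ≤ 7

lemma gridIdx_inj {x y : ℤ × ℤ} (hx : InGrid x) (hy : InGrid y) (h : gridIdx x = gridIdx y) :
    x = y := by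
  unfold gridIdx at h
  unfold InGrid at hx hy
  ext <;> omega

/-- The six unit vectors, each with the mask whose bit at a cell is the bit of `m` at the neighbor
of the cell in that direction. -/
def shifted (m : ℕ) : List ((ℤ × ℤ) × ℕ) :=
  [((1, 0), m >>> 16), ((0, 1), m >>> 1), ((-1, 1), m <<< 15), ((-1, 0), m <<< 16),
    ((0, -1), m <<< 1), ((1, -1), m >>> 15)]

lemma testBit_shifted {m : ℕ} {q : (ℤ × ℤ) × ℕ} (hq : q ∈ shifted m) {x : ℤ × ℤ}
    (hx : -7 ≤ x.1 ∧ x.1 ≤ 6 ∧ -7 ≤ x.2 ∧ x.2 ≤ 6) (h : q.2.testBit (gridIdx x) = true) :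
    q.1 ∈ hexDirs ∧ m.testBit (gridIdx (x + q.1)) = true := by
  have key : ∀ {i j : ℕ}, i = j → m.testBit i = true → m.testBit j = true := fun h h' => h ▸ h'
  simp only [shifted, List.mem_cons, List.not_mem_nil, or_false] at hq
  rcases hq with rfl | rfl | rfl | rfl | rfl | rfl <;> refine ⟨by simp [hexDirs], ?_⟩ <;>
    simp only [Nat.testBit_shiftRight, Nat.testBit_shiftLeft, Bool.and_eq_true,
      decide_eq_true_eq] at h
  · exact key (by simp only [gridIdx, Prod.fst_add, Prod.snd_add]; omega) h
  · exact key (by simp only [gridIdx, Prod.fst_add, Prod.snd_add]; omega) h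
  · exact key (by simp only [gridIdx, Prod.fst_add, Prod.snd_add]; omega) h.2
  · exact key (by simp only [gridIdx, Prod.fst_add, Prod.snd_add]; omega) h.2
  · exact key (by simp only [gridIdx, Prod.fst_add, Prod.snd_add]; omega) h.2
  · exact key (by simp only [gridIdx, Prod.fst_add, Prod.snd_add]; omega) h

/-- The bits set in at least one of the masks. -/
def anyBit {ι : Type*} (l : List (ι × ℕ)) : ℕ := l.foldr (fun q m => q.2 ||| m) 0

/-- The bits set in at least two of the masks. -/
def twoBits {ι : Type*} : List (ι × ℕ) → ℕ
  | [] => 0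
  | q :: l => (q.2 &&& anyBit l) ||| twoBits l

lemma testBit_anyBit {ι : Type*} {l : List (ι × ℕ)} {i : ℕ} :
    (anyBit l).testBit i = true ↔ ∃ q ∈ l, q.2.testBit i = true := by
  induction l with
  | nil => simp [anyBit]
  | cons q l ih =>
    rw [anyBit, List.foldr_cons, Nat.testBit_or, Bool.or_eq_true]
    simp only [List.mem_cons, exists_eq_or_imp, ← ih]
    rfl

lemma testBit_twoBits {ι : Type*} {l : List (ι × ℕ)} (hl : (l.map Prod.fst).Nodup) {i : ℕ}
    (h : (twoBits l).testBit i = true) :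
    ∃ q ∈ l, ∃ r ∈ l, q.1 ≠ r.1 ∧ q.2.testBit i = true ∧ r.2.testBit i = true := by
  induction l with
  | nil => simp [twoBits] at h
  | cons q l ih =>
    rw [List.map_cons, List.nodup_cons] at hl
    rw [twoBits, Nat.testBit_or, Bool.or_eq_true, Nat.testBit_and, Bool.and_eq_true] at h
    rcases h with ⟨h1, h2⟩ | h
    · obtain ⟨r, hr, hri⟩ := testBit_anyBit.1 h2
      refine ⟨q, List.mem_cons_self, r, List.mem_cons_of_mem _ hr, fun hqr => hl.1 ?_, h1, hri⟩
      exact List.mem_map.2 ⟨r, hr, hqr.symm⟩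
    · obtain ⟨q', hq, r, hr, h⟩ := ih hl.2 h
      exact ⟨q', List.mem_cons_of_mem _ hq, r, List.mem_cons_of_mem _ hr, h⟩

lemma testBit_anyBit_shifted {m : ℕ} {x : ℤ × ℤ} (hx : -7 ≤ x.1 ∧ x.1 ≤ 6 ∧ -7 ≤ x.2 ∧ x.2 ≤ 6)
    (h : (anyBit (shifted m)).testBit (gridIdx x) = true) :
    ∃ d ∈ hexDirs, m.testBit (gridIdx (x + d)) = true := by
  obtain ⟨q, hq, hqi⟩ := testBit_anyBit.1 h
  exact ⟨q.1, testBit_shifted hq hx hqi⟩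

lemma testBit_twoBits_shifted {m : ℕ} {x : ℤ × ℤ} (hx : -7 ≤ x.1 ∧ x.1 ≤ 6 ∧ -7 ≤ x.2 ∧ x.2 ≤ 6)
    (h : (twoBits (shifted m)).testBit (gridIdx x) = true) :
    ∃ d₁ ∈ hexDirs, ∃ d₂ ∈ hexDirs, d₁ ≠ d₂ ∧ m.testBit (gridIdx (x + d₁)) = true ∧
      m.testBit (gridIdx (x + d₂)) = true := by
  obtain ⟨q, hq, r, hr, hqr, hqi, hri⟩ :=
    testBit_twoBits (l := shifted m) (by simp only [shifted, List.map]; decide) h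
  obtain ⟨h1, h2⟩ := testBit_shifted hq hx hqi
  obtain ⟨h3, h4⟩ := testBit_shifted hr hx hri
  exact ⟨q.1, h1, r.1, h3, hqr, h2, h4⟩

/-- The mask of a list of cells. -/
def maskOf (l : List (ℤ × ℤ)) : ℕ := anyBit (l.map fun p => (p, 1 <<< gridIdx p))

lemma testBit_maskOf {l : List (ℤ × ℤ)} (hl : ∀ p ∈ l, InGrid p) {x : ℤ × ℤ} (hx : InGrid x) :
    (maskOf l).testBit (gridIdx x) = true ↔ x ∈ l := by
  rw [maskOf, testBit_anyBit]
  constructor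
  · rintro ⟨q, hq, h⟩
    obtain ⟨p, hp, rfl⟩ := List.mem_map.1 hq
    rw [Nat.one_shiftLeft, Nat.testBit_two_pow] at h
    exact gridIdx_inj (hl p hp) hx (of_decide_eq_true h) ▸ hp
  · intro h
    exact ⟨(x, 1 <<< gridIdx x), List.mem_map.2 ⟨x, h, rfl⟩, by simp [Nat.one_shiftLeft]⟩

/-- The mask of the cells with both coordinates between `l` and `6`. -/
def squareMask (l : ℤ) : ℕ :=
  maskOf ((List.range (7 - l).toNat).flatMap fun (i : ℕ) =>
    (List.range (7 - l).toNat).map fun (j : ℕ) => (l + (i : ℤ), l + (j : ℤ)))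

lemma testBit_squareMask {l : ℤ} (hl : -8 ≤ l) {x : ℤ × ℤ} (hx : InGrid x) :
    (squareMask l).testBit (gridIdx x) = true ↔ (l ≤ x.1 ∧ x.1 ≤ 6) ∧ l ≤ x.2 ∧ x.2 ≤ 6 := by
  unfold squareMask
  rw [testBit_maskOf _ hx]
  · simp only [List.mem_flatMap, List.mem_range, List.mem_map]
    constructor
    · rintro ⟨i, hi, j, hj, rfl⟩
      simp only
      omega
    · rintro ⟨h1, h2⟩
      exact ⟨(x.1 - l).toNat, by omega, (x.2 - l).toNat, by omega, by ext <;> simp <;> omega⟩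
  · simp only [List.mem_flatMap, List.mem_range, List.mem_map]
    rintro p ⟨i, hi, j, hj, rfl⟩
    simp only [InGrid]
    omega

/-- One round of filling: `F` is the mask of the free cells, `S` that of the configuration. -/
def fillStep (F S R : ℕ) : ℕ :=
  R ||| (F &&& (twoBits (shifted R) ||| (anyBit (shifted R) &&& twoBits (shifted S))))

lemma fillStep_sound {S : List (ℤ × ℤ)} (hS : ∀ p ∈ S, InGrid p) {R : Set (ℤ × ℤ)}
    (hR : FillClosed S.toFinset R) {m : ℕ}
    (hm : ∀ x, InGrid x → m.testBit (gridIdx x) = true → x ∈ R) (x : ℤ × ℤ) (hx : InGrid x)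
    (h : (fillStep (squareMask (-2) ^^^ (squareMask (-2) &&& maskOf S)) (maskOf S) m).testBit
      (gridIdx x) = true) : x ∈ R := by
  have hadd : ∀ d ∈ hexDirs, -2 ≤ x.1 → x.1 ≤ 6 → -2 ≤ x.2 → x.2 ≤ 6 → InGrid (x + d) := by
    intro d hd h1 h2 h3 h4
    rw [mem_hexDirs] at hd
    unfold InGrid
    rcases hd with rfl | rfl | rfl | rfl | rfl | rfl <;>
      simp only [Prod.fst_add, Prod.snd_add] <;> omega
  simp only [fillStep, Nat.testBit_or, Nat.testBit_and, Nat.testBit_xor, Bool.or_eq_true,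
    Bool.and_eq_true, bne_iff_ne, ne_eq] at h
  rcases h with h | ⟨h1, h2⟩
  · exact hm x hx h
  · have hbox : (squareMask (-2)).testBit (gridIdx x) = true := by
      by_contra hb
      simp [hb] at h1
    have hxS : (maskOf S).testBit (gridIdx x) ≠ true := by
      intro hb
      simp [hb] at h1
    rw [ne_eq, testBit_maskOf hS hx] at hxS
    obtain ⟨⟨b1, b2⟩, b3, b4⟩ := (testBit_squareMask (by norm_num) hx).1 hbox
    have hb : -7 ≤ x.1 ∧ x.1 ≤ 6 ∧ -7 ≤ x.2 ∧ x.2 ≤ 6 := by omega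
    refine hR x b1 b2 b3 b4 (by simpa using hxS) ?_
    rcases h2 with h2 | ⟨h2, h3⟩
    · obtain ⟨d, hd, f, hf, hdf, h4, h5⟩ := testBit_twoBits_shifted hb h2
      exact Or.inl ⟨d, hd, f, hf, hdf, hm _ (hadd d hd b1 b2 b3 b4) h4,
        hm _ (hadd f hf b1 b2 b3 b4) h5⟩
    · obtain ⟨g, hg, h6⟩ := testBit_anyBit_shifted hb h2
      obtain ⟨d, hd, f, hf, hdf, h4, h5⟩ := testBit_twoBits_shifted hb h3
      rw [testBit_maskOf hS (hadd d hd b1 b2 b3 b4)] at h4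
      rw [testBit_maskOf hS (hadd f hf b1 b2 b3 b4)] at h5
      exact Or.inr ⟨g, hg, d, hd, f, hf, hdf, hm _ (hadd g hg b1 b2 b3 b4) h6, by simpa using h4,
        by simpa using h5⟩

/-- A computable form of `Fillable` for a list of cells and a cell adjacent to three of them. -/
def FillCheck (S : List (ℤ × ℤ)) (w : ℤ × ℤ) : Prop :=
  (S.Nodup ∧ S.length = 4) ∧ (∀ p ∈ S, 0 ≤ p.1 ∧ p.1 ≤ 4 ∧ 0 ≤ p.2 ∧ p.2 ≤ 4) ∧
  (∀ p ∈ S, ∀ q ∈ S, p - q ∉ hexDirs) ∧ (0 ≤ w.1 ∧ w.1 ≤ 4 ∧ 0 ≤ w.2 ∧ w.2 ≤ 4) ∧ w ∉ S ∧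
  (∃ p ∈ S, ∃ q ∈ S, ∃ r ∈ S, (p ≠ q ∧ p ≠ r ∧ q ≠ r) ∧
    p - w ∈ hexDirs ∧ q - w ∈ hexDirs ∧ r - w ∈ hexDirs) ∧
  Nat.land (squareMask 0 ^^^ (squareMask 0 &&& maskOf S))
    ((fillStep (squareMask (-2) ^^^ (squareMask (-2) &&& maskOf S)) (maskOf S))^[30]
      (maskOf [w])) = squareMask 0 ^^^ (squareMask 0 &&& maskOf S)

instance (S : List (ℤ × ℤ)) (w : ℤ × ℤ) : Decidable (FillCheck S w) :=
  inferInstanceAs (Decidable (_ ∧ _))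

lemma FillCheck.fillable {S : List (ℤ × ℤ)} {w : ℤ × ℤ} (h : FillCheck S w) :
    Fillable S.toFinset := by
  obtain ⟨⟨h1, h2⟩, h3, h4, hw, hwS, ⟨p, hp, q, hq, r, hr, ⟨hpq, hpr, hqr⟩, h5, h6, h7⟩, h8⟩ := h
  have hwin : ∀ {p : ℤ × ℤ}, (0 ≤ p.1 ∧ p.1 ≤ 4 ∧ 0 ≤ p.2 ∧ p.2 ≤ 4) → InGrid p := by
    intro p hp
    unfold InGrid
    omega
  have hgrid : ∀ p ∈ S, InGrid p := fun p hp => hwin (h3 p hp)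
  refine ⟨by rw [List.toFinset_card_of_nodup h1, h2], by simpa using h3, by simpa using h4,
    w, hw, by simpa using hwS, ?_, ?_⟩
  · refine ⟨p - w, h5, q - w, h6, r - w, h7, ?_, ?_, ?_, ?_, ?_, ?_⟩ <;> simpa
  · intro R hwR hR x hx1 hx2 hx3 hx4 hxS
    have hx : InGrid x := by unfold InGrid; omega
    have hiter : ∀ n : ℕ, ∀ x, InGrid x →
        ((fillStep (squareMask (-2) ^^^ (squareMask (-2) &&& maskOf S)) (maskOf S))^[n]
          (maskOf [w])).testBit (gridIdx x) = true → x ∈ R := by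
      intro n
      induction n with
      | zero =>
        intro x hx h
        rw [Function.iterate_zero, id, testBit_maskOf (by simpa using hwin hw) hx] at h
        rw [List.mem_singleton] at h
        exact h ▸ hwR
      | succ n ih =>
        rw [Function.iterate_succ_apply']
        exact fillStep_sound hgrid hR ih
    refine hiter 30 x hx ?_
    have : (squareMask 0 ^^^ (squareMask 0 &&& maskOf S)).testBit (gridIdx x) = true := by
      have hS : (maskOf S).testBit (gridIdx x) = false := by
        rw [← Bool.not_eq_true, testBit_maskOf hgrid hx]
        simpa using hxS
      have hb := (testBit_squareMask (l := 0) (by norm_num) hx).2 ⟨⟨hx1, hx2⟩, hx3, hx4⟩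
      rw [Nat.testBit_xor, Nat.testBit_and, hS, hb]
      rfl
    rw [← h8] at this
    change (_ &&& _ : ℕ).testBit _ = true at this
    rw [Nat.testBit_and, Bool.and_eq_true] at this
    exact this.2

/-- The lower left corner of the bounding box of a list of cells containing the origin or not. -/
def lowerCorner (l : List (ℤ × ℤ)) : ℤ × ℤ :=
  (l.foldr (fun p m => min p.1 m) 10, l.foldr (fun p m => min p.2 m) 10)

/-- `FillCheck` after translation into the window. -/
def FillCheckFrom (l : List (ℤ × ℤ)) : Prop :=
  FillCheck (l.map (· - lowerCorner l)) (-lowerCorner l)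

instance (l : List (ℤ × ℤ)) : Decidable (FillCheckFrom l) :=
  inferInstanceAs (Decidable (FillCheck _ _))

/-- The three alternating neighbors of the origin that form a triple. -/
def tripleCells : List (ℤ × ℤ) := [(1, 0), (-1, 1), (0, -1)]

/-- The cells which extend the triple to a good template. -/
def templateCells : List (ℤ × ℤ) :=
  [(2, 1), (3, -1), (-2, 3), (-3, 2), (-1, -2), (1, -3),
    (1, 2), (3, -2), (-1, 3), (-3, 1), (-2, -1), (2, -3)]

/-- The linear map sending the standard basis to `d₁`, `d₂`. -/
def frameMap (d₁ d₂ : ℤ × ℤ) (p : ℤ × ℤ) : ℤ × ℤ :=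
  (p.1 * d₁.1 + p.2 * d₂.1, p.1 * d₁.2 + p.2 * d₂.2)

lemma fillCheckFrom_frames : ∀ d₁ ∈ hexDirs, ∀ d₂ ∈ hexDirs, d₂ - d₁ ∈ hexDirs →
    ∀ p ∈ templateCells, FillCheckFrom ((p :: tripleCells).map (frameMap d₁ d₂)) ∨
      FillCheckFrom ((p :: tripleCells).map fun q => -frameMap d₁ d₂ q) := by
  decide +kernel

lemma good_of_fillCheckFrom {a b : ℕ} (ha : 7 ≤ a) (hb : 7 ≤ b) (v : ZMod a × ZMod b)
    {l : List (ℤ × ℤ)} (h : FillCheckFrom l) :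
    GoodFourTemplate (triGrid a b) ((fun p => v + toTorus a b p) '' {p | p ∈ l}) ∧
      GoodFourTemplate (triGrid a b) ((fun p => v - toTorus a b p) '' {p | p ∈ l}) := by
  have h1 := h.fillable.good ha hb (chart_translate ha hb (v + toTorus a b (lowerCorner l)))
  have h2 := h.fillable.good ha hb (chart_reflect ha hb (v - toTorus a b (lowerCorner l)))
  constructor
  · convert h1 using 1
    ext u
    simp only [Set.mem_image, Set.mem_ofPred_eq, Finset.mem_coe, List.mem_toFinset, List.mem_map,
      exists_exists_and_eq_and, map_sub]
    refine exists_congr fun p => and_congr_right fun _ => ?_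
    rw [add_assoc, add_sub_cancel]
  · convert h2 using 1
    ext u
    simp only [Set.mem_image, Set.mem_ofPred_eq, Finset.mem_coe, List.mem_toFinset, List.mem_map,
      exists_exists_and_eq_and, map_sub]
    refine exists_congr fun p => and_congr_right fun _ => ?_
    rw [sub_sub, add_sub_cancel]

theorem good_template_frame {a b : ℕ} (ha : 7 ≤ a) (hb : 7 ≤ b) (v : ZMod a × ZMod b)
    {d₁ d₂ p : ℤ × ℤ} (h₁ : d₁ ∈ hexDirs) (h₂ : d₂ ∈ hexDirs) (h : d₂ - d₁ ∈ hexDirs)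
    (hp : p ∈ templateCells) :
    GoodFourTemplate (triGrid a b)
      ((fun q => v + toTorus a b (frameMap d₁ d₂ q)) '' {q | q ∈ p :: tripleCells}) := by
  rcases fillCheckFrom_frames d₁ h₁ d₂ h₂ h p hp with h | h
  · convert (good_of_fillCheckFrom ha hb v h).1 using 1
    ext u
    simp only [Set.mem_image, Set.mem_ofPred_eq, List.mem_map, exists_exists_and_eq_and]
  · convert (good_of_fillCheckFrom ha hb v h).2 using 1
    ext u
    simp only [Set.mem_image, Set.mem_ofPred_eq, List.mem_map, exists_exists_and_eq_and, map_neg,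
      sub_neg_eq_add]

/-- The images of the standard basis of the triangular lattice under its point symmetries. -/
def IsFrame (d₁ d₂ : ℤ × ℤ) : Prop := d₁ ∈ hexDirs ∧ d₂ ∈ hexDirs ∧ d₂ - d₁ ∈ hexDirs

instance (d₁ d₂ : ℤ × ℤ) : Decidable (IsFrame d₁ d₂) := inferInstanceAs (Decidable (_ ∧ _))

lemma frameMap_add (d₁ d₂ p q : ℤ × ℤ) :
    frameMap d₁ d₂ (p + q) = frameMap d₁ d₂ p + frameMap d₁ d₂ q := by
  ext <;> simp [frameMap] <;> ring

lemma frameMap_frameMap (d₁ d₂ e₁ e₂ p : ℤ × ℤ) :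
    frameMap d₁ d₂ (frameMap e₁ e₂ p) = frameMap (frameMap d₁ d₂ e₁) (frameMap d₁ d₂ e₂) p := by
  ext <;> simp [frameMap] <;> ring

lemma frameMap_std (p : ℤ × ℤ) : frameMap (1, 0) (0, 1) p = p := by
  ext <;> simp [frameMap]

/-- The list of all frames. -/
def frames : List ((ℤ × ℤ) × (ℤ × ℤ)) :=
  [((1, 0), (0, 1)), ((1, 0), (1, -1)), ((0, 1), (-1, 1)), ((0, 1), (1, 0)), ((-1, 1), (-1, 0)),
    ((-1, 1), (0, 1)), ((-1, 0), (0, -1)), ((-1, 0), (-1, 1)), ((0, -1), (1, -1)),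
    ((0, -1), (-1, 0)), ((1, -1), (1, 0)), ((1, -1), (0, -1))]

lemma IsFrame.mem_frames {d₁ d₂ : ℤ × ℤ} (h : IsFrame d₁ d₂) : (d₁, d₂) ∈ frames := by
  have key : ∀ d₁ ∈ hexDirs, ∀ d₂ ∈ hexDirs, d₂ - d₁ ∈ hexDirs → (d₁, d₂) ∈ frames := by
    decide +kernel
  exact key _ h.1 _ h.2.1 h.2.2

lemma IsFrame.map_hexDirs {d₁ d₂ : ℤ × ℤ} (h : IsFrame d₁ d₂) {d : ℤ × ℤ} (hd : d ∈ hexDirs) :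
    frameMap d₁ d₂ d ∈ hexDirs := by
  have key : ∀ d₁ ∈ hexDirs, ∀ d₂ ∈ hexDirs, d₂ - d₁ ∈ hexDirs → ∀ d ∈ hexDirs,
      frameMap d₁ d₂ d ∈ hexDirs := by decide +kernel
  exact key _ h.1 _ h.2.1 h.2.2 _ hd

lemma IsFrame.exists_hexDirs {d₁ d₂ : ℤ × ℤ} (h : IsFrame d₁ d₂) {d : ℤ × ℤ} (hd : d ∈ hexDirs) :
    ∃ e ∈ hexDirs, frameMap d₁ d₂ e = d := by
  have key : ∀ d₁ ∈ hexDirs, ∀ d₂ ∈ hexDirs, d₂ - d₁ ∈ hexDirs → ∀ d ∈ hexDirs,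
      ∃ e ∈ hexDirs, frameMap d₁ d₂ e = d := by decide +kernel
  exact key _ h.1 _ h.2.1 h.2.2 _ hd

lemma IsFrame.comp {d₁ d₂ e₁ e₂ : ℤ × ℤ} (h : IsFrame d₁ d₂) (h' : IsFrame e₁ e₂) :
    IsFrame (frameMap d₁ d₂ e₁) (frameMap d₁ d₂ e₂) := by
  refine ⟨h.map_hexDirs h'.1, h.map_hexDirs h'.2.1, ?_⟩
  convert h.map_hexDirs h'.2.2 using 1
  ext <;> simp [frameMap] <;> ring

/-- Two cells of the triangular lattice at distance at most six. -/
def Near (x y : ℤ × ℤ) : Prop :=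
  (|x.1 - y.1| ≤ 6 ∧ |x.2 - y.2| ≤ 6) ∧ |(x.1 - y.1) + (x.2 - y.2)| ≤ 6

instance (x y : ℤ × ℤ) : Decidable (Near x y) := inferInstanceAs (Decidable (_ ∧ _))

lemma IsFrame.eq_of_near {a b : ℕ} (ha : 7 ≤ a) (hb : 7 ≤ b) {d₁ d₂ : ℤ × ℤ}
    (h : IsFrame d₁ d₂) {x y : ℤ × ℤ} (hxy : Near x y)
    (he : toTorus a b (frameMap d₁ d₂ x) = toTorus a b (frameMap d₁ d₂ y)) : x = y := by
  simp only [Near, abs_le] at hxy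
  have h0 : toTorus a b (frameMap d₁ d₂ x - frameMap d₁ d₂ y) = 0 := by
    rw [map_sub, he, sub_self]
  have key : (|(frameMap d₁ d₂ x - frameMap d₁ d₂ y).1| ≤ 6 ∧
      |(frameMap d₁ d₂ x - frameMap d₁ d₂ y).2| ≤ 6) ∧
      (frameMap d₁ d₂ x - frameMap d₁ d₂ y = 0 → x = y) := by
    clear he h0
    have hmem := h.mem_frames
    simp only [frames, List.mem_cons, List.not_mem_nil, or_false, Prod.mk.injEq] at hmem
    rcases hmem with ⟨rfl, rfl⟩ | ⟨rfl, rfl⟩ | ⟨rfl, rfl⟩ | ⟨rfl, rfl⟩ | ⟨rfl, rfl⟩ | ⟨rfl, rfl⟩ |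
      ⟨rfl, rfl⟩ | ⟨rfl, rfl⟩ | ⟨rfl, rfl⟩ | ⟨rfl, rfl⟩ | ⟨rfl, rfl⟩ | ⟨rfl, rfl⟩ <;>
    simp only [frameMap, Prod.fst_sub, Prod.snd_sub, abs_le, Prod.ext_iff, Prod.fst_zero,
      Prod.snd_zero] <;> omega
  exact key.2 (eq_zero_of_toTorus ha hb key.1.1 key.1.2 h0)

/-- A class of colorings of the triangular lattice which is closed under lattice symmetries,
color permutations and local Kempe changes, and which avoids the monochromatic templates. -/
structure LatticeClass (𝒞 : Set (ℤ × ℤ → Fin 5)) : Prop where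
  proper : ∀ ψ ∈ 𝒞, ∀ p, ∀ d ∈ hexDirs, ψ (p + d) ≠ ψ p
  frame : ∀ ψ ∈ 𝒞, ∀ d₁ d₂, IsFrame d₁ d₂ → ∀ (p : ℤ × ℤ) (σ : Equiv.Perm (Fin 5)),
    (fun q => σ (ψ (p + frameMap d₁ d₂ q))) ∈ 𝒞
  swap : ∀ ψ ∈ 𝒞, ∀ (C : Finset (ℤ × ℤ)) (α β : Fin 5), (∀ x ∈ C, ψ x = α ∨ ψ x = β) →
    (∀ x ∈ C, ∀ d ∈ hexDirs, x + d ∉ C → ψ (x + d) ≠ α ∧ ψ (x + d) ≠ β) →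
    ∃ ψ' ∈ 𝒞, (∀ x ∈ C, ψ' x = Equiv.swap α β (ψ x)) ∧
      ∀ x ∉ C, (∀ y ∈ C, Near x y) → ψ' x = ψ x
  template : ∀ ψ ∈ 𝒞, ∀ p ∈ templateCells, ∀ c, ¬ ∀ q ∈ p :: tripleCells, ψ q = c

/-- The lifts to the triangular lattice of the colorings of the torus which are not nice. -/
def obstructions (a b : ℕ) : Set (ℤ × ℤ → Fin 5) :=
  {ψ | ∃ (φ : ZMod a × ZMod b → Fin 5) (v : ZMod a × ZMod b) (d₁ d₂ : ℤ × ℤ)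
    (σ : Equiv.Perm (Fin 5)), (Proper (triGrid a b) φ ∧ ¬ Nice a b φ) ∧ IsFrame d₁ d₂ ∧
      ∀ p, ψ p = σ (φ (v + toTorus a b (frameMap d₁ d₂ p)))}

theorem latticeClass_obstructions {a b : ℕ} (ha : 7 ≤ a) (hb : 7 ≤ b) :
    LatticeClass (obstructions a b) where
  proper := by
    rintro ψ ⟨φ, v, d₁, d₂, σ, ⟨hφ, -⟩, hd, hψ⟩ p d hpd h
    rw [hψ, hψ, σ.apply_eq_iff_eq, frameMap_add, map_add, ← add_assoc] at h
    exact hφ ((triGrid_adj ha hb).2 ⟨_, hd.map_hexDirs hpd, rfl⟩) h.symm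
  frame := by
    rintro ψ ⟨φ, v, d₁, d₂, σ, hφ, hd, hψ⟩ e₁ e₂ he p τ
    refine ⟨φ, v + toTorus a b (frameMap d₁ d₂ p), _, _, σ.trans τ, hφ, hd.comp he, fun q => ?_⟩
    simp only [hψ, frameMap_add, map_add, frameMap_frameMap, Equiv.trans_apply, add_assoc]
  swap := by
    rintro ψ ⟨φ, v, d₁, d₂, σ, ⟨hφ, hnice⟩, hd, hψ⟩ C α β hC hcl
    have : NeZero a := ⟨by omega⟩
    have : NeZero b := ⟨by omega⟩
    have hS : KempeClosed (triGrid a b) φ (σ.symm α) (σ.symm β)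
        ((fun p => v + toTorus a b (frameMap d₁ d₂ p)) '' C) := by
      rintro _ w huw ⟨x, hx, rfl⟩ - hw
      obtain ⟨d, hdd, rfl⟩ := (triGrid_adj ha hb).1 huw
      obtain ⟨e, hee, rfl⟩ := hd.exists_hexDirs hdd
      have hadd : v + toTorus a b (frameMap d₁ d₂ x) + toTorus a b (frameMap d₁ d₂ e) =
          v + toTorus a b (frameMap d₁ d₂ (x + e)) := by
        rw [frameMap_add, map_add, add_assoc]
      rw [hadd] at hw ⊢
      by_contra hmem
      have hxe : x + e ∉ C := fun h => hmem ⟨_, h, rfl⟩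
      obtain ⟨h1, h2⟩ := hcl x hx e hee hxe
      rw [hψ] at h1 h2
      rw [Equiv.eq_symm_apply, Equiv.eq_symm_apply] at hw
      tauto
    have hswap : ∀ c, σ (Equiv.swap (σ.symm α) (σ.symm β) c) = Equiv.swap α β (σ c) := by
      intro c
      simp only [Equiv.swap_apply_def, Equiv.eq_symm_apply]
      split_ifs <;> simp
    refine ⟨fun p => σ (swapOn ((fun p => v + toTorus a b (frameMap d₁ d₂ p)) '' C) (σ.symm α)
      (σ.symm β) φ (v + toTorus a b (frameMap d₁ d₂ p))), ⟨_, v, d₁, d₂, σ, ⟨hφ.swapOn hS,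
      fun h => hnice (Nice.of_kempeClosed hS h)⟩, hd, fun _ => rfl⟩, fun x hx => ?_,
      fun x hx hnear => ?_⟩
    · simp only [swapOn]
      rw [if_pos ⟨x, hx, rfl⟩, hswap, hψ]
    · simp only [swapOn]
      rw [if_neg, hψ]
      rintro ⟨y, hy, h⟩
      exact hx (hd.eq_of_near ha hb (hnear y hy) (add_left_cancel h.symm) ▸ hy)
  template := by
    rintro ψ ⟨φ, v, d₁, d₂, σ, ⟨hφ, hnice⟩, hd, hψ⟩ p hp c h
    refine hnice ⟨φ, hφ, Relation.ReflTransGen.refl, _,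
      good_template_frame ha hb v hd.1 hd.2.1 hd.2.2 hp, ?_⟩
    rintro _ ⟨q, hq, rfl⟩ _ ⟨r, hr, rfl⟩
    have := (h q hq).trans (h r hr).symm
    rwa [hψ, hψ, σ.apply_eq_iff_eq] at this

namespace LatticeClass

variable {𝒞 : Set (ℤ × ℤ → Fin 5)} {ψ : ℤ × ℤ → Fin 5}

lemma frame_origin (h𝒞 : LatticeClass 𝒞) (hψ : ψ ∈ 𝒞) (σ : Equiv.Perm (Fin 5)) :
    (fun q => σ (ψ q)) ∈ 𝒞 := by
  have := h𝒞.frame ψ hψ (1, 0) (0, 1) (by decide) 0 σ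
  simpa only [frameMap_std, zero_add] using this

lemma recolor (h𝒞 : LatticeClass 𝒞) (hψ : ψ ∈ 𝒞) {x : ℤ × ℤ} {c : Fin 5}
    (h : ∀ d ∈ hexDirs, ψ (x + d) ≠ c) :
    ∃ ψ' ∈ 𝒞, ψ' x = c ∧ ∀ y, y ≠ x → Near y x → ψ' y = ψ y := by
  obtain ⟨ψ', h1, h2, h3⟩ := h𝒞.swap ψ hψ {x} (ψ x) c (by simp)
    (by simpa using fun d₁ d₂ hd _ => ⟨h𝒞.proper ψ hψ x _ hd, h _ hd⟩)
  exact ⟨ψ', h1, by simpa using h2 x, fun y hy hyx => h3 y (by simpa using hy) (by simpa using hyx)⟩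

/-- Swapping two colors on the component of some cells of color `c` and then renaming the two
colors everywhere changes the color `c` of other nearby cells only. -/
lemma isolate (h𝒞 : LatticeClass 𝒞) (hψ : ψ ∈ 𝒞) {S : List (ℤ × ℤ)} {c d : Fin 5} (hcd : d ≠ c)
    (hS : ∀ x ∈ S, ψ x = c)
    (hcl : ∀ x ∈ S, ∀ e ∈ hexDirs, ψ (x + e) = d → ∀ f ∈ hexDirs, ψ (x + e + f) = c →
      x + e + f ∈ S) :
    ∃ ψ' ∈ 𝒞, (∀ x ∈ S, ψ' x = c) ∧
      ∀ y ∉ S, (∀ x ∈ S, Near y x ∧ ∀ e ∈ hexDirs, Near y (x + e)) → ψ y = c → ψ' y = d := by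
  classical
  set C : Finset (ℤ × ℤ) := S.toFinset ∪
    {y ∈ S.toFinset.biUnion fun x => hexDirs.image (x + ·) | ψ y = d} with hC
  have hmem : ∀ y, y ∈ C ↔ y ∈ S ∨ (∃ x ∈ S, ∃ e ∈ hexDirs, x + e = y) ∧ ψ y = d := by
    intro y
    simp only [hC, Finset.mem_union, List.mem_toFinset, Finset.mem_filter, Finset.mem_biUnion,
      Finset.mem_image]
  have hpair : ∀ x ∈ C, ψ x = c ∨ ψ x = d := by
    intro x hx
    rcases (hmem x).1 hx with hx | ⟨-, hx⟩
    · exact Or.inl (hS x hx)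
    · exact Or.inr hx
  have hclosed : ∀ x ∈ C, ∀ e ∈ hexDirs, x + e ∉ C → ψ (x + e) ≠ c ∧ ψ (x + e) ≠ d := by
    intro x hx e he hxe
    rw [hmem] at hxe
    push Not at hxe
    rcases (hmem x).1 hx with hx | ⟨⟨y, hy, f, hf, rfl⟩, hyd⟩
    · exact ⟨fun h => h𝒞.proper ψ hψ x e he (h.trans (hS x hx).symm),
        hxe.2 ⟨x, hx, e, he, rfl⟩⟩
    · exact ⟨fun h => hxe.1 (hcl y hy f hf hyd e he h),
        fun h => h𝒞.proper ψ hψ _ e he (h.trans hyd.symm)⟩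
  obtain ⟨ψ', h1, h2, h3⟩ := h𝒞.swap ψ hψ C c d hpair hclosed
  refine ⟨_, h𝒞.frame_origin h1 (Equiv.swap c d), fun x hx => ?_, fun y hy hn hyc => ?_⟩
  · rw [h2 x ((hmem x).2 (Or.inl hx)), Equiv.swap_apply_self, hS x hx]
  · rw [h3 y, hyc, Equiv.swap_apply_left]
    · rw [hmem]
      rintro (h | ⟨-, h⟩)
      · exact hy h
      · exact hcd (h ▸ hyc)
    · intro z hz
      rcases (hmem z).1 hz with hz | ⟨⟨x, hx, e, he, rfl⟩, -⟩
      · exact (hn z hz).1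
      · exact (hn x hx).2 e he

lemma template_frame (h𝒞 : LatticeClass 𝒞) (hψ : ψ ∈ 𝒞) {d₁ d₂ : ℤ × ℤ} (hd : IsFrame d₁ d₂)
    (w : ℤ × ℤ) {c : Fin 5} (h : ∀ q ∈ tripleCells, ψ (w + frameMap d₁ d₂ q) = c) :
    ∀ p ∈ templateCells, ψ (w + frameMap d₁ d₂ p) ≠ c := by
  intro p hp hpc
  refine h𝒞.template _ (h𝒞.frame ψ hψ d₁ d₂ hd w (Equiv.refl _)) p hp c ?_
  simpa using ⟨hpc, fun a b hab => h _ hab⟩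

lemma ne_of_adj (h𝒞 : LatticeClass 𝒞) (hψ : ψ ∈ 𝒞) {S : List (ℤ × ℤ)} {c : Fin 5}
    (hS : ∀ x ∈ S, ψ x = c) {y : ℤ × ℤ} (h : ∃ x ∈ S, y - x ∈ hexDirs) : ψ y ≠ c := by
  obtain ⟨x, hx, hd⟩ := h
  have := h𝒞.proper ψ hψ x _ hd
  rwa [add_sub_cancel, hS x hx] at this

/-- The triple together with a cell at distance two from its center. -/
def diamondCells : List (ℤ × ℤ) := (0, 2) :: tripleCells

theorem not_diamond (h𝒞 : LatticeClass 𝒞) (hψ : ψ ∈ 𝒞) (c : Fin 5) :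
    ¬ ∀ x ∈ diamondCells, ψ x = c := by
  have hne : ∀ ψ ∈ 𝒞, (∀ x ∈ diamondCells, ψ x = c) → ∀ y, (y ∈ templateCells ∨
      (0, 1) + frameMap (-1, 0) (0, -1) y ∈ templateCells ∨ ∃ x ∈ diamondCells, y - x ∈ hexDirs) →
      ψ y ≠ c := by
    rintro ψ hψ h y (hy | hy | hy)
    · have := h𝒞.template_frame hψ (d₁ := (1, 0)) (d₂ := (0, 1)) (c := c) (by decide) 0
        (fun q hq => by
          rw [frameMap_std, zero_add]
          exact h q (List.mem_cons_of_mem _ hq)) y hy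
      rwa [frameMap_std, zero_add] at this
    · have := h𝒞.template_frame hψ (d₁ := (-1, 0)) (d₂ := (0, -1)) (c := c) (by decide) (0, 1)
        (fun q hq => h _ (by revert q; decide)) _ hy
      convert this using 2
      ext <;> simp [frameMap]
    · exact h𝒞.ne_of_adj hψ h hy
  have hcorner : ∀ ψ ∈ 𝒞, (∀ x ∈ diamondCells, ψ x = c) → ψ (3, 1) = c := by
    intro ψ hψ h
    by_contra h31
    obtain ⟨ψ', h1, h2, h3⟩ := h𝒞.recolor hψ (x := (2, 1)) (c := c) (by
      intro d hd
      have key : ∀ d ∈ hexDirs, (2, 1) + d = ((3, 1) : ℤ × ℤ) ∨ ((2, 1) + d ∈ templateCells ∨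
        (0, 1) + frameMap (-1, 0) (0, -1) ((2, 1) + d) ∈ templateCells ∨
        ∃ x ∈ diamondCells, (2, 1) + d - x ∈ hexDirs) := by decide
      rcases key d hd with h' | h'
      · rwa [h']
      · exact hne ψ hψ h _ h')
    refine h𝒞.template ψ' h1 (2, 1) (by decide) c ?_
    rw [List.forall_mem_cons]
    refine ⟨h2, fun q hq => ?_⟩
    have key : ∀ q ∈ tripleCells, q ≠ (2, 1) ∧ Near q (2, 1) := by decide
    rw [h3 q (key q hq).1 (key q hq).2]
    exact h q (List.mem_cons_of_mem _ hq)
  intro h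
  obtain ⟨d, hdc, hd1, hd2⟩ : ∃ d : Fin 5, d ≠ c ∧ ψ (0, 3) ≠ d ∧ ψ (0, -2) ≠ d := by
    have key : ∀ c x y : Fin 5, ∃ d, d ≠ c ∧ x ≠ d ∧ y ≠ d := by decide
    exact key _ _ _
  obtain ⟨ψ', h1, h2, h3⟩ := h𝒞.isolate hψ hdc h (by
    intro x hx e he hxe f hf hc
    have key : ∀ x ∈ diamondCells, ∀ e ∈ hexDirs, x + e = (0, 3) ∨ x + e = (0, -2) ∨
        ∀ f ∈ hexDirs, x + e + f ∈ diamondCells ∨ (x + e + f ∈ templateCells ∨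
        (0, 1) + frameMap (-1, 0) (0, -1) (x + e + f) ∈ templateCells ∨
        ∃ y ∈ diamondCells, x + e + f - y ∈ hexDirs) := by decide +kernel
    rcases key x hx e he with h' | h' | h'
    · exact absurd (h' ▸ hxe) hd1
    · exact absurd (h' ▸ hxe) hd2
    · exact (h' f hf).resolve_right fun h' => hne ψ hψ h _ h' hc)
  have h4 := h3 (3, 1) (by decide) (by decide) (hcorner ψ hψ h)
  exact hdc (h4.symm.trans (hcorner ψ' h1 h2))

theorem not_triple (h𝒞 : LatticeClass 𝒞) (hψ : ψ ∈ 𝒞) (c : Fin 5) :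
    ¬ ∀ x ∈ tripleCells, ψ x = c := by
  have hne : ∀ ψ ∈ 𝒞, (∀ x ∈ tripleCells, ψ x = c) → ∀ y, (y ∈ templateCells ∨
      y ∈ ([(0, 2), (-2, 0), (2, -2)] : List (ℤ × ℤ)) ∨ ∃ x ∈ tripleCells, y - x ∈ hexDirs) →
      ψ y ≠ c := by
    rintro ψ hψ h y (hy | hy | hy)
    · have := h𝒞.template_frame hψ (d₁ := (1, 0)) (d₂ := (0, 1)) (c := c) (by decide) 0
        (fun q hq => by
          rw [frameMap_std, zero_add]
          exact h q hq) y hy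
      rwa [frameMap_std, zero_add] at this
    · intro hc
      have key : ∀ y ∈ ([(0, 2), (-2, 0), (2, -2)] : List (ℤ × ℤ)), ∃ f ∈ frames,
          IsFrame f.1 f.2 ∧ ∀ x ∈ diamondCells,
          frameMap f.1 f.2 x = y ∨ frameMap f.1 f.2 x ∈ tripleCells := by decide
      obtain ⟨f, -, hf, hx⟩ := key y hy
      refine h𝒞.not_diamond (h𝒞.frame ψ hψ _ _ hf 0 (Equiv.refl _)) c fun x hxd => ?_
      simp only [zero_add, Equiv.refl_apply]
      rcases hx x hxd with h' | h'
      · rwa [h']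
      · exact h _ h'
    · exact h𝒞.ne_of_adj hψ h hy
  have hcorner : ∀ ψ ∈ 𝒞, (∀ x ∈ tripleCells, ψ x = c) → ψ (0, 3) = c := by
    intro ψ hψ h
    by_contra h03
    obtain ⟨ψ', h1, h2, h3⟩ := h𝒞.recolor hψ (x := (0, 2)) (c := c) (by
      intro d hd
      have key : ∀ d ∈ hexDirs, (0, 2) + d = ((0, 3) : ℤ × ℤ) ∨ ((0, 2) + d ∈ templateCells ∨
        (0, 2) + d ∈ ([(0, 2), (-2, 0), (2, -2)] : List (ℤ × ℤ)) ∨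
        ∃ x ∈ tripleCells, (0, 2) + d - x ∈ hexDirs) := by decide
      rcases key d hd with h' | h'
      · rwa [h']
      · exact hne ψ hψ h _ h')
    refine h𝒞.not_diamond h1 c ?_
    unfold diamondCells
    rw [List.forall_mem_cons]
    refine ⟨h2, fun q hq => ?_⟩
    have key : ∀ q ∈ tripleCells, q ≠ (0, 2) ∧ Near q (0, 2) := by decide
    rw [h3 q (key q hq).1 (key q hq).2]
    exact h q hq
  intro h
  obtain ⟨d, hdc, hd1, hd2, hd3⟩ : ∃ d : Fin 5, d ≠ c ∧ ψ (2, 0) ≠ d ∧ ψ (-2, 2) ≠ d ∧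
      ψ (0, -2) ≠ d := by
    have key : ∀ c x y z : Fin 5, ∃ d, d ≠ c ∧ x ≠ d ∧ y ≠ d ∧ z ≠ d := by decide
    exact key _ _ _ _
  obtain ⟨ψ', h1, h2, h3⟩ := h𝒞.isolate hψ hdc h (by
    intro x hx e he hxe f hf hc
    have key : ∀ x ∈ tripleCells, ∀ e ∈ hexDirs, x + e = (2, 0) ∨ x + e = (-2, 2) ∨
        x + e = (0, -2) ∨ ∀ f ∈ hexDirs, x + e + f ∈ tripleCells ∨ (x + e + f ∈ templateCells ∨
        x + e + f ∈ ([(0, 2), (-2, 0), (2, -2)] : List (ℤ × ℤ)) ∨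
        ∃ y ∈ tripleCells, x + e + f - y ∈ hexDirs) := by decide +kernel
    rcases key x hx e he with h' | h' | h' | h'
    · exact absurd (h' ▸ hxe) hd1
    · exact absurd (h' ▸ hxe) hd2
    · exact absurd (h' ▸ hxe) hd3
    · exact (h' f hf).resolve_right fun h' => hne ψ hψ h _ h' hc)
  have h4 := h3 (0, 3) (by decide) (by decide) (hcorner ψ hψ h)
  exact hdc (h4.symm.trans (hcorner ψ' h1 h2))

lemma exists_near_triple (h𝒞 : LatticeClass 𝒞) (hψ : ψ ∈ 𝒞) (c : Fin 5) :
    ∃ x ∈ tripleCells, ∃ d ∈ hexDirs, ψ (x + d) = c := by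
  by_contra! h
  have key : ∀ l : List (ℤ × ℤ), l ⊆ tripleCells → ∃ ψ' ∈ 𝒞, (∀ x ∈ l, ψ' x = c) ∧
      ∀ x ∈ tripleCells, ∀ d ∈ hexDirs, ψ' (x + d) ≠ c := by
    have hnear : ∀ x ∈ tripleCells, ∀ y ∈ tripleCells, Near y x ∧
      ∀ d ∈ hexDirs, y + d ≠ x ∧ Near (y + d) x := by decide +kernel
    intro l
    induction l with
    | nil => exact fun _ => ⟨ψ, hψ, by simp, h⟩
    | cons x l ih =>
      intro hl
      rw [List.cons_subset] at hl
      obtain ⟨ψ₁, h1, h2, h3⟩ := ih hl.2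
      obtain ⟨ψ₂, h4, h5, h6⟩ := h𝒞.recolor h1 (h3 x hl.1)
      refine ⟨ψ₂, h4, ?_, ?_⟩
      · rw [List.forall_mem_cons]
        refine ⟨h5, fun y hy => ?_⟩
        by_cases hyx : y = x
        · rw [hyx, h5]
        · rw [h6 y hyx (hnear x hl.1 y (hl.2 hy)).1, h2 y hy]
      · intro y hy d hd
        obtain ⟨h7, h8⟩ := (hnear x hl.1 y hy).2 d hd
        rw [h6 _ h7 h8]
        exact h3 y hy d hd
  obtain ⟨ψ', h1, h2, -⟩ := key tripleCells (List.Subset.refl _)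
  exact h𝒞.not_triple h1 c h2

lemma exists_near_triple_frame (h𝒞 : LatticeClass 𝒞) (hψ : ψ ∈ 𝒞) {d₁ d₂ : ℤ × ℤ}
    (hd : IsFrame d₁ d₂) (w : ℤ × ℤ) (c : Fin 5) :
    ∃ x ∈ tripleCells, ∃ d ∈ hexDirs, ψ (w + frameMap d₁ d₂ (x + d)) = c := by
  simpa using h𝒞.exists_near_triple (h𝒞.frame ψ hψ _ _ hd w (Equiv.refl _)) c

end LatticeClass

/-- `k n`, arranged so that the kernel evaluates `n` before substituting it into `k`. -/
def force {β : Type} (n : ℕ) (k : ℕ → β) : β := Nat.rec (k 0) (fun m _ => k (Nat.succ m)) n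

/-- A partial coloring of the grid is encoded by a number whose bit `256 * c + gridIdx x` tells
whether the color `c` is still possible at `x`. This number has the bits of all colors at the
index `0`. -/
def colorRep : ℕ := 1 + 2 ^ 256 + 2 ^ 512 + 2 ^ 768 + 2 ^ 1024

/-- The mask of the cells at distance at most four from the origin. -/
def patch : ℕ :=
  3113539010940730526739623866237952832985518650785790406164480

/-- The mask of the cells at distance at most six from the origin, with the origin at bit `102`. -/
def ball : ℕ :=
  797216345288641158145834099124440098691939338358510753685440

/-- The mask of the cells adjacent to the triple or to the reflected triple, with the origin at
bit `51`. -/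
def tripleNbhd (o : ℕ) : ℕ :=
  cond (Nat.beq o 0) 14507515671063710082793472 7254034545418813811720192

/-- The mask of the neighbors of the cells of `m`, layer by layer. -/
def nbrs (m : ℕ) : ℕ :=
  Nat.lor (Nat.lor (Nat.lor (Nat.shiftLeft m 1) (Nat.shiftRight m 1))
    (Nat.lor (Nat.shiftLeft m 16) (Nat.shiftRight m 16)))
    (Nat.lor (Nat.shiftLeft m 15) (Nat.shiftRight m 15))

/-- The cells where the color `c` is possible. -/
def layer (P c : ℕ) : ℕ := Nat.shiftRight P (Nat.mul 256 c)

/-- The cells where some color is possible. -/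
def occ (P : ℕ) : ℕ :=
  Nat.lor (Nat.lor (Nat.lor P (layer P 1)) (Nat.lor (layer P 2) (layer P 3))) (layer P 4)

/-- The cells where at least two colors are possible. -/
def amb (P : ℕ) : ℕ :=
  Nat.lor (Nat.lor (Nat.land P (layer P 1)) (Nat.land (layer P 2) (layer P 3)))
    (Nat.lor (Nat.land (Nat.lor P (layer P 1)) (Nat.lor (layer P 2) (layer P 3)))
      (Nat.land (Nat.lor (Nat.lor P (layer P 1)) (Nat.lor (layer P 2) (layer P 3))) (layer P 4)))

/-- The cells of the patch where exactly one color is possible. -/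
def known (P : ℕ) : ℕ := Nat.land patch (Nat.xor (occ P) (amb P))

/-- Remove the known colors from the neighboring cells, for at most `n` rounds. The result is `0`
if a contradiction is found. -/
def propagate (n : ℕ) : ℕ → ℕ :=
  Nat.rec (fun P => P) (fun _ ih P => force P fun P =>
    cond (Nat.beq (Nat.land patch (occ P)) patch)
      (force (Nat.land P (nbrs (Nat.land P (Nat.mul colorRep (known P))))) fun D =>
        cond (Nat.beq D 0) P (ih (Nat.xor P D)))
      0) n

/-- Assign the color `c` to the cell of index `v`. -/
def assign (P v c : ℕ) : ℕ :=
  Nat.xor P (Nat.land P (Nat.xor (Nat.shiftLeft colorRep v)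
    (Nat.shiftLeft 1 (Nat.add (Nat.mul 256 c) v))))

/-- Exclude the color `c` from the cell of index `v`. -/
def exclude (P v c : ℕ) : ℕ :=
  Nat.xor P (Nat.land P (Nat.shiftLeft 1 (Nat.add (Nat.mul 256 c) v)))

/-- The indices of the `81` cells with coordinates between `-4` and `4`. -/
def cellOf (r : ℕ) : ℕ := Nat.add 68 (Nat.add (Nat.mul 16 (Nat.div r 9)) (Nat.mod r 9))

/-- The cells of the patch at distance at most six from all cells of `C`, if `C` has fewer than
`n` cells. -/
def nearAll (n : ℕ) : ℕ → ℕ :=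
  Nat.rec (fun _ => 0) (fun _ ih C => cond (Nat.beq C 0) patch
      (Nat.land (Nat.shiftRight (Nat.shiftLeft ball (Nat.log2 C)) 102)
        (ih (Nat.xor C (Nat.shiftLeft 1 (Nat.log2 C)))))) n

/-- `m` is contained in `n`. -/
def isSubset (m n : ℕ) : Bool := Nat.beq (Nat.land m n) m

/-- The partial coloring in which everything is possible. -/
def full : ℕ := 2 ^ 1280 - 2 ^ 32

/-- The cells of known color `a`. -/
def knownAs (P a : ℕ) : ℕ := Nat.land (known P) (layer P a)

/-- No neighbor of an `a`-colored cell of `C` that may have color `b` is outside `C`. -/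
def closedFor (P C a b : ℕ) : Bool :=
  isSubset (Nat.land (nbrs (Nat.land C (knownAs P a))) (layer P b)) C

/-- What remains known after interchanging the colors `a` and `b` on `C`. -/
def swapTo (P C a b : ℕ) : ℕ :=
  Nat.lor (Nat.xor full (Nat.mul colorRep (nearAll 5 C)))
    (Nat.xor P (Nat.lor (Nat.shiftLeft C (Nat.mul 256 a)) (Nat.shiftLeft C (Nat.mul 256 b))))

/-- Interchange the colors `a` and `b` on `C` if `C` is certainly a union of Kempe chains. -/
def moveOn (P a b C : ℕ) : List ℕ :=
  cond (and (and (isSubset C (Nat.lor (knownAs P a) (knownAs P b))) (not (Nat.beq a b)))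
      (and (closedFor P C a b) (closedFor P C b a)))
    [propagate 60 (swapTo P C a b)]
    [P]

/-- Enlarge `C` by its neighbors in `k`. -/
def spread (k C : ℕ) : ℕ := Nat.lor C (Nat.land k (nbrs C))

/-- Three rounds of `spread`. -/
def spreadThrice (k C : ℕ) : ℕ := spread k (spread k (spread k C))

/-- Interchange the colors `a` and `b` on the Kempe chain of the cell of index `v`. -/
def move (P v a b : ℕ) : List ℕ :=
  moveOn P a b (spreadThrice (Nat.lor (knownAs P a) (knownAs P b)) (Nat.shiftLeft 1 v))

/-- A partial coloring of the cells near the origin: the list of the `(x + 3, y + 3, c)` such that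
`(x, y)` has color `c`. -/
abbrev Pattern := List (ℕ × ℕ × ℕ)

/-- The index steps, modulo `256`, in the six directions. -/
def dirStep (d : ℕ) : ℕ :=
  cond (Nat.beq d 0) 16 (cond (Nat.beq d 1) 1 (cond (Nat.beq d 2) 241
    (cond (Nat.beq d 3) 240 (cond (Nat.beq d 4) 255 15))))

/-- The directions of the `g`th frame. -/
def frameDir (g d : ℕ) : ℕ :=
  cond (Nat.ble g 5) (Nat.mod (Nat.add g d) 6) (Nat.mod (Nat.add g (Nat.sub 7 d)) 6)

/-- The base `5` digit of `σ` at position `k`. -/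
def digit (σ k : ℕ) : ℕ := Nat.mod (Nat.div σ (Nat.pow 5 k)) 5

/-- The partial coloring `P` contains the image of the pattern `p` under the affine map with index
steps `s` and `t` that sends the index `0` to `A`, with the colors renamed by the digits of `σ`. -/
def matchesAt (P A s t σ : ℕ) (p : Pattern) : Bool :=
  List.rec true (fun e _ ih =>
    cond (Nat.beq
      (Nat.land (Nat.shiftRight P
        (Nat.mod (Nat.add A (Nat.add (Nat.mul e.1 s) (Nat.mul e.2.1 t))) 256)) colorRep)
      (Nat.shiftLeft 1 (Nat.mul 256 (digit σ e.2.2)))) ih false) p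

/-- The five lowest digits of `σ` are pairwise distinct. -/
def isPerm (σ : ℕ) : Bool :=
  Nat.beq 31 (Nat.lor (Nat.shiftLeft 1 (digit σ 0)) (Nat.lor (Nat.shiftLeft 1 (digit σ 1))
    (Nat.lor (Nat.shiftLeft 1 (digit σ 2)) (Nat.lor (Nat.shiftLeft 1 (digit σ 3))
      (Nat.shiftLeft 1 (digit σ 4))))))

/-- Distinguish whether the cell of index `v` has color `c`. -/
def branchesAt (P v c : ℕ) : List ℕ :=
  [propagate 60 (assign P v c), propagate 60 (exclude P v c)]

/-- The branches described by the code `r`. -/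
def branches (P r : ℕ) : List ℕ := branchesAt P (cellOf (Nat.div r 5)) (Nat.mod r 5)

/-- The Kempe change described by the code `r`. -/
def moves (P r : ℕ) : List ℕ :=
  move P (cellOf (Nat.div r 25)) (Nat.mod (Nat.div r 5) 5) (Nat.mod r 5)

/-- Discard `P` if the color `r % 5` is impossible around a triple described by the code `r`. -/
def triples (P r : ℕ) : List ℕ :=
  cond (Nat.beq 0 (Nat.land (layer P (Nat.mod r 5))
      (Nat.shiftRight (Nat.shiftLeft (tripleNbhd (Nat.mod (Nat.div r 5) 2))
        (cellOf (Nat.div r 10))) 51)))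
    [] [P]

/-- Discard `P` if it contains the given image of the pattern `p`. -/
def embeddings (P σ A s t : ℕ) (p : Pattern) : List ℕ :=
  cond (and (isPerm σ) (matchesAt P (Nat.add A (Nat.mul 253 (Nat.add s t))) s t σ p)) [] [P]

/-- Discard `P` if it contains the image described by the code `r` of one of the first `i`
patterns. -/
def patterns (lib : List Pattern) (i P r : ℕ) : List ℕ :=
  cond (Nat.blt (Nat.div r 3037500) i)
    (embeddings P (Nat.mod r 3125) (cellOf (Nat.mod (Nat.div r 37500) 81))
      (dirStep (frameDir (Nat.mod (Nat.div r 3125) 12) 0))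
      (dirStep (frameDir (Nat.mod (Nat.div r 3125) 12) 1))
      (List.getD lib (Nat.div r 3037500) []))
    [P]

/-- Treat the partial coloring `P` by the step with code `q` of type `t`. -/
def record (lib : List Pattern) (i : ℕ) (ih : ℕ → List ℕ → List ℕ → Bool) (cs st : List ℕ)
    (P q t : ℕ) : Bool :=
  cond (Nat.beq t 0) (ih (Nat.div q 405) cs (List.append (branches P (Nat.mod q 405)) st)) <|
  cond (Nat.beq t 1) (ih (Nat.div q 2025) cs (List.append (moves P (Nat.mod q 2025)) st)) <|
  cond (Nat.beq t 2) (ih (Nat.div q 810) cs (List.append (triples P (Nat.mod q 810)) st)) <|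
  ih (Nat.div q 777600000) cs (List.append (patterns lib i P (Nat.mod q 777600000)) st)

/-- Read the next part `c` of the certificate if the current one is exhausted, and treat `P`
otherwise. The number `c` is mixed into irrelevant bits of `P` to keep the steps apart. -/
def step (lib : List Pattern) (i : ℕ) (ih : ℕ → List ℕ → List ℕ → Bool) (cs st : List ℕ)
    (P c : ℕ) : Bool :=
  cond (Nat.ble c 1) (List.rec false (fun c cs' _ => ih c cs' (P :: st)) cs)
    (force (Nat.xor P (Nat.mod c 4294967296)) fun P =>
      record lib i ih cs st P (Nat.div c 4) (Nat.mod c 4))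

/-- Treat the partial coloring `P` unless it is contradictory. -/
def treat (lib : List Pattern) (i : ℕ) (ih : ℕ → List ℕ → List ℕ → Bool) (c : ℕ)
    (cs st : List ℕ) (P : ℕ) : Bool :=
  cond (Nat.beq P 0) (ih c cs st) (force c (step lib i ih cs st P))

/-- Refute all partial colorings in the list by the steps encoded in the certificate, with fuel
`n`, using the first `i` patterns. -/
def run (lib : List Pattern) (i n : ℕ) : ℕ → List ℕ → List ℕ → Bool :=
  Nat.rec (fun _ _ _ => false) (fun _ ih c cs st =>
    List.rec true (fun P st' _ => force P (treat lib i ih c cs st')) st) n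

/-- The partial coloring of the grid given by a pattern. -/
def start (p : Pattern) : ℕ :=
  propagate 60 (List.rec full (fun e _ ih =>
    assign ih (Nat.add 85 (Nat.add (Nat.mul 16 e.1) e.2.1)) e.2.2) p)

lemma force_eq {β : Type} (n : ℕ) (k : ℕ → β) : force n k = k n := by cases n <;> rfl

lemma testBit_natLor (m n i : ℕ) : (Nat.lor m n).testBit i = (m.testBit i || n.testBit i) :=
  Nat.testBit_or ..

lemma testBit_natLand (m n i : ℕ) : (Nat.land m n).testBit i = (m.testBit i && n.testBit i) :=
  Nat.testBit_and ..

lemma testBit_natXor (m n i : ℕ) : (Nat.xor m n).testBit i = (m.testBit i ^^ n.testBit i) :=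
  Nat.testBit_xor ..

lemma testBit_natShiftLeft (m n i : ℕ) :
    (Nat.shiftLeft m n).testBit i = (decide (n ≤ i) && m.testBit (i - n)) :=
  Nat.testBit_shiftLeft ..

lemma testBit_natShiftRight (m n i : ℕ) : (Nat.shiftRight m n).testBit i = m.testBit (n + i) :=
  Nat.testBit_shiftRight ..

lemma testBit_layer (P c i : ℕ) : (layer P c).testBit i = P.testBit (256 * c + i) :=
  testBit_natShiftRight ..

lemma isSubset_spec {m n : ℕ} (h : isSubset m n = true) {i : ℕ} (hi : m.testBit i = true) :
    n.testBit i = true := by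
  rw [← Nat.eq_of_beq_eq_true h, testBit_natLand, Bool.and_eq_true] at hi
  exact hi.2

/-- The cells with both coordinates between `-r` and `r`. -/
def InSquare (r : ℤ) (x : ℤ × ℤ) : Prop := (-r ≤ x.1 ∧ x.1 ≤ r) ∧ -r ≤ x.2 ∧ x.2 ≤ r

lemma InSquare.mono {r s : ℤ} {x : ℤ × ℤ} (h : InSquare r x) (hrs : r ≤ s) : InSquare s x := by
  unfold InSquare at *
  omega

lemma InSquare.inGrid {x : ℤ × ℤ} (h : InSquare 7 x) : InGrid x := by
  unfold InSquare at h
  unfold InGrid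
  omega

lemma InSquare.add_hexDirs {r : ℤ} {x d : ℤ × ℤ} (h : InSquare r x) (hd : d ∈ hexDirs) :
    InSquare (r + 1) (x + d) := by
  rw [mem_hexDirs] at hd
  unfold InSquare at *
  rcases hd with rfl | rfl | rfl | rfl | rfl | rfl <;> simp only [Prod.fst_add, Prod.snd_add] <;>
    omega

lemma gridIdx_lt {x : ℤ × ℤ} (h : InGrid x) : gridIdx x < 256 := by
  unfold InGrid at h
  unfold gridIdx
  omega

lemma testBit_nbrs {m c : ℕ} {x : ℤ × ℤ} (hx : InSquare 6 x) :
    (nbrs m).testBit (256 * c + gridIdx x) = true ↔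
      ∃ d ∈ hexDirs, m.testBit (256 * c + gridIdx (x + d)) = true := by
  unfold InSquare at hx
  have e1 : gridIdx (x + (1, 0)) = gridIdx x + 16 := by
    simp only [gridIdx, Prod.fst_add, Prod.snd_add]; omega
  have e2 : gridIdx (x + (0, 1)) = gridIdx x + 1 := by
    simp only [gridIdx, Prod.fst_add, Prod.snd_add]; omega
  have e3 : gridIdx (x + (-1, 1)) = gridIdx x - 15 := by
    simp only [gridIdx, Prod.fst_add, Prod.snd_add]; omega
  have e4 : gridIdx (x + (-1, 0)) = gridIdx x - 16 := by
    simp only [gridIdx, Prod.fst_add, Prod.snd_add]; omega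
  have e5 : gridIdx (x + (0, -1)) = gridIdx x - 1 := by
    simp only [gridIdx, Prod.fst_add, Prod.snd_add]; omega
  have e6 : gridIdx (x + (1, -1)) = gridIdx x + 15 := by
    simp only [gridIdx, Prod.fst_add, Prod.snd_add]; omega
  have hge : 32 ≤ gridIdx x := by unfold gridIdx; omega
  simp only [nbrs, testBit_natLor, testBit_natShiftLeft, testBit_natShiftRight, Bool.or_eq_true,
    Bool.and_eq_true, decide_eq_true_eq, hexDirs, Finset.mem_insert, Finset.mem_singleton,
    exists_eq_or_imp, exists_eq_left, e1, e2, e3, e4, e5, e6]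
  have h1 : 1 ≤ 256 * c + gridIdx x := by omega
  have h15 : 15 ≤ 256 * c + gridIdx x := by omega
  have h16 : 16 ≤ 256 * c + gridIdx x := by omega
  rw [show 256 * c + gridIdx x - 1 = 256 * c + (gridIdx x - 1) by omega,
    show 256 * c + gridIdx x - 15 = 256 * c + (gridIdx x - 15) by omega,
    show 256 * c + gridIdx x - 16 = 256 * c + (gridIdx x - 16) by omega,
    show 1 + (256 * c + gridIdx x) = 256 * c + (gridIdx x + 1) by omega,
    show 15 + (256 * c + gridIdx x) = 256 * c + (gridIdx x + 15) by omega,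
    show 16 + (256 * c + gridIdx x) = 256 * c + (gridIdx x + 16) by omega]
  tauto

lemma patch_lt : patch < 2 ^ 256 := by decide +kernel

lemma patch_spec {i : ℕ} (h : patch.testBit i = true) :
    ∃ x : ℤ × ℤ, InSquare 4 x ∧ gridIdx x = i := by
  have hi : i < 256 := by
    by_contra! hi
    rw [Nat.testBit_lt_two_pow (patch_lt.trans_le (Nat.pow_le_pow_right (by norm_num) hi))] at h
    exact absurd h (by decide)
  have key : ∀ i < 256, patch.testBit i = true → (4 ≤ i / 16 ∧ i / 16 ≤ 12) ∧
    4 ≤ i % 16 ∧ i % 16 ≤ 12 := by decide +kernel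
  have := key i hi h
  exact ⟨((i / 16 : ℕ) - 8, (i % 16 : ℕ) - 8), by unfold InSquare; simp only; omega,
    by simp only [gridIdx]; omega⟩

lemma inSquare_of_patch {x : ℤ × ℤ} (hx : InGrid x) (h : patch.testBit (gridIdx x) = true) :
    InSquare 4 x := by
  obtain ⟨y, hy, hyx⟩ := patch_spec h
  exact gridIdx_inj (hy.mono (by norm_num)).inGrid hx hyx ▸ hy

lemma testBit_two_pow_mul_add_block {n m a c i : ℕ} (hm : m < 2 ^ n) (hi : i < n) :
    (2 ^ n * a + m).testBit (n * c + i) =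
      if c = 0 then m.testBit i else a.testBit (n * (c - 1) + i) := by
  rw [Nat.testBit_two_pow_mul_add _ hm]
  cases c with
  | zero => simp [hi]
  | succ c =>
    have : n * (c + 1) + i - n = n * c + i := by rw [mul_add, mul_one]; omega
    rw [if_neg (by rw [mul_add, mul_one]; omega), if_neg (by omega), this, Nat.add_sub_cancel]

lemma testBit_repeat_mul {n m c i : ℕ} (hm : m < 2 ^ n) (hc : c < 5) (hi : i < n) :
    ((1 + 2 ^ n + (2 ^ n) ^ 2 + (2 ^ n) ^ 3 + (2 ^ n) ^ 4) * m).testBit (n * c + i) =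
      m.testBit i := by
  rw [show (1 + 2 ^ n + (2 ^ n) ^ 2 + (2 ^ n) ^ 3 + (2 ^ n) ^ 4) * m =
    2 ^ n * (2 ^ n * (2 ^ n * (2 ^ n * m + m) + m) + m) + m by ring]
  iterate 4 rw [testBit_two_pow_mul_add_block hm hi]
  interval_cases c <;> simp

lemma testBit_colorRep_mul {m c i : ℕ} (hm : m < 2 ^ 256) (hc : c < 5) (hi : i < 256) :
    (Nat.mul colorRep m).testBit (256 * c + i) = m.testBit i := by
  have e : colorRep = 1 + 2 ^ 256 + (2 ^ 256) ^ 2 + (2 ^ 256) ^ 3 + (2 ^ 256) ^ 4 := by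
    decide +kernel
  change (colorRep * m).testBit _ = _
  rw [e]
  exact testBit_repeat_mul hm hc hi

/-- The coloring `ψ` is compatible with the encoded partial coloring `P`. -/
def Models (ψ : ℤ × ℤ → Fin 5) (P : ℕ) : Prop :=
  ∀ x, InSquare 6 x → P.testBit (256 * (ψ x : ℕ) + gridIdx x) = true

/-- No coloring of the class `𝒞` is compatible with the encoded partial coloring `P`. -/
def Refuted (𝒞 : Set (ℤ × ℤ → Fin 5)) (P : ℕ) : Prop := ∀ ψ ∈ 𝒞, ¬ Models ψ P

lemma refuted_zero (𝒞 : Set (ℤ × ℤ → Fin 5)) : Refuted 𝒞 0 := by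
  intro ψ _ h
  have := h (0, 0) (by unfold InSquare; omega)
  rw [Nat.zero_testBit] at this
  exact absurd this (by decide)

lemma occ_of_testBit {P c i : ℕ} (hc : c < 5) (h : P.testBit (256 * c + i) = true) :
    (occ P).testBit i = true := by
  simp only [occ, testBit_natLor, testBit_layer, Bool.or_eq_true]
  interval_cases c <;> simp_all

lemma known_lt (P : ℕ) : known P < 2 ^ 256 := lt_of_le_of_lt Nat.and_le_left patch_lt

lemma known_unique {P c c' i : ℕ} (hc : c < 5) (hc' : c' < 5) (h : (known P).testBit i = true)
    (h1 : P.testBit (256 * c + i) = true) (h2 : P.testBit (256 * c' + i) = true) : c = c' := by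
  have hocc := occ_of_testBit hc h1
  rw [known, testBit_natLand, testBit_natXor, hocc, Bool.and_eq_true] at h
  have hamb : (amb P).testBit i = false := by simpa using h.2
  have key : ∀ b : Fin 5 → Bool, ((b 0 && b 1) || (b 2 && b 3) ||
      (((b 0 || b 1) && (b 2 || b 3)) || ((b 0 || b 1 || (b 2 || b 3)) && b 4))) = false →
      ∀ c c' : Fin 5, b c = true → b c' = true → c = c' := by decide +kernel
  have := key (fun c => P.testBit (256 * (c : ℕ) + i)) (by
    rw [← hamb]
    simp only [amb, testBit_natLor, testBit_natLand, testBit_layer]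
    simp) ⟨c, hc⟩ ⟨c', hc'⟩ h1 h2
  exact congrArg Fin.val this

lemma known_spec {ψ : ℤ × ℤ → Fin 5} {P : ℕ} (hP : Models ψ P) {x : ℤ × ℤ} (hx : InGrid x)
    (h : (known P).testBit (gridIdx x) = true) :
    InSquare 4 x ∧ ∀ c < 5, P.testBit (256 * c + gridIdx x) = true → c = ψ x := by
  have h4 : InSquare 4 x := by
    rw [known, testBit_natLand, Bool.and_eq_true] at h
    exact inSquare_of_patch hx h.1
  exact ⟨h4, fun c hc h' => known_unique hc (ψ x).isLt h h' (hP x (h4.mono (by norm_num)))⟩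

lemma knownAs_spec {ψ : ℤ × ℤ → Fin 5} {P a : ℕ} (hP : Models ψ P) (ha : a < 5) {x : ℤ × ℤ}
    (hx : InGrid x) (h : (knownAs P a).testBit (gridIdx x) = true) :
    InSquare 4 x ∧ (known P).testBit (gridIdx x) = true ∧ a = ψ x := by
  rw [knownAs, testBit_natLand, Bool.and_eq_true, testBit_layer] at h
  have := known_spec hP hx h.1
  exact ⟨this.1, h.1, this.2 a ha h.2⟩

section

variable {𝒞 : Set (ℤ × ℤ → Fin 5)} {ψ : ℤ × ℤ → Fin 5} {P : ℕ}

lemma propagate_succ (n P : ℕ) : propagate (n + 1) P = force P fun P =>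
    cond (Nat.beq (Nat.land patch (occ P)) patch)
      (force (Nat.land P (nbrs (Nat.land P (Nat.mul colorRep (known P))))) fun D =>
        cond (Nat.beq D 0) P (propagate n (Nat.xor P D))) 0 := rfl

lemma models_propagate (h𝒞 : LatticeClass 𝒞) (hψ : ψ ∈ 𝒞) (n : ℕ) (hP : Models ψ P) :
    Models ψ (propagate n P) := by
  induction n generalizing P with
  | zero => exact hP
  | succ n ih =>
    rw [propagate_succ, force_eq]
    have hocc : Nat.beq (Nat.land patch (occ P)) patch = true := by
      refine Eq.mpr Nat.beq_eq (Nat.eq_of_testBit_eq fun i => ?_)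
      rw [testBit_natLand]
      by_cases hi : patch.testBit i = true
      · obtain ⟨x, hx, rfl⟩ := patch_spec hi
        rw [hi, occ_of_testBit (ψ x).isLt (hP x (hx.mono (by norm_num)))]
        rfl
      · rw [Bool.not_eq_true] at hi
        rw [hi, Bool.false_and]
    rw [hocc, cond_true, force_eq]
    generalize Nat.beq (Nat.land P (nbrs (Nat.land P (Nat.mul colorRep (known P))))) 0 = t
    cases t
    · refine ih fun x hx => ?_
      have hPx := hP x hx
      rw [testBit_natXor, testBit_natLand, hPx, Bool.true_and, Bool.true_xor, Bool.not_eq_true',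
        ← Bool.not_eq_true, testBit_nbrs hx]
      rintro ⟨d, hd, h⟩
      have hxd := (hx.add_hexDirs hd).inGrid
      rw [testBit_natLand, Bool.and_eq_true,
        testBit_colorRep_mul (known_lt P) (ψ x).isLt (gridIdx_lt hxd)] at h
      exact h𝒞.proper ψ hψ x d hd (Fin.ext ((known_spec hP hxd h.2).2 _ (ψ x).isLt h.1)).symm
    · exact hP

lemma testBit_shiftLeft_one {v i : ℕ} :
    (Nat.shiftLeft 1 v).testBit i = decide (v = i) := by
  rw [show Nat.shiftLeft 1 v = 2 ^ v from Nat.one_shiftLeft v, Nat.testBit_two_pow]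

lemma testBit_colorRep_shiftLeft {v c i : ℕ} (hv : v < 256) (hc : c < 5) (hi : i < 256) :
    (Nat.shiftLeft colorRep v).testBit (256 * c + i) = decide (v = i) := by
  have : Nat.shiftLeft colorRep v = Nat.mul colorRep (2 ^ v) := Nat.shiftLeft_eq colorRep v
  rw [this, testBit_colorRep_mul (Nat.pow_lt_pow_right (by norm_num) hv) hc hi,
    Nat.testBit_two_pow]

lemma models_assign (hP : Models ψ P) {x : ℤ × ℤ} (hx : InGrid x) {c : ℕ} (h : (ψ x : ℕ) = c) :
    Models ψ (assign P (gridIdx x) c) := by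
  intro y hy
  have hy' := (hy.mono (show (6 : ℤ) ≤ 7 by norm_num)).inGrid
  rw [assign, testBit_natXor, testBit_natLand, hP y hy, Bool.true_and, Bool.true_xor,
    Bool.not_eq_true', testBit_natXor, testBit_shiftLeft_one,
    testBit_colorRep_shiftLeft (gridIdx_lt hx) (ψ y).isLt (gridIdx_lt hy')]
  by_cases hxy : gridIdx x = gridIdx y
  · obtain rfl := gridIdx_inj hx hy' hxy
    simp [h]
  · have h1 := gridIdx_lt hx
    have h2 := gridIdx_lt hy'
    have : ¬ 256 * c + gridIdx x = 256 * (ψ y : ℕ) + gridIdx y := by omega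
    simp only [hxy, decide_false, Bool.false_xor]
    exact decide_eq_false this

lemma models_exclude (hP : Models ψ P) {x : ℤ × ℤ} (hx : InGrid x) {c : ℕ} (h : (ψ x : ℕ) ≠ c) :
    Models ψ (exclude P (gridIdx x) c) := by
  intro y hy
  have hy' := (hy.mono (show (6 : ℤ) ≤ 7 by norm_num)).inGrid
  rw [exclude, testBit_natXor, testBit_natLand, hP y hy, Bool.true_and, Bool.true_xor,
    Bool.not_eq_true', testBit_shiftLeft_one]
  refine decide_eq_false fun he => ?_
  change 256 * c + gridIdx x = _ at he
  have h1 := gridIdx_lt hx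
  have h2 := gridIdx_lt hy'
  obtain rfl := gridIdx_inj hx hy' (by omega)
  omega

lemma cellOf_spec {r : ℕ} (hr : r < 81) : ∃ x : ℤ × ℤ, InSquare 4 x ∧ cellOf r = gridIdx x := by
  refine ⟨((r / 9 : ℕ) - 4, (r % 9 : ℕ) - 4), by unfold InSquare; simp only; omega, ?_⟩
  change 68 + (16 * (r / 9) + r % 9) = _
  simp only [gridIdx]
  omega

lemma refuted_of_branches (h𝒞 : LatticeClass 𝒞) {r : ℕ} (hr : r < 405)
    (h : ∀ Q ∈ branches P r, Refuted 𝒞 Q) : Refuted 𝒞 P := by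
  obtain ⟨x, hx, hcell⟩ := cellOf_spec (r := Nat.div r 5) (Nat.div_lt_of_lt_mul (by omega))
  have hx' := (hx.mono (show (4 : ℤ) ≤ 7 by norm_num)).inGrid
  simp only [branches, branchesAt, hcell, List.forall_mem_cons] at h
  intro ψ hψ hP
  by_cases hc : (ψ x : ℕ) = Nat.mod r 5
  · exact h.1 ψ hψ (models_propagate h𝒞 hψ _ (models_assign hP hx' hc))
  · exact h.2.1 ψ hψ (models_propagate h𝒞 hψ _ (models_exclude hP hx' hc))

end

lemma ball_spec {k : ℕ} (h : ball.testBit k = true) : ∃ d : ℤ × ℤ,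
    ((|d.1| ≤ 6 ∧ |d.2| ≤ 6) ∧ |d.1 + d.2| ≤ 6) ∧ (k : ℤ) = 102 + 16 * d.1 + d.2 := by
  have hlt : ball < 2 ^ 256 := by decide +kernel
  have hk : k < 256 := by
    by_contra! hk
    rw [Nat.testBit_lt_two_pow (hlt.trans_le (Nat.pow_le_pow_right (by norm_num) hk))] at h
    exact absurd h (by decide)
  have key : ∀ k < 256, ball.testBit k = true → ((2 ≤ (k + 34) / 16 ∧ (k + 34) / 16 ≤ 14) ∧
    2 ≤ (k + 34) % 16 ∧ (k + 34) % 16 ≤ 14) ∧ 10 ≤ (k + 34) / 16 + (k + 34) % 16 ∧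
      (k + 34) / 16 + (k + 34) % 16 ≤ 22 := by decide +kernel
  have := key k hk h
  refine ⟨(((k + 34) / 16 : ℕ) - 8, ((k + 34) % 16 : ℕ) - 8), ?_, ?_⟩
  · simp only [abs_le]
    omega
  · simp only
    omega

lemma lt_of_subset_patch {C : ℕ} (hC : ∀ i, C.testBit i = true → patch.testBit i = true) :
    C < 2 ^ 256 := by
  refine Nat.lt_pow_two_of_testBit _ fun i hi => ?_
  rw [← Bool.not_eq_true]
  intro h
  have := hC i h
  rw [Nat.testBit_lt_two_pow (patch_lt.trans_le (Nat.pow_le_pow_right (by norm_num) hi))] at this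
  exact absurd this (by decide)

lemma nearAll_lt (n C : ℕ) : nearAll n C < 2 ^ 256 := by
  induction n generalizing C with
  | zero => exact Nat.two_pow_pos 256
  | succ n ih =>
    change cond (Nat.beq C 0) patch (Nat.land _ (nearAll n _)) < _
    cases Nat.beq C 0
    · exact lt_of_le_of_lt Nat.and_le_right (ih _)
    · exact patch_lt

lemma nearAll_spec {n C : ℕ} (hC : ∀ i, C.testBit i = true → patch.testBit i = true) {y : ℤ × ℤ}
    (hy : InGrid y) (h : (nearAll n C).testBit (gridIdx y) = true) :
    InSquare 4 y ∧ ∀ x, InGrid x → C.testBit (gridIdx x) = true → Near y x := by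
  induction n generalizing C with
  | zero =>
    change (0 : ℕ).testBit _ = true at h
    rw [Nat.zero_testBit] at h
    exact absurd h (by decide)
  | succ n ih =>
    change (cond (Nat.beq C 0) patch (Nat.land _ (nearAll n _))).testBit _ = true at h
    cases hC0 : Nat.beq C 0
    · rw [hC0, cond_false, testBit_natLand, Bool.and_eq_true, testBit_natShiftRight,
        testBit_natShiftLeft, Bool.and_eq_true, decide_eq_true_eq] at h
      have hne : C ≠ 0 := by
        rintro rfl
        exact absurd hC0 (by decide)
      have hsub : ∀ i, (Nat.xor C (Nat.shiftLeft 1 C.log2)).testBit i = true ↔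
          C.testBit i = true ∧ i ≠ C.log2 := by
        intro i
        rw [testBit_natXor, testBit_shiftLeft_one]
        by_cases hi : C.log2 = i
        · subst hi
          simp [Nat.testBit_log2 hne]
        · simp [hi, Ne.symm hi]
      obtain ⟨h4, hnear⟩ := ih (fun i hi => hC i ((hsub i).1 hi).1) h.2
      refine ⟨h4, fun x hx hCx => ?_⟩
      by_cases hxl : gridIdx x = C.log2
      · obtain ⟨d, hd, hdk⟩ := ball_spec h.1.2
        have hx4 := inSquare_of_patch hx (hC _ hCx)
        rw [← hxl] at hdk h
        have h1 := h.1.1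
        simp only [abs_le] at hd
        simp only [Near, abs_le]
        unfold InSquare at h4 hx4
        unfold gridIdx at hdk h1
        omega
      · exact hnear x hx ((hsub _).2 ⟨hCx, hxl⟩)
    · obtain rfl := Nat.eq_of_beq_eq_true hC0
      rw [hC0, cond_true] at h
      refine ⟨inSquare_of_patch hy h, fun x _ hx => ?_⟩
      rw [Nat.zero_testBit] at hx
      exact absurd hx (by decide)

lemma testBit_shiftLeft_block {C a b i : ℕ} (hC : C < 2 ^ 256) (hi : i < 256) :
    (Nat.shiftLeft C (Nat.mul 256 a)).testBit (256 * b + i) = (decide (a = b) && C.testBit i) := by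
  rw [testBit_natShiftLeft, show Nat.mul 256 a = 256 * a from rfl]
  rcases lt_trichotomy a b with h | rfl | h
  · rw [Nat.testBit_lt_two_pow (hC.trans_le (Nat.pow_le_pow_right (by norm_num)
      (show 256 ≤ 256 * b + i - 256 * a by omega))), Bool.and_false, decide_eq_false h.ne,
      Bool.false_and]
  · rw [Nat.add_sub_cancel_left, decide_eq_true (by omega), decide_eq_true rfl]
  · rw [decide_eq_false (by omega), decide_eq_false h.ne', Bool.false_and, Bool.false_and]

lemma testBit_full {c : ℕ} (hc : c < 5) {x : ℤ × ℤ} (hx : InSquare 6 x) :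
    full.testBit (256 * c + gridIdx x) = true := by
  have key : ∀ i < 1280, 32 ≤ i → full.testBit i = true := by decide +kernel
  unfold InSquare at hx
  refine key _ ?_ ?_ <;> unfold gridIdx <;> omega

section

variable {𝒞 : Set (ℤ × ℤ → Fin 5)} {ψ : ℤ × ℤ → Fin 5} {P : ℕ}

lemma closedFor_spec (h𝒞 : LatticeClass 𝒞) (hψ : ψ ∈ 𝒞) (hP : Models ψ P) {C : ℕ} {α β : Fin 5}
    (h : closedFor P C α β = true) {x d : ℤ × ℤ} (hx : InSquare 4 x) (hd : d ∈ hexDirs)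
    (hCx : C.testBit (gridIdx x) = true) (hα : (knownAs P α).testBit (gridIdx x) = true)
    (hxd : C.testBit (gridIdx (x + d)) ≠ true) : ψ (x + d) ≠ α ∧ ψ (x + d) ≠ β := by
  have hxα : α = ψ x := Fin.ext
    (knownAs_spec hP α.isLt (hx.mono (show (4 : ℤ) ≤ 7 by norm_num)).inGrid hα).2.2
  have hxd6 : InSquare 6 (x + d) := (hx.add_hexDirs hd).mono (by norm_num)
  refine ⟨fun h' => h𝒞.proper ψ hψ x d hd (h'.trans hxα), fun h' => hxd (isSubset_spec h ?_)⟩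
  have hnbrs := (testBit_nbrs (m := Nat.land C (knownAs P α)) (c := 0) hxd6).2
    ⟨-d, by rw [mem_hexDirs] at hd ⊢; rcases hd with rfl | rfl | rfl | rfl | rfl | rfl <;> decide, by
      rw [add_neg_cancel_right, mul_zero, zero_add, testBit_natLand, hCx, hα, Bool.and_self]⟩
  rw [mul_zero, zero_add] at hnbrs
  rw [testBit_natLand, hnbrs, testBit_layer, ← h', hP _ hxd6, Bool.and_self]

lemma exists_models_swapTo (h𝒞 : LatticeClass 𝒞) (hψ : ψ ∈ 𝒞) (hP : Models ψ P) {C : ℕ}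
    {α β : Fin 5} (hαβ : α ≠ β)
    (hC : isSubset C (Nat.lor (knownAs P α) (knownAs P β)) = true)
    (h1 : closedFor P C α β = true) (h2 : closedFor P C β α = true) :
    ∃ ψ' ∈ 𝒞, Models ψ' (swapTo P C α β) := by
  have hC' : ∀ i, C.testBit i = true →
      (knownAs P α).testBit i = true ∨ (knownAs P β).testBit i = true := by
    intro i hi
    have := isSubset_spec hC hi
    rwa [testBit_natLor, Bool.or_eq_true] at this
  have hpatch : ∀ i, C.testBit i = true → patch.testBit i = true := by
    intro i hi
    rcases hC' i hi with h | h <;>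
    · rw [knownAs, testBit_natLand, known, testBit_natLand, Bool.and_eq_true,
        Bool.and_eq_true] at h
      exact h.1.1
  have hlt := lt_of_subset_patch hpatch
  set S : Finset (ℤ × ℤ) := {x ∈ Finset.Icc (-4, -4) (4, 4) | C.testBit (gridIdx x) = true} with hS
  have hmem : ∀ x, x ∈ S ↔ InSquare 4 x ∧ C.testBit (gridIdx x) = true := by
    intro x
    simp only [hS, Finset.mem_filter, Finset.mem_Icc, Prod.le_def, InSquare]
    tauto
  have hmem' : ∀ x, InGrid x → C.testBit (gridIdx x) = true → x ∈ S := fun x hx hCx =>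
    (hmem x).2 ⟨inSquare_of_patch hx (hpatch _ hCx), hCx⟩
  obtain ⟨ψ', hψ', hin, hout⟩ := h𝒞.swap ψ hψ S α β (fun x hx => by
      have hx4 := ((hmem x).1 hx).1
      have hx7 := (hx4.mono (show (4 : ℤ) ≤ 7 by norm_num)).inGrid
      rcases hC' _ ((hmem x).1 hx).2 with h | h
      · exact Or.inl (Fin.ext (knownAs_spec hP α.isLt hx7 h).2.2).symm
      · exact Or.inr (Fin.ext (knownAs_spec hP β.isLt hx7 h).2.2).symm)
    (fun x hx d hd hxd => by
      obtain ⟨hx4, hCx⟩ := (hmem x).1 hx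
      have hxd' : C.testBit (gridIdx (x + d)) ≠ true := fun h =>
        hxd (hmem' _ ((hx4.add_hexDirs hd).mono (by norm_num)).inGrid h)
      rcases hC' _ hCx with h | h
      · exact closedFor_spec h𝒞 hψ hP h1 hx4 hd hCx h hxd'
      · exact (closedFor_spec h𝒞 hψ hP h2 hx4 hd hCx h hxd').symm)
  refine ⟨ψ', hψ', fun x hx => ?_⟩
  have hx7 := (hx.mono (show (6 : ℤ) ≤ 7 by norm_num)).inGrid
  have hi := gridIdx_lt hx7
  rw [swapTo, testBit_natLor, testBit_natXor, testBit_full (ψ' x).isLt hx,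
    testBit_colorRep_mul (nearAll_lt 5 C) (ψ' x).isLt hi, Bool.true_xor]
  cases hnear : (nearAll 5 C).testBit (gridIdx x)
  · rfl
  rw [Bool.not_true, Bool.false_or, testBit_natXor, testBit_natLor, testBit_shiftLeft_block hlt hi,
    testBit_shiftLeft_block hlt hi]
  by_cases hxS : x ∈ S
  · have hCx := ((hmem x).1 hxS).2
    have hsplit : ∀ γ δ : Fin 5, γ ≠ δ → (knownAs P γ).testBit (gridIdx x) = true → ψ x = γ ∧
        P.testBit (256 * (δ : ℕ) + gridIdx x) = false := by
      intro γ δ hγδ h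
      obtain ⟨-, hk, hγ⟩ := knownAs_spec hP γ.isLt hx7 h
      refine ⟨(Fin.ext hγ).symm, ?_⟩
      rw [← Bool.not_eq_true]
      exact fun hδ => hγδ (Fin.ext (hγ.trans ((known_spec hP hx7 hk).2 _ δ.isLt hδ).symm))
    rw [hin x hxS, hCx]
    rcases hC' _ hCx with h | h
    · obtain ⟨e, hbit⟩ := hsplit α β hαβ h
      rw [e, Equiv.swap_apply_left, hbit]
      simp
    · obtain ⟨e, hbit⟩ := hsplit β α hαβ.symm h
      rw [e, Equiv.swap_apply_right, hbit]
      simp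
  · have hCx : C.testBit (gridIdx x) = false := by
      rw [← Bool.not_eq_true]
      exact fun h => hxS (hmem' x hx7 h)
    have hnearS : ∀ y ∈ S, Near x y := fun y hy =>
      (nearAll_spec hpatch hx7 hnear).2 y
        (((hmem y).1 hy).1.mono (show (4 : ℤ) ≤ 7 by norm_num)).inGrid ((hmem y).1 hy).2
    rw [hout x hxS hnearS, hP x hx, hCx]
    simp

lemma refuted_of_moveOn (h𝒞 : LatticeClass 𝒞) {α β : Fin 5} {C : ℕ}
    (h : ∀ Q ∈ moveOn P α β C, Refuted 𝒞 Q) : Refuted 𝒞 P := by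
  intro ψ hψ hP
  unfold moveOn at h
  cases hc : and (and (isSubset C (Nat.lor (knownAs P α) (knownAs P β)))
    (not (Nat.beq (α : ℕ) (β : ℕ)))) (and (closedFor P C α β) (closedFor P C β α))
  · rw [hc, cond_false] at h
    exact h P List.mem_cons_self ψ hψ hP
  · rw [hc, cond_true] at h
    simp only [Bool.and_eq_true, Bool.not_eq_true'] at hc
    obtain ⟨ψ', hψ', hP'⟩ := exists_models_swapTo h𝒞 hψ hP (α := α) (β := β) (C := C)
      (by rintro rfl; simpa using hc.1.2) hc.1.1 hc.2.1 hc.2.2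
    exact h _ List.mem_cons_self ψ' hψ' (models_propagate h𝒞 hψ' _ hP')

lemma refuted_of_moves (h𝒞 : LatticeClass 𝒞) {r : ℕ} (h : ∀ Q ∈ moves P r, Refuted 𝒞 Q) :
    Refuted 𝒞 P :=
  refuted_of_moveOn (α := ⟨r / 5 % 5, Nat.mod_lt _ (by norm_num)⟩)
    (β := ⟨r % 5, Nat.mod_lt _ (by norm_num)⟩) h𝒞 h

lemma tripleNbhd_spec {o : ℕ} (ho : o < 2) {x d : ℤ × ℤ} (hx : x ∈ tripleCells)
    (hd : d ∈ hexDirs) : (tripleNbhd o).testBit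
      (51 + (1 - 2 * (o : ℤ)) * (16 * (x + d).1 + (x + d).2)).toNat = true := by
  have key : ∀ o < 2, ∀ x ∈ tripleCells, ∀ d ∈ hexDirs, (tripleNbhd o).testBit
      (51 + (1 - 2 * (o : ℤ)) * (16 * (x + d).1 + (x + d).2)).toNat = true := by decide +kernel
  exact key o ho x hx d hd

lemma refuted_of_triples (h𝒞 : LatticeClass 𝒞) {r : ℕ} (hr : r < 810)
    (h : ∀ Q ∈ triples P r, Refuted 𝒞 Q) : Refuted 𝒞 P := by
  intro ψ hψ hP
  obtain ⟨w, hw, hcell⟩ := cellOf_spec (r := Nat.div r 10) (Nat.div_lt_of_lt_mul (by omega))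
  unfold triples at h
  rw [hcell] at h
  cases hc : Nat.beq 0 (Nat.land (layer P (Nat.mod r 5)) (Nat.shiftRight (Nat.shiftLeft
    (tripleNbhd (Nat.mod (Nat.div r 5) 2)) (gridIdx w)) 51))
  · rw [hc, cond_false] at h
    exact h P List.mem_cons_self ψ hψ hP
  have ho : Nat.mod (Nat.div r 5) 2 < 2 := Nat.mod_lt _ (by norm_num)
  generalize Nat.mod (Nat.div r 5) 2 = o at hc ho
  obtain ⟨x, hx, d, hd, hc'⟩ := h𝒞.exists_near_triple_frame hψ
    (d₁ := (1 - 2 * (o : ℤ), 0)) (d₂ := (0, 1 - 2 * (o : ℤ))) (by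
      interval_cases o <;> decide) w ⟨Nat.mod r 5, Nat.mod_lt _ (by norm_num)⟩
  have hbit := tripleNbhd_spec ho hx hd
  have hxd : InSquare 2 (x + d) := by
    have key : ∀ x ∈ tripleCells, InSquare 1 x := by
      simp [tripleCells, InSquare]
    exact (key x hx).add_hexDirs hd
  have hs : InSquare 6 (w + frameMap (1 - 2 * (o : ℤ), 0) (0, 1 - 2 * (o : ℤ)) (x + d)) ∧
      gridIdx w + (51 + (1 - 2 * (o : ℤ)) * (16 * (x + d).1 + (x + d).2)).toNat =
      51 + gridIdx (w + frameMap (1 - 2 * (o : ℤ), 0) (0, 1 - 2 * (o : ℤ)) (x + d)) := by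
    generalize x + d = y at hxd
    clear hc' hbit hc h hcell hP
    unfold InSquare at *
    interval_cases o <;> simp only [gridIdx, frameMap, Prod.fst_add, Prod.snd_add] <;> omega
  have hPx := hP _ hs.1
  rw [hc'] at hPx
  have h0 := Nat.eq_of_beq_eq_true hc
  have : (0 : ℕ).testBit (gridIdx (w + frameMap (1 - 2 * (o : ℤ), 0) (0, 1 - 2 * (o : ℤ))
      (x + d))) = true := by
    rw [h0, testBit_natLand, testBit_layer, hPx, Bool.true_and, testBit_natShiftRight, ← hs.2,
      testBit_natShiftLeft, Nat.add_sub_cancel_left, hbit, decide_eq_true (Nat.le_add_right _ _)]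
    rfl
  rw [Nat.zero_testBit] at this
  exact absurd this (by decide)

end

/-- The coloring `ψ` contains the pattern `p`. -/
def Fits (ψ : ℤ × ℤ → Fin 5) (p : Pattern) : Prop :=
  ∀ e ∈ p, (ψ ((e.1 : ℤ) - 3, (e.2.1 : ℤ) - 3) : ℕ) = e.2.2

/-- No coloring of the class `𝒞` contains the pattern `p`. -/
def Excluded (𝒞 : Set (ℤ × ℤ → Fin 5)) (p : Pattern) : Prop := ∀ ψ ∈ 𝒞, ¬ Fits ψ p

/-- The cells of the pattern are at distance at most two from the origin, and its colors are
smaller than five. -/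
def WellFormed (p : Pattern) : Prop :=
  ∀ e ∈ p, (((1 ≤ e.1 ∧ e.1 ≤ 5) ∧ 1 ≤ e.2.1 ∧ e.2.1 ≤ 5) ∧ 4 ≤ e.1 + e.2.1 ∧
    e.1 + e.2.1 ≤ 8) ∧ e.2.2 < 5

instance (p : Pattern) : Decidable (WellFormed p) := inferInstanceAs (Decidable (∀ e ∈ p, _))

lemma exists_perm_of_isPerm {σ : ℕ} (h : isPerm σ = true) :
    ∃ τ : Equiv.Perm (Fin 5), ∀ k : Fin 5, (τ k : ℕ) = digit σ k := by
  let f : Fin 5 → Fin 5 := fun k => ⟨digit σ k, Nat.mod_lt _ (by norm_num)⟩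
  have hf : Function.Surjective f := by
    intro j
    have hj : (31 : ℕ).testBit j = true := by
      have key : ∀ j : Fin 5, (31 : ℕ).testBit j = true := by decide
      exact key j
    rw [Nat.eq_of_beq_eq_true h] at hj
    simp only [testBit_natLor, testBit_shiftLeft_one, Bool.or_eq_true, decide_eq_true_eq] at hj
    rcases hj with h | h | h | h | h
    exacts [⟨0, Fin.ext h⟩, ⟨1, Fin.ext h⟩, ⟨2, Fin.ext h⟩, ⟨3, Fin.ext h⟩, ⟨4, Fin.ext h⟩]
  exact ⟨Equiv.ofBijective f ⟨Finite.injective_iff_surjective.2 hf, hf⟩, fun _ => rfl⟩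

lemma exists_frame {g : ℕ} (hg : g < 12) : ∃ d₁ d₂, IsFrame d₁ d₂ ∧
    (∃ k : ℤ, (dirStep (frameDir g 0) : ℤ) = 16 * d₁.1 + d₁.2 + 256 * k) ∧
      ∃ k : ℤ, (dirStep (frameDir g 1) : ℤ) = 16 * d₂.1 + d₂.2 + 256 * k := by
  have key : ∀ g < 12, ∃ q ∈ frames, IsFrame q.1 q.2 ∧
      (dirStep (frameDir g 0) : ℤ) % 256 = (16 * q.1.1 + q.1.2) % 256 ∧
      (dirStep (frameDir g 1) : ℤ) % 256 = (16 * q.2.1 + q.2.2) % 256 := by decide +kernel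
  have key' : ∀ a b : ℤ, a % 256 = b % 256 → ∃ k, a = b + 256 * k := fun a b h =>
    ⟨a / 256 - b / 256, by omega⟩
  obtain ⟨q, -, hq, h1, h2⟩ := key g hg
  exact ⟨q.1, q.2, hq, key' _ _ h1, key' _ _ h2⟩

lemma IsFrame.inSquare {d₁ d₂ : ℤ × ℤ} (h : IsFrame d₁ d₂) {p : ℤ × ℤ} (hp : InSquare 2 p)
    (hp' : -2 ≤ p.1 + p.2 ∧ p.1 + p.2 ≤ 2) : InSquare 2 (frameMap d₁ d₂ p) := by
  unfold InSquare at *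
  have hmem := h.mem_frames
  simp only [frames, List.mem_cons, List.not_mem_nil, or_false, Prod.mk.injEq] at hmem
  rcases hmem with ⟨rfl, rfl⟩ | ⟨rfl, rfl⟩ | ⟨rfl, rfl⟩ | ⟨rfl, rfl⟩ | ⟨rfl, rfl⟩ | ⟨rfl, rfl⟩ |
    ⟨rfl, rfl⟩ | ⟨rfl, rfl⟩ | ⟨rfl, rfl⟩ | ⟨rfl, rfl⟩ | ⟨rfl, rfl⟩ | ⟨rfl, rfl⟩ <;>
  simp only [frameMap] <;> omega

lemma matchesAt_cons {P A s t σ : ℕ} {e : ℕ × ℕ × ℕ} {p : Pattern}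
    (h : matchesAt P A s t σ (e :: p) = true) :
    Nat.land (Nat.shiftRight P ((A + (e.1 * s + e.2.1 * t)) % 256)) colorRep =
      Nat.shiftLeft 1 (Nat.mul 256 (digit σ e.2.2)) ∧ matchesAt P A s t σ p = true := by
  change cond (Nat.beq (Nat.land (Nat.shiftRight P ((A + (e.1 * s + e.2.1 * t)) % 256)) colorRep)
    (Nat.shiftLeft 1 (Nat.mul 256 (digit σ e.2.2)))) (matchesAt P A s t σ p) false = true at h
  cases hb : Nat.beq (Nat.land (Nat.shiftRight P ((A + (e.1 * s + e.2.1 * t)) % 256)) colorRep)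
    (Nat.shiftLeft 1 (Nat.mul 256 (digit σ e.2.2)))
  · rw [hb, cond_false] at h
    exact absurd h Bool.false_ne_true
  · rw [hb, cond_true] at h
    exact ⟨Nat.eq_of_beq_eq_true hb, h⟩

lemma matchesAt_spec {P A s t σ : ℕ} {p : Pattern} (h : matchesAt P A s t σ p = true) :
    ∀ e ∈ p, Nat.land (Nat.shiftRight P ((A + (e.1 * s + e.2.1 * t)) % 256)) colorRep =
      Nat.shiftLeft 1 (Nat.mul 256 (digit σ e.2.2)) := by
  induction p with
  | nil => simp
  | cons e p ih =>
    rw [List.forall_mem_cons]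
    exact ⟨(matchesAt_cons h).1, ih (matchesAt_cons h).2⟩

lemma digit_of_land_colorRep {P i c v : ℕ} (hc : c < 5)
    (h : Nat.land (Nat.shiftRight P i) colorRep = Nat.shiftLeft 1 (Nat.mul 256 v))
    (hP : P.testBit (256 * c + i) = true) : v = c := by
  have hrep : ∀ c < 5, colorRep.testBit (256 * c) = true := by decide +kernel
  have : (Nat.shiftLeft 1 (Nat.mul 256 v)).testBit (256 * c) = true := by
    rw [← h, testBit_natLand, testBit_natShiftRight, Nat.add_comm i, hP, hrep c hc, Bool.and_self]
  rw [testBit_shiftLeft_one, decide_eq_true_eq] at this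
  exact Nat.eq_of_mul_eq_mul_left (by norm_num) this

section

variable {𝒞 : Set (ℤ × ℤ → Fin 5)} {ψ : ℤ × ℤ → Fin 5} {P : ℕ}

lemma not_matchesAt (h𝒞 : LatticeClass 𝒞) (hψ : ψ ∈ 𝒞) (hP : Models ψ P) {p : Pattern}
    (hp : WellFormed p) (hex : Excluded 𝒞 p) {d₁ d₂ : ℤ × ℤ} (hd : IsFrame d₁ d₂) {s t σ : ℕ}
    (hs : ∃ k : ℤ, (s : ℤ) = 16 * d₁.1 + d₁.2 + 256 * k)
    (ht : ∃ k : ℤ, (t : ℤ) = 16 * d₂.1 + d₂.2 + 256 * k) (hσ : isPerm σ = true) {w : ℤ × ℤ}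
    (hw : InSquare 4 w) : matchesAt P (gridIdx w + 253 * (s + t)) s t σ p ≠ true := by
  intro h
  obtain ⟨τ, hτ⟩ := exists_perm_of_isPerm hσ
  obtain ⟨k, hk⟩ := hs
  obtain ⟨l, hl⟩ := ht
  refine hex _ (h𝒞.frame ψ hψ d₁ d₂ hd w τ.symm) fun e he => ?_
  obtain ⟨hcell, hcol⟩ := hp e he
  have hsq : InSquare 2 (frameMap d₁ d₂ ((e.1 : ℤ) - 3, (e.2.1 : ℤ) - 3)) :=
    hd.inSquare (by unfold InSquare; simp only; omega) (by simp only; omega)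
  set y := w + frameMap d₁ d₂ ((e.1 : ℤ) - 3, (e.2.1 : ℤ) - 3) with hy
  have hy6 : InSquare 6 y := by
    rw [hy]
    unfold InSquare at *
    simp only [Prod.fst_add, Prod.snd_add]
    omega
  have hidx : (gridIdx w + 253 * (s + t) + (e.1 * s + e.2.1 * t)) % 256 = gridIdx y := by
    have h1 : (gridIdx y : ℤ) = 16 * y.1 + y.2 + 136 := by
      unfold InSquare at hy6
      unfold gridIdx
      omega
    have h2 : (gridIdx w : ℤ) = 16 * w.1 + w.2 + 136 := by
      unfold InSquare at hw
      unfold gridIdx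
      omega
    have h3 : ((gridIdx w + 253 * (s + t) + (e.1 * s + e.2.1 * t) : ℕ) : ℤ) = gridIdx y +
        256 * ((s + t) + (e.1 - 3) * k + (e.2.1 - 3) * l) := by
      push_cast
      rw [h1, h2, hk, hl, hy]
      simp only [frameMap, Prod.fst_add, Prod.snd_add]
      ring
    have h4 := gridIdx_lt (hy6.mono (show (6 : ℤ) ≤ 7 by norm_num)).inGrid
    omega
  have hbit := matchesAt_spec h e he
  rw [hidx] at hbit
  have hv := digit_of_land_colorRep (ψ y).isLt hbit (hP y hy6)
  have : τ ⟨e.2.2, hcol⟩ = ψ y := Fin.ext ((hτ _).trans hv)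
  rw [← this, Equiv.symm_apply_apply]

lemma refuted_of_patterns (h𝒞 : LatticeClass 𝒞) {lib : List Pattern} {i r : ℕ}
    (hlib : ∀ j < i, WellFormed (lib.getD j []) ∧ Excluded 𝒞 (lib.getD j []))
    (h : ∀ Q ∈ patterns lib i P r, Refuted 𝒞 Q) : Refuted 𝒞 P := by
  intro ψ hψ hP
  unfold patterns at h
  cases hi : Nat.blt (Nat.div r 3037500) i
  · rw [hi, cond_false] at h
    exact h P List.mem_cons_self ψ hψ hP
  obtain ⟨hwf, hex⟩ := hlib _ (Nat.blt_eq.mp hi)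
  obtain ⟨w, hw, hcell⟩ := cellOf_spec (r := Nat.mod (Nat.div r 37500) 81)
    (Nat.mod_lt _ (by norm_num))
  rw [hi, cond_true, hcell, embeddings] at h
  obtain ⟨d₁, d₂, hd, hs, ht⟩ := exists_frame (g := Nat.mod (Nat.div r 3125) 12)
    (Nat.mod_lt _ (by norm_num))
  cases hm : and (isPerm (Nat.mod r 3125)) (matchesAt P (Nat.add (gridIdx w) (Nat.mul 253
    (Nat.add (dirStep (frameDir (Nat.mod (Nat.div r 3125) 12) 0))
      (dirStep (frameDir (Nat.mod (Nat.div r 3125) 12) 1)))))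
    (dirStep (frameDir (Nat.mod (Nat.div r 3125) 12) 0))
    (dirStep (frameDir (Nat.mod (Nat.div r 3125) 12) 1)) (Nat.mod r 3125)
    (List.getD lib (Nat.div r 3037500) []))
  · rw [hm, cond_false] at h
    exact h P List.mem_cons_self ψ hψ hP
  · rw [Bool.and_eq_true] at hm
    exact not_matchesAt h𝒞 hψ hP hwf hex hd hs ht hm.1 hw hm.2

lemma models_xor (hP : Models ψ P) {c : ℕ} (hc : c < 2 ^ 32) : Models ψ (Nat.xor P c) := by
  intro x hx
  have h32 : 32 ≤ 256 * (ψ x : ℕ) + gridIdx x := by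
    unfold InSquare at hx
    unfold gridIdx
    omega
  rw [testBit_natXor, hP x hx,
    Nat.testBit_lt_two_pow (hc.trans_le (Nat.pow_le_pow_right (by norm_num) h32)), Bool.xor_false]

lemma refuted_of_record (h𝒞 : LatticeClass 𝒞) {lib : List Pattern} {i : ℕ}
    (hlib : ∀ j < i, WellFormed (lib.getD j []) ∧ Excluded 𝒞 (lib.getD j []))
    {f : ℕ → List ℕ → List ℕ → Bool}
    (hf : ∀ c cs st, f c cs st = true → ∀ Q ∈ st, Refuted 𝒞 Q) {cs st : List ℕ} {q t : ℕ}
    (h : record lib i f cs st P q t = true) : ∀ Q ∈ P :: st, Refuted 𝒞 Q := by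
  have key : ∀ {c : ℕ} {l : List ℕ}, f c cs (List.append l st) = true →
      ((∀ Q ∈ l, Refuted 𝒞 Q) → Refuted 𝒞 P) → ∀ Q ∈ P :: st, Refuted 𝒞 Q := by
    intro c l hl hP
    have := hf _ _ _ hl
    rw [List.forall_mem_cons]
    exact ⟨hP fun Q hQ => this Q (List.mem_append_left _ hQ),
      fun Q hQ => this Q (List.mem_append_right _ hQ)⟩
  unfold record at h
  cases h0 : Nat.beq t 0
  · rw [h0, cond_false] at h
    cases h1 : Nat.beq t 1
    · rw [h1, cond_false] at h
      cases h2 : Nat.beq t 2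
      · rw [h2, cond_false] at h
        exact key h (refuted_of_patterns h𝒞 hlib)
      · rw [h2, cond_true] at h
        exact key h (refuted_of_triples h𝒞 (Nat.mod_lt _ (by norm_num)))
    · rw [h1, cond_true] at h
      exact key h (refuted_of_moves h𝒞)
  · rw [h0, cond_true] at h
    exact key h (refuted_of_branches h𝒞 (Nat.mod_lt _ (by norm_num)))

lemma refuted_of_step (h𝒞 : LatticeClass 𝒞) {lib : List Pattern} {i : ℕ}
    (hlib : ∀ j < i, WellFormed (lib.getD j []) ∧ Excluded 𝒞 (lib.getD j []))
    {f : ℕ → List ℕ → List ℕ → Bool}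
    (hf : ∀ c cs st, f c cs st = true → ∀ Q ∈ st, Refuted 𝒞 Q) {cs st : List ℕ} {c : ℕ}
    (h : step lib i f cs st P c = true) : ∀ Q ∈ P :: st, Refuted 𝒞 Q := by
  unfold step at h
  cases hc : Nat.ble c 1
  · rw [hc, cond_false, force_eq] at h
    have := refuted_of_record h𝒞 hlib hf h
    rw [List.forall_mem_cons] at this ⊢
    exact ⟨fun ψ hψ hP => this.1 ψ hψ (models_xor hP (Nat.mod_lt _ (by norm_num))), this.2⟩
  · rw [hc, cond_true] at h
    cases cs with
    | nil => exact absurd h Bool.false_ne_true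
    | cons c' cs => exact hf _ _ _ h

lemma refuted_of_treat (h𝒞 : LatticeClass 𝒞) {lib : List Pattern} {i : ℕ}
    (hlib : ∀ j < i, WellFormed (lib.getD j []) ∧ Excluded 𝒞 (lib.getD j []))
    {f : ℕ → List ℕ → List ℕ → Bool}
    (hf : ∀ c cs st, f c cs st = true → ∀ Q ∈ st, Refuted 𝒞 Q) {c : ℕ} {cs st : List ℕ}
    (h : treat lib i f c cs st P = true) : ∀ Q ∈ P :: st, Refuted 𝒞 Q := by
  unfold treat at h
  cases h0 : Nat.beq P 0
  · rw [h0, cond_false, force_eq] at h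
    exact refuted_of_step h𝒞 hlib hf h
  · rw [h0, cond_true] at h
    rw [List.forall_mem_cons, Nat.eq_of_beq_eq_true h0]
    exact ⟨refuted_zero 𝒞, hf _ _ _ h⟩

lemma refuted_of_run (h𝒞 : LatticeClass 𝒞) {lib : List Pattern} {i : ℕ}
    (hlib : ∀ j < i, WellFormed (lib.getD j []) ∧ Excluded 𝒞 (lib.getD j [])) (n c : ℕ)
    (cs st : List ℕ) (h : run lib i n c cs st = true) : ∀ Q ∈ st, Refuted 𝒞 Q := by
  induction n generalizing c cs st with
  | zero => exact absurd h Bool.false_ne_true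
  | succ n ih =>
    cases st with
    | nil => simp
    | cons P st =>
      change force P (treat lib i (run lib i n) c cs st) = true at h
      rw [force_eq] at h
      exact refuted_of_treat h𝒞 hlib ih h

lemma models_full (ψ : ℤ × ℤ → Fin 5) : Models ψ full := fun x hx => testBit_full (ψ x).isLt hx

lemma excluded_of_refuted_start (h𝒞 : LatticeClass 𝒞) {p : Pattern} (hp : WellFormed p)
    (h : Refuted 𝒞 (start p)) : Excluded 𝒞 p := by
  intro ψ hψ hfit
  refine h ψ hψ (models_propagate h𝒞 hψ _ ?_)
  clear h
  induction p with
  | nil => exact models_full ψ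
  | cons e p ih =>
    unfold WellFormed at hp
    unfold Fits at hfit
    rw [List.forall_mem_cons] at hp hfit
    have hcell : Nat.add 85 (Nat.add (Nat.mul 16 e.1) e.2.1) =
        gridIdx ((e.1 : ℤ) - 3, (e.2.1 : ℤ) - 3) := by
      change 85 + (16 * e.1 + e.2.1) = _
      simp only [gridIdx]
      omega
    have := models_assign (ih hp.2 hfit.2) (x := ((e.1 : ℤ) - 3, (e.2.1 : ℤ) - 3))
      (by unfold InGrid; simp only; omega) hfit.1
    rwa [← hcell] at this

end

/-- The patterns that are excluded one after the other. -/
def patternList : List Pattern := [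
  [(2, 4, 0), (2, 3, 1), (3, 2, 2), (4, 4, 3), (5, 2, 3)],
  [(2, 4, 0), (2, 3, 1), (3, 2, 0), (4, 4, 2), (5, 2, 2)],
  [(3, 3, 0), (4, 3, 1), (3, 4, 2), (2, 4, 3), (2, 3, 1), (3, 2, 2), (4, 2, 3), (5, 3, 0),
   (3, 5, 3), (2, 5, 1)],
  [(3, 4, 0), (2, 3, 1), (3, 2, 2), (5, 3, 3), (4, 4, 4), (3, 5, 3), (2, 5, 4)],
  [(3, 3, 0), (4, 3, 1), (3, 4, 2), (2, 4, 1), (2, 3, 3), (3, 2, 2), (4, 2, 3), (5, 3, 0),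
   (5, 2, 2), (2, 5, 4)],
  [(3, 3, 0), (4, 3, 1), (2, 3, 1), (3, 2, 2), (5, 3, 0), (3, 5, 2), (2, 5, 3)],
  [(3, 3, 0), (3, 4, 1), (2, 4, 2), (2, 3, 3), (3, 2, 2), (4, 2, 4), (5, 3, 1), (4, 4, 4),
   (3, 5, 2), (2, 5, 4)],
  [(4, 3, 0), (3, 4, 1), (2, 4, 2), (2, 3, 0), (3, 2, 2), (4, 2, 3), (5, 3, 3), (4, 4, 2),
   (5, 2, 4), (2, 5, 0)],
  [(3, 3, 0), (2, 4, 1), (2, 3, 2), (3, 2, 3), (4, 2, 4), (5, 3, 0), (4, 4, 4), (5, 2, 3),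
   (3, 5, 0), (2, 5, 4)],
  [(3, 3, 0), (4, 3, 1), (3, 4, 2), (2, 3, 1), (3, 2, 3), (4, 2, 4), (5, 3, 2), (4, 4, 3),
   (5, 2, 3), (3, 5, 4), (2, 5, 3)],
  [(4, 3, 0), (3, 4, 1), (2, 4, 2), (2, 3, 0), (3, 2, 2), (4, 2, 3), (5, 3, 3), (4, 4, 2),
   (5, 2, 4), (2, 5, 4)],
  [(4, 3, 0), (3, 4, 1), (2, 3, 1), (3, 2, 2), (5, 3, 1), (4, 4, 3), (3, 5, 0), (2, 5, 3)],
  [(3, 3, 0), (4, 3, 1), (3, 4, 2), (2, 4, 3), (2, 3, 2), (3, 2, 3), (4, 2, 4), (5, 3, 2),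
   (4, 4, 4), (5, 2, 3), (3, 5, 3), (2, 5, 4)],
  [(4, 3, 0), (3, 4, 1), (2, 4, 2), (2, 3, 0), (3, 2, 2), (4, 2, 3), (5, 3, 2), (4, 4, 3),
   (5, 2, 1), (3, 5, 2), (2, 5, 3)],
  [(4, 3, 0), (3, 4, 1), (2, 4, 2), (2, 3, 0), (3, 2, 2), (4, 2, 3), (5, 3, 3), (4, 4, 2),
   (5, 2, 4), (3, 5, 4), (2, 5, 3)],
  [(3, 3, 0), (4, 3, 1), (2, 3, 1), (4, 2, 2), (5, 3, 2), (4, 4, 3), (5, 2, 0), (3, 5, 1),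
   (2, 5, 3)],
  [(2, 4, 0), (2, 3, 1), (3, 2, 2), (4, 2, 3), (5, 3, 1), (4, 4, 3), (3, 5, 0), (2, 5, 4)],
  [(4, 3, 0), (3, 4, 1), (2, 4, 2), (2, 3, 1), (4, 2, 3), (5, 3, 1), (4, 4, 3), (5, 2, 2),
   (3, 5, 2), (2, 5, 3)],
  [(3, 3, 0), (4, 3, 1), (3, 4, 2), (2, 4, 3), (2, 3, 2), (3, 2, 3), (4, 2, 4), (5, 3, 2),
   (5, 2, 3), (3, 5, 3), (2, 5, 0)],
  [(3, 3, 0), (4, 3, 1), (3, 4, 2), (2, 4, 3), (2, 3, 2), (3, 2, 3), (4, 2, 4), (5, 3, 2),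
   (4, 4, 4), (5, 2, 3)],
  [(4, 3, 0), (3, 4, 1), (2, 4, 0), (2, 3, 1), (3, 2, 2), (4, 2, 3), (5, 3, 4), (4, 4, 2),
   (5, 2, 2), (3, 5, 3), (2, 5, 2)],
  [(3, 3, 0), (4, 3, 1), (2, 4, 2), (2, 3, 1), (3, 2, 3), (4, 2, 4), (5, 3, 0), (4, 4, 4),
   (5, 2, 2), (3, 5, 2), (2, 5, 4)],
  [(3, 3, 0), (4, 3, 1), (3, 4, 2), (2, 4, 3), (2, 3, 1), (3, 2, 4), (4, 2, 3), (5, 3, 2),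
   (4, 4, 4), (5, 2, 0), (3, 5, 3), (2, 5, 4)],
  [(3, 3, 0), (4, 3, 1), (3, 4, 2), (2, 4, 3), (2, 3, 1), (3, 2, 4), (4, 2, 3), (5, 3, 3),
   (4, 4, 4), (5, 2, 4), (3, 5, 1), (2, 5, 4)],
  [(3, 3, 0), (4, 3, 1), (2, 4, 2), (2, 3, 3), (3, 2, 2), (4, 2, 4), (4, 4, 4), (5, 2, 0),
   (3, 5, 2), (2, 5, 4)],
  [(3, 3, 0), (3, 4, 1), (2, 4, 2), (2, 3, 1), (5, 3, 1), (4, 4, 3), (5, 2, 3)],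
  [(3, 3, 0), (4, 3, 1), (3, 4, 2), (2, 4, 1), (2, 3, 2), (3, 2, 3), (4, 2, 4), (5, 3, 0),
   (4, 4, 3), (5, 2, 3), (3, 5, 4), (2, 5, 0)],
  [(3, 4, 0), (2, 4, 1), (2, 3, 2), (3, 2, 0), (4, 2, 2), (5, 3, 2), (4, 4, 3), (5, 2, 4),
   (3, 5, 2), (2, 5, 4)],
  [(4, 3, 0), (2, 4, 1), (2, 3, 0), (3, 2, 1), (4, 2, 2), (5, 3, 2), (5, 2, 1), (3, 5, 3)],
  [(3, 3, 0), (4, 3, 1), (3, 4, 2), (2, 4, 3), (3, 2, 4), (4, 2, 3), (5, 3, 2), (4, 4, 4),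
   (5, 2, 0), (3, 5, 1), (2, 5, 4)],
  [(3, 3, 0), (4, 3, 1), (2, 4, 2), (2, 3, 3), (3, 2, 1), (4, 2, 2), (5, 3, 3), (4, 4, 4),
   (5, 2, 0), (3, 5, 1), (2, 5, 0)],
  [(4, 3, 0), (3, 4, 1), (2, 4, 0), (3, 2, 2), (4, 2, 3), (4, 4, 2), (5, 2, 2), (3, 5, 4),
   (2, 5, 2)],
  [(3, 3, 0), (4, 3, 1), (3, 4, 2), (2, 4, 1), (2, 3, 2), (3, 2, 3), (5, 3, 2), (4, 4, 4),
   (5, 2, 0), (2, 5, 0)],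
  [(3, 3, 0), (4, 3, 1), (3, 4, 2), (2, 4, 1), (2, 3, 3), (3, 2, 2), (4, 2, 3), (5, 3, 3),
   (5, 2, 2), (2, 5, 4)],
  [(3, 3, 0), (4, 3, 1), (3, 4, 2), (2, 4, 1), (2, 3, 3), (3, 2, 2), (4, 2, 3), (5, 3, 3),
   (5, 2, 2), (2, 5, 3)],
  [(3, 3, 0), (4, 3, 1), (3, 4, 2), (2, 4, 3), (2, 3, 1), (3, 2, 2), (5, 3, 0), (5, 2, 4),
   (3, 5, 1), (2, 5, 4)],
  [(3, 3, 0), (4, 3, 1), (3, 4, 2), (2, 4, 3), (4, 2, 3), (5, 3, 2), (4, 4, 3), (5, 2, 0),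
   (2, 5, 0)],
  [(3, 3, 0), (3, 4, 1), (2, 4, 2), (2, 3, 3), (3, 2, 1), (4, 2, 2), (5, 3, 1), (4, 4, 2),
   (5, 2, 4), (2, 5, 4)],
  [(3, 3, 0), (4, 3, 1), (2, 4, 2), (2, 3, 1), (3, 2, 3), (4, 2, 2), (5, 3, 2), (4, 4, 4),
   (5, 2, 0), (3, 5, 2), (2, 5, 0)],
  [(3, 3, 0), (4, 3, 1), (3, 4, 2), (2, 4, 3), (2, 3, 1), (3, 2, 2), (4, 2, 4), (5, 3, 0),
   (4, 4, 4), (3, 5, 3), (2, 5, 0)],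
  [(3, 3, 0), (4, 3, 1), (2, 4, 2), (3, 2, 2), (4, 4, 3), (5, 2, 4), (3, 5, 1), (2, 5, 0)],
  [(3, 4, 0), (2, 3, 1), (3, 2, 2), (4, 4, 3), (5, 2, 0), (3, 5, 1), (2, 5, 3)],
  [(3, 4, 0), (2, 4, 1), (2, 3, 2), (3, 2, 3), (4, 2, 1), (5, 3, 1), (4, 4, 3), (5, 2, 4),
   (2, 5, 3)],
  [(4, 3, 0), (3, 4, 1), (2, 4, 2), (2, 3, 0), (3, 2, 3), (4, 2, 2), (5, 3, 2), (4, 4, 3),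
   (5, 2, 3), (3, 5, 2), (2, 5, 3)],
  [(3, 3, 0), (3, 4, 1), (2, 4, 2), (2, 3, 1), (3, 2, 3), (4, 2, 4), (5, 3, 1), (4, 4, 2),
   (5, 2, 2), (3, 5, 3), (2, 5, 4)],
  [(3, 3, 0), (4, 3, 1), (3, 4, 2), (2, 4, 3), (2, 3, 2), (3, 2, 3), (5, 3, 4), (4, 4, 3),
   (5, 2, 3), (3, 5, 1)],
  [(3, 3, 0), (4, 3, 1), (3, 4, 2), (2, 4, 1), (2, 3, 2), (3, 2, 3), (5, 3, 2), (4, 4, 0)],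
  [(3, 3, 0), (2, 4, 1), (2, 3, 2), (3, 2, 1), (4, 2, 3), (4, 4, 3), (5, 2, 2)],
  [(4, 3, 0), (3, 4, 1), (2, 4, 0), (2, 3, 1), (3, 2, 2), (5, 3, 1), (4, 4, 3), (5, 2, 4),
   (2, 5, 2)],
  [(3, 3, 0), (4, 3, 1), (3, 4, 2), (2, 3, 2), (3, 2, 3), (4, 2, 4), (5, 3, 2), (4, 4, 4),
   (5, 2, 0), (3, 5, 0)],
  [(4, 3, 0), (3, 4, 1), (2, 4, 0), (2, 3, 1), (3, 2, 2), (4, 2, 3), (5, 3, 1), (4, 4, 3),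
   (5, 2, 4), (3, 5, 2)],
  [(3, 3, 0), (4, 3, 1), (3, 4, 2), (2, 4, 1), (2, 3, 2), (3, 2, 3), (4, 2, 4), (5, 3, 4),
   (4, 4, 0), (5, 2, 3), (3, 5, 3)],
  [(3, 3, 0), (4, 3, 1), (3, 4, 2), (2, 4, 1), (2, 3, 3), (3, 2, 2), (4, 2, 3), (5, 3, 2),
   (4, 4, 3), (5, 2, 4), (3, 5, 0), (2, 5, 4)],
  [(3, 3, 0), (4, 3, 1), (3, 4, 2), (2, 4, 1), (2, 3, 3), (3, 2, 2), (4, 2, 3), (5, 3, 3),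
   (4, 4, 0), (5, 2, 4), (3, 5, 4)],
  [(3, 3, 0), (2, 4, 1), (2, 3, 2), (3, 2, 3), (4, 2, 2), (5, 3, 2), (4, 4, 4)],
  [(4, 3, 0), (3, 4, 1), (2, 4, 0), (3, 2, 2), (4, 2, 3), (5, 3, 1), (4, 4, 2), (5, 2, 2),
   (2, 5, 2)],
  [(3, 3, 0), (4, 3, 1), (3, 4, 2), (2, 4, 3), (2, 3, 1), (3, 2, 2), (4, 2, 3), (5, 3, 2),
   (4, 4, 4), (5, 2, 0), (3, 5, 3), (2, 5, 1)],
  [(3, 3, 0), (4, 3, 1), (3, 4, 2), (2, 4, 3), (2, 3, 1), (4, 4, 3), (5, 2, 0), (3, 5, 1),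
   (2, 5, 0)],
  [(4, 3, 0), (3, 4, 1), (2, 4, 2), (2, 3, 0), (3, 2, 2), (4, 2, 3), (5, 3, 2), (4, 4, 3),
   (5, 2, 4), (3, 5, 0), (2, 5, 4)],
  [(4, 3, 0), (3, 4, 1), (2, 4, 2), (2, 3, 0), (3, 2, 2), (4, 4, 3), (5, 2, 4), (3, 5, 0),
   (2, 5, 3)],
  [(3, 3, 0), (4, 3, 1), (3, 4, 2), (2, 4, 3), (2, 3, 1), (4, 2, 3), (5, 3, 3), (4, 4, 4),
   (5, 2, 0), (3, 5, 3), (2, 5, 0)],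
  [(3, 3, 0), (2, 4, 1), (2, 3, 2), (3, 2, 3), (4, 2, 1), (5, 3, 2), (4, 4, 4)],
  [(3, 3, 0), (4, 3, 1), (3, 4, 2), (2, 4, 3), (3, 2, 1), (4, 2, 3), (5, 3, 3), (5, 2, 0),
   (2, 5, 0)],
  [(3, 3, 0), (4, 3, 1), (2, 4, 2), (2, 3, 3), (5, 3, 2), (5, 2, 0), (3, 5, 2), (2, 5, 4)],
  [(3, 3, 0), (3, 4, 1), (2, 4, 2), (2, 3, 1), (3, 2, 2), (5, 3, 2), (4, 4, 3), (3, 5, 4)],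
  [(3, 3, 0), (4, 3, 1), (2, 4, 2), (2, 3, 3), (5, 3, 4), (4, 4, 2), (5, 2, 2), (3, 5, 4),
   (2, 5, 0)],
  [(4, 3, 0), (2, 4, 1), (2, 3, 2), (5, 3, 1), (4, 4, 3), (5, 2, 3), (3, 5, 1), (2, 5, 3)],
  [(3, 3, 0), (3, 4, 1), (2, 4, 2), (2, 3, 1), (3, 2, 2), (5, 3, 1), (4, 4, 2), (5, 2, 2)],
  [(3, 3, 0), (4, 3, 1), (3, 4, 2), (2, 4, 3), (2, 3, 2), (3, 2, 3), (5, 3, 4), (4, 4, 3),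
   (5, 2, 3)],
  [(3, 3, 0), (4, 3, 1), (3, 4, 2), (2, 4, 1), (3, 2, 3), (5, 3, 2), (4, 4, 3), (3, 5, 0),
   (2, 5, 3)],
  [(3, 4, 0), (2, 4, 1), (2, 3, 0), (3, 2, 2), (5, 3, 0), (4, 4, 2), (5, 2, 3), (3, 5, 4),
   (2, 5, 2)],
  [(4, 3, 0), (2, 4, 0), (2, 3, 1), (3, 2, 2), (4, 2, 3), (5, 3, 1), (4, 4, 3), (5, 2, 2),
   (3, 5, 2), (2, 5, 4)],
  [(3, 3, 0), (4, 3, 1), (3, 4, 2), (2, 4, 1), (2, 3, 2), (3, 2, 3), (4, 2, 4), (5, 3, 4),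
   (4, 4, 0), (5, 2, 2), (3, 5, 3)],
  [(3, 3, 0), (4, 3, 1), (3, 4, 2), (2, 4, 1), (2, 3, 2), (3, 2, 3), (4, 2, 4), (5, 3, 4),
   (4, 4, 0), (5, 2, 3), (3, 5, 4), (2, 5, 3)],
  [(3, 3, 0), (4, 3, 1), (3, 4, 2), (2, 4, 1), (2, 3, 2), (3, 2, 3), (4, 2, 4), (5, 3, 4),
   (4, 4, 3), (5, 2, 3), (3, 5, 4)],
  [(3, 3, 0), (4, 3, 1), (3, 4, 2), (2, 4, 1), (2, 3, 3), (3, 2, 2), (4, 2, 4), (5, 3, 4),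
   (4, 4, 3), (5, 2, 3), (2, 5, 4)],
  [(3, 3, 0), (4, 3, 1), (3, 4, 2), (2, 4, 1), (2, 3, 3), (3, 2, 2), (5, 3, 4), (4, 4, 3),
   (5, 2, 3), (3, 5, 4), (2, 5, 3)],
  [(4, 3, 0), (3, 4, 1), (2, 3, 2), (3, 2, 3), (4, 2, 2), (5, 3, 4), (5, 2, 1), (3, 5, 3),
   (2, 5, 2)],
  [(4, 3, 0), (3, 4, 1), (2, 4, 0), (2, 3, 2), (5, 3, 3), (4, 4, 4), (5, 2, 4), (2, 5, 4)],
  [(3, 4, 0), (2, 4, 1), (2, 3, 2), (3, 2, 0), (4, 2, 3), (5, 3, 0), (4, 4, 3), (3, 5, 1),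
   (2, 5, 4)],
  [(3, 3, 0), (4, 3, 1), (2, 4, 2), (2, 3, 1), (3, 2, 3), (4, 2, 4), (5, 3, 2), (5, 2, 0),
   (3, 5, 2), (2, 5, 4)],
  [(3, 3, 0), (4, 3, 1), (2, 4, 2), (2, 3, 1), (3, 2, 2), (5, 3, 0), (4, 4, 3), (5, 2, 2),
   (3, 5, 1), (2, 5, 3)],
  [(3, 3, 0), (4, 3, 1), (3, 4, 2), (2, 4, 3), (2, 3, 1), (3, 2, 3), (5, 3, 2), (4, 4, 4),
   (3, 5, 1), (2, 5, 4)],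
  [(3, 3, 0), (4, 3, 1), (3, 4, 2), (2, 4, 3), (2, 3, 1), (3, 2, 3), (4, 2, 4), (5, 3, 2),
   (5, 2, 3), (3, 5, 3), (2, 5, 0)],
  [(3, 3, 0), (4, 3, 1), (2, 4, 2), (2, 3, 1), (4, 2, 3), (5, 3, 3), (4, 4, 2), (5, 2, 0),
   (2, 5, 3)],
  [(4, 3, 0), (2, 4, 1), (3, 2, 1), (4, 2, 2), (5, 3, 2), (4, 4, 1), (5, 2, 1), (2, 5, 3)],
  [(3, 3, 0), (4, 3, 1), (2, 4, 2), (5, 3, 3), (4, 4, 4), (5, 2, 4), (3, 5, 1)],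
  [(3, 3, 0), (4, 3, 1), (3, 4, 2), (2, 4, 3), (2, 3, 1), (3, 2, 4), (4, 2, 3), (5, 3, 2),
   (4, 4, 4), (5, 2, 4), (2, 5, 0)],
  [(3, 4, 0), (2, 3, 1), (3, 2, 2), (4, 2, 3), (5, 3, 3), (4, 4, 2), (5, 2, 4), (2, 5, 4)],
  [(3, 3, 0), (4, 3, 1), (3, 4, 2), (2, 4, 3), (2, 3, 2), (3, 2, 1), (4, 2, 4), (5, 3, 2),
   (4, 4, 3), (5, 2, 0), (3, 5, 1)],
  [(3, 3, 0), (4, 3, 1), (3, 4, 2), (2, 4, 1), (2, 3, 2), (5, 3, 0), (4, 4, 3), (5, 2, 3)],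
  [(3, 3, 0), (4, 3, 1), (3, 4, 2), (2, 4, 1), (2, 3, 2), (4, 2, 3), (5, 3, 2), (5, 2, 0)],
  [(3, 3, 0), (3, 4, 1), (2, 4, 2), (2, 3, 1), (3, 2, 3), (4, 2, 4), (5, 3, 1), (4, 4, 4),
   (5, 2, 3)],
  [(3, 3, 0), (4, 3, 1), (3, 4, 2), (2, 4, 1), (2, 3, 2), (3, 2, 3), (5, 3, 4), (4, 4, 0)],
  [(3, 3, 0), (4, 3, 1), (3, 4, 2), (2, 4, 1), (2, 3, 2), (4, 4, 3), (5, 2, 3)],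
  [(3, 3, 0), (4, 3, 1), (3, 4, 2), (2, 4, 1), (2, 3, 3), (3, 2, 2), (4, 2, 3), (5, 3, 2),
   (4, 4, 4)],
  [(3, 3, 0), (3, 4, 1), (2, 4, 2), (3, 2, 1), (5, 3, 3), (4, 4, 4), (5, 2, 4)],
  [(3, 3, 0), (4, 3, 1), (3, 4, 2), (2, 4, 1), (2, 3, 3), (4, 2, 2), (5, 3, 0), (4, 4, 3),
   (5, 2, 3)],
  [(3, 3, 0), (4, 3, 1), (3, 4, 2), (2, 4, 1), (2, 3, 3), (4, 2, 2), (5, 3, 4), (4, 4, 0)],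
  [(3, 3, 0), (4, 3, 1), (3, 4, 2), (2, 4, 1), (2, 3, 3), (3, 2, 4), (4, 2, 2), (5, 3, 4),
   (5, 2, 0)],
  [(3, 3, 0), (4, 3, 1), (3, 4, 2), (2, 4, 3), (2, 3, 2), (3, 2, 3), (4, 2, 4), (5, 3, 4),
   (4, 4, 3)],
  [(3, 3, 0), (4, 3, 1), (3, 4, 2), (2, 4, 1), (2, 3, 2), (3, 2, 3), (2, 5, 0)],
  [(3, 3, 0), (4, 3, 1), (2, 4, 1), (2, 3, 2), (3, 2, 3), (4, 2, 4), (5, 3, 0), (4, 4, 4),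
   (5, 2, 2), (3, 5, 3)],
  [(3, 3, 0), (4, 3, 1), (3, 4, 2), (2, 3, 2), (3, 2, 3), (4, 2, 4), (4, 4, 4), (5, 2, 0),
   (3, 5, 0), (2, 5, 4)],
  [(3, 3, 0), (4, 3, 1), (3, 4, 2), (2, 3, 2), (3, 2, 3), (4, 2, 4), (5, 2, 0), (3, 5, 3),
   (2, 5, 4)],
  [(3, 3, 0), (3, 4, 1), (2, 4, 2), (2, 3, 1), (3, 2, 3), (4, 2, 4), (5, 3, 3), (5, 2, 1),
   (3, 5, 0), (2, 5, 4)],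
  [(3, 3, 0), (4, 3, 1), (3, 4, 2), (2, 4, 1), (2, 3, 2), (3, 2, 3), (5, 2, 0), (3, 5, 4)],
  [(3, 3, 0), (4, 3, 1), (2, 4, 1), (2, 3, 2), (3, 2, 3), (4, 2, 4), (5, 3, 4), (4, 4, 3),
   (5, 2, 2), (3, 5, 0)],
  [(3, 3, 0), (4, 3, 1), (3, 4, 2), (2, 3, 3), (3, 2, 2), (4, 2, 3), (5, 3, 0), (4, 4, 3),
   (5, 2, 2), (3, 5, 4), (2, 5, 3)],
  [(3, 3, 0), (4, 3, 1), (2, 4, 1), (2, 3, 2), (3, 2, 3), (4, 2, 2), (5, 3, 0), (4, 4, 2),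
   (5, 2, 4), (3, 5, 0), (2, 5, 2)],
  [(3, 3, 0), (4, 3, 1), (3, 4, 2), (2, 4, 1), (2, 3, 3), (3, 2, 2), (4, 2, 3), (5, 3, 0),
   (5, 2, 4), (3, 5, 0)],
  [(3, 3, 0), (3, 4, 1), (2, 4, 2), (2, 3, 3), (3, 2, 1), (5, 3, 0), (4, 4, 3), (5, 2, 4)],
  [(3, 3, 0), (4, 3, 1), (3, 4, 2), (2, 4, 1), (2, 3, 3), (3, 2, 2), (4, 2, 3), (5, 3, 2),
   (5, 2, 0), (3, 5, 0), (2, 5, 3)],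
  [(3, 3, 0), (4, 3, 1), (2, 3, 2), (3, 2, 3), (4, 2, 2), (5, 3, 3), (4, 4, 2), (5, 2, 0),
   (3, 5, 0), (2, 5, 4)],
  [(3, 3, 0), (4, 3, 1), (3, 4, 2), (2, 4, 1), (2, 3, 3), (3, 2, 2), (4, 2, 3), (5, 3, 2),
   (4, 4, 3), (5, 2, 4), (3, 5, 0)],
  [(3, 3, 0), (4, 3, 1), (3, 4, 2), (2, 4, 1), (2, 3, 3), (3, 2, 2), (4, 2, 3), (4, 4, 3),
   (5, 2, 4), (2, 5, 3)],
  [(3, 3, 0), (4, 3, 1), (2, 4, 1), (2, 3, 2), (3, 2, 3), (4, 2, 2), (5, 3, 4), (4, 4, 2),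
   (5, 2, 0), (2, 5, 4)],
  [(3, 3, 0), (4, 3, 1), (2, 4, 1), (2, 3, 2), (3, 2, 3), (4, 2, 2), (5, 3, 4), (5, 2, 0),
   (3, 5, 4), (2, 5, 2)],
  [(3, 3, 0), (3, 4, 1), (2, 4, 2), (2, 3, 3), (3, 2, 1), (4, 2, 3), (5, 3, 4), (4, 4, 3),
   (3, 5, 0), (2, 5, 4)],
  [(3, 3, 0), (4, 3, 1), (3, 4, 2), (2, 4, 1), (2, 3, 3), (3, 2, 2), (4, 2, 3), (5, 3, 4),
   (4, 4, 3), (5, 2, 2), (3, 5, 4), (2, 5, 3)],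
  [(3, 3, 0), (4, 3, 1), (3, 4, 2), (2, 4, 1), (2, 3, 3), (3, 2, 2), (4, 2, 4), (5, 3, 2),
   (4, 4, 3), (5, 2, 3), (3, 5, 0), (2, 5, 4)],
  [(4, 3, 0), (3, 4, 1), (2, 4, 0), (2, 3, 2), (3, 2, 1), (4, 2, 3), (5, 3, 1), (5, 2, 4),
   (3, 5, 4), (2, 5, 2)],
  [(3, 3, 0), (4, 3, 1), (3, 4, 2), (2, 4, 1), (2, 3, 3), (4, 2, 4), (5, 3, 4), (5, 2, 0)],
  [(3, 3, 0), (4, 3, 1), (3, 4, 2), (2, 4, 1), (2, 3, 3), (3, 2, 4), (5, 3, 0), (4, 4, 4),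
   (5, 2, 2), (2, 5, 4)],
  [(3, 3, 0), (4, 3, 1), (2, 4, 1), (2, 3, 2), (3, 2, 3), (4, 2, 2), (5, 3, 4), (4, 4, 3),
   (5, 2, 0), (3, 5, 2), (2, 5, 3)],
  [(3, 3, 0), (4, 3, 1), (3, 4, 2), (2, 4, 1), (2, 3, 3), (3, 2, 4), (4, 2, 3), (5, 3, 3),
   (4, 4, 4), (5, 2, 4), (3, 5, 3)],
  [(3, 3, 0), (4, 3, 1), (3, 4, 2), (2, 4, 3), (2, 3, 1), (3, 2, 2), (5, 3, 0), (4, 4, 3),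
   (5, 2, 2), (3, 5, 1), (2, 5, 0)],
  [(3, 3, 0), (3, 4, 1), (2, 4, 2), (2, 3, 3), (3, 2, 1), (5, 3, 0), (5, 2, 4), (3, 5, 3),
   (2, 5, 0)],
  [(3, 3, 0), (2, 4, 1), (2, 3, 2), (3, 2, 3), (5, 3, 0), (4, 4, 4), (5, 2, 3), (3, 5, 1),
   (2, 5, 0)],
  [(3, 3, 0), (4, 3, 1), (3, 4, 2), (2, 4, 3), (4, 2, 3), (5, 3, 2), (4, 4, 3), (5, 2, 0),
   (3, 5, 1)],
  [(3, 3, 0), (4, 3, 1), (3, 4, 2), (3, 2, 2), (4, 2, 3), (5, 3, 2), (5, 2, 0), (3, 5, 4)],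
  [(3, 3, 0), (4, 3, 1), (3, 4, 2), (2, 3, 1), (3, 2, 2), (4, 2, 3), (5, 3, 2), (4, 4, 3),
   (5, 2, 4), (3, 5, 4), (2, 5, 0)],
  [(3, 3, 0), (4, 3, 1), (3, 4, 2), (2, 4, 3), (2, 3, 1), (3, 2, 2), (5, 3, 2), (4, 4, 3),
   (5, 2, 4), (2, 5, 1)],
  [(3, 3, 0), (4, 3, 1), (2, 4, 2), (3, 2, 3), (5, 3, 3), (4, 4, 4), (3, 5, 2), (2, 5, 0)],
  [(3, 3, 0), (4, 3, 1), (3, 4, 2), (2, 4, 3), (2, 3, 1), (3, 2, 2), (4, 2, 3), (5, 3, 3),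
   (4, 4, 4), (5, 2, 0), (3, 5, 3)],
  [(3, 3, 0), (3, 4, 1), (2, 4, 2), (2, 3, 3), (3, 2, 1), (4, 2, 2), (5, 3, 2), (4, 4, 4),
   (5, 2, 1), (3, 5, 2)],
  [(3, 3, 0), (4, 3, 1), (3, 4, 2), (2, 4, 3), (3, 2, 2), (5, 3, 2), (4, 4, 3), (5, 2, 3),
   (3, 5, 4), (2, 5, 0)],
  [(3, 3, 0), (4, 3, 1), (3, 4, 2), (2, 3, 1), (5, 3, 2), (4, 4, 3), (3, 5, 4), (2, 5, 3)],
  [(3, 3, 0), (4, 3, 1), (3, 4, 2), (2, 4, 3), (2, 3, 1), (3, 2, 2), (4, 2, 4), (5, 3, 3),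
   (4, 4, 4), (5, 2, 2), (3, 5, 3), (2, 5, 0)],
  [(3, 3, 0), (3, 4, 1), (2, 3, 2), (3, 2, 1), (4, 2, 3), (5, 3, 4), (4, 4, 3), (3, 5, 4),
   (2, 5, 3)],
  [(3, 3, 0), (4, 3, 1), (3, 4, 2), (2, 4, 3), (2, 3, 1), (3, 2, 3), (4, 2, 4), (5, 3, 0),
   (4, 4, 3), (5, 2, 3), (2, 5, 4)],
  [(3, 4, 0), (2, 4, 1), (2, 3, 2), (3, 2, 1), (4, 2, 3), (5, 3, 4), (4, 4, 1), (5, 2, 1),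
   (3, 5, 2)],
  [(3, 3, 0), (4, 3, 1), (3, 4, 2), (2, 4, 3), (2, 3, 1), (3, 2, 3), (4, 2, 4), (5, 3, 0),
   (4, 4, 4), (5, 2, 3), (3, 5, 3), (2, 5, 1)],
  [(3, 3, 0), (4, 3, 1), (3, 4, 2), (2, 4, 3), (3, 2, 3), (4, 2, 4), (5, 3, 2), (5, 2, 0),
   (3, 5, 4), (2, 5, 0)],
  [(3, 3, 0), (3, 4, 1), (3, 2, 2), (4, 2, 3), (5, 3, 1), (4, 4, 2), (5, 2, 2), (3, 5, 4)],
  [(3, 3, 0), (4, 3, 1), (3, 4, 2), (2, 4, 3), (2, 3, 1), (4, 2, 4), (5, 3, 2), (4, 4, 3),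
   (5, 2, 3), (2, 5, 0)],
  [(3, 3, 0), (4, 3, 1), (3, 4, 2), (2, 4, 3), (2, 3, 1), (3, 2, 3), (4, 2, 4), (5, 3, 2),
   (4, 4, 4), (3, 5, 1)],
  [(3, 3, 0), (4, 3, 1), (3, 4, 2), (2, 4, 3), (2, 3, 1), (3, 2, 3), (4, 2, 4), (5, 3, 2),
   (4, 4, 4), (5, 2, 3), (3, 5, 3), (2, 5, 1)],
  [(3, 3, 0), (4, 3, 1), (3, 4, 2), (2, 3, 1), (3, 2, 3), (4, 2, 4), (5, 3, 3), (4, 4, 4),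
   (5, 2, 0), (2, 5, 4)],
  [(3, 3, 0), (4, 3, 1), (2, 4, 2), (2, 3, 1), (3, 2, 2), (4, 4, 2), (5, 2, 2), (3, 5, 1),
   (2, 5, 3)],
  [(3, 3, 0), (4, 3, 1), (3, 4, 2), (2, 4, 3), (2, 3, 1), (3, 2, 4), (4, 2, 3), (4, 4, 3),
   (3, 5, 1), (2, 5, 0)],
  [(3, 4, 0), (2, 4, 1), (2, 3, 2), (3, 2, 3), (4, 2, 1), (5, 3, 0), (4, 4, 1), (5, 2, 4)],
  [(3, 3, 0), (4, 3, 1), (3, 4, 2), (2, 4, 3), (2, 3, 1), (3, 2, 4), (4, 2, 3), (5, 3, 2),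
   (4, 4, 3), (3, 5, 1)],
  [(4, 3, 0), (3, 4, 1), (2, 4, 2), (2, 3, 0), (3, 2, 3), (5, 2, 4), (3, 5, 2), (2, 5, 4)],
  [(3, 3, 0), (3, 4, 1), (3, 2, 2), (4, 2, 3), (5, 3, 3), (4, 4, 2), (5, 2, 2), (3, 5, 4)],
  [(3, 3, 0), (4, 3, 1), (3, 4, 2), (2, 4, 3), (2, 3, 1), (3, 2, 4), (4, 2, 3), (5, 3, 4),
   (4, 4, 3), (5, 2, 0), (3, 5, 0)],
  [(4, 3, 0), (2, 4, 1), (2, 3, 0), (3, 2, 2), (4, 2, 1), (5, 3, 2), (4, 4, 1), (5, 2, 3),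
   (3, 5, 2), (2, 5, 3)],
  [(3, 3, 0), (4, 3, 1), (3, 4, 2), (2, 4, 3), (3, 2, 1), (4, 2, 4), (5, 3, 2), (4, 4, 3),
   (2, 5, 0)],
  [(3, 3, 0), (4, 3, 1), (3, 4, 2), (2, 4, 1), (2, 3, 3), (3, 2, 2), (4, 2, 3)],
  [(3, 3, 0), (4, 3, 1), (3, 4, 2), (2, 4, 1), (2, 3, 2), (3, 2, 3), (5, 3, 0)],
  [(3, 3, 0), (4, 3, 1), (3, 4, 2), (2, 4, 1), (2, 3, 2), (3, 2, 3), (5, 3, 3), (4, 4, 0)],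
  [(3, 3, 0), (4, 3, 1), (3, 4, 2), (2, 4, 1), (2, 3, 2), (3, 2, 3), (4, 2, 4), (5, 3, 3)],
  [(3, 3, 0), (4, 3, 1), (2, 4, 1), (2, 3, 2), (4, 2, 3), (5, 3, 3), (5, 2, 0)],
  [(3, 4, 0), (2, 4, 1), (2, 3, 0), (3, 2, 2), (4, 2, 3), (5, 3, 3), (4, 4, 2)],
  [(3, 4, 0), (2, 4, 1), (2, 3, 2), (4, 2, 3), (5, 3, 0), (4, 4, 2), (5, 2, 2)],
  [(3, 3, 0), (4, 3, 1), (3, 4, 2), (2, 4, 1), (3, 2, 2), (5, 3, 3), (4, 4, 0)],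
  [(3, 3, 0), (4, 3, 1), (3, 4, 2), (2, 4, 1), (2, 3, 3), (4, 2, 2), (5, 3, 0), (5, 2, 4)],
  [(3, 3, 0), (4, 3, 1), (3, 4, 2), (2, 4, 1), (2, 3, 3), (4, 2, 2), (5, 2, 3)],
  [(3, 3, 0), (4, 3, 1), (3, 4, 2), (2, 4, 1), (3, 2, 3), (4, 2, 2), (5, 3, 4)],
  [(3, 3, 0), (4, 3, 1), (3, 4, 2), (2, 4, 1), (2, 3, 3), (3, 2, 4), (5, 3, 0), (4, 4, 3),
   (5, 2, 2)],
  [(3, 3, 0), (4, 3, 1), (3, 4, 2), (2, 4, 1), (2, 3, 3), (4, 2, 3), (5, 3, 0), (4, 4, 4),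
   (5, 2, 2)],
  [(3, 3, 0), (4, 3, 1), (3, 4, 2), (2, 4, 1), (2, 3, 3), (3, 2, 4), (4, 4, 4), (5, 2, 4)],
  [(3, 3, 0), (4, 3, 1), (2, 4, 1), (2, 3, 2), (3, 2, 3), (4, 2, 2), (5, 3, 4), (5, 2, 3)],
  [(3, 3, 0), (4, 3, 1), (3, 4, 2), (2, 4, 1), (2, 3, 3), (3, 2, 4), (5, 3, 2), (4, 4, 4)],
  [(3, 3, 0), (4, 3, 1), (3, 4, 2), (2, 4, 1), (2, 3, 3), (4, 4, 0), (5, 2, 4)],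
  [(4, 3, 0), (3, 4, 1), (2, 4, 0), (2, 3, 2), (3, 2, 3), (4, 2, 2), (5, 3, 2), (4, 4, 3),
   (5, 2, 1)],
  [(3, 3, 0), (4, 3, 1), (3, 4, 2), (2, 4, 1), (2, 3, 3), (3, 2, 4), (5, 3, 4), (5, 2, 2)],
  [(3, 3, 0), (3, 4, 1), (2, 4, 2), (2, 3, 3), (3, 2, 1), (4, 2, 2), (5, 3, 1), (5, 2, 4)],
  [(3, 3, 0), (4, 3, 1), (3, 4, 2), (2, 4, 3), (5, 3, 2), (4, 4, 3), (5, 2, 3)],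
  [(3, 3, 0), (4, 3, 1), (2, 4, 2), (3, 2, 3), (5, 3, 4), (4, 4, 2), (5, 2, 2)],
  [(3, 3, 0), (4, 3, 1), (2, 3, 1), (3, 2, 2), (4, 2, 3), (5, 3, 4), (4, 4, 2), (5, 2, 2)],
  [(3, 3, 0), (4, 3, 1), (3, 4, 2), (2, 4, 3), (2, 3, 2), (3, 2, 4), (5, 3, 2), (4, 4, 3)],
  [(3, 3, 0), (3, 4, 1), (2, 4, 2), (2, 3, 1), (3, 2, 3), (5, 3, 2), (4, 4, 3), (5, 2, 1)],
  [(3, 3, 0), (3, 4, 1), (2, 4, 2), (2, 3, 1), (3, 2, 3), (4, 2, 2), (4, 4, 2), (5, 2, 1)],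
  [(3, 3, 0), (4, 3, 1), (3, 4, 2), (2, 4, 3), (3, 2, 3), (4, 2, 2), (5, 3, 3)],
  [(3, 3, 0), (3, 4, 1), (2, 3, 2), (4, 2, 1), (5, 3, 2), (4, 4, 3)],
  [(3, 3, 0), (4, 3, 1), (3, 4, 2), (2, 4, 1), (2, 3, 3), (3, 2, 2), (4, 2, 4), (5, 3, 0),
   (4, 4, 3), (5, 2, 3), (3, 5, 0), (2, 5, 4)],
  [(3, 3, 0), (2, 4, 1), (2, 3, 2), (3, 2, 3), (4, 2, 4), (4, 4, 2), (5, 2, 0), (3, 5, 0),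
   (2, 5, 4)],
  [(3, 3, 0), (4, 3, 1), (3, 4, 2), (2, 4, 3), (2, 3, 1), (3, 2, 2), (4, 2, 3), (3, 5, 0),
   (2, 5, 4)],
  [(3, 3, 0), (4, 3, 1), (2, 4, 2), (2, 3, 1), (3, 2, 3), (4, 2, 2), (5, 3, 4), (5, 2, 0),
   (2, 5, 1)],
  [(3, 3, 0), (4, 3, 1), (3, 4, 2), (2, 4, 3), (2, 3, 1), (3, 2, 2), (4, 2, 3), (5, 3, 4),
   (4, 4, 3), (5, 2, 2), (3, 5, 4)],
  [(3, 3, 0), (3, 4, 1), (2, 4, 2), (2, 3, 3), (3, 2, 1), (4, 2, 4), (5, 3, 0), (5, 2, 1),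
   (3, 5, 3)],
  [(3, 3, 0), (4, 3, 1), (3, 4, 2), (2, 4, 3), (2, 3, 1), (3, 2, 2), (4, 2, 4), (4, 4, 3),
   (3, 5, 1)],
  [(3, 3, 0), (4, 3, 1), (3, 4, 2), (2, 4, 3), (2, 3, 1), (4, 2, 4), (5, 2, 0), (3, 5, 3),
   (2, 5, 1)],
  [(3, 3, 0), (4, 3, 1), (3, 4, 2), (2, 4, 3), (2, 3, 1), (3, 2, 2), (5, 3, 3), (4, 4, 4),
   (5, 2, 2), (3, 5, 3)],
  [(3, 3, 0), (2, 4, 1), (2, 3, 2), (3, 2, 1), (4, 2, 3), (5, 3, 4), (4, 4, 3)],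
  [(3, 3, 0), (4, 3, 1), (3, 4, 2), (2, 4, 3), (2, 3, 1), (3, 2, 4), (4, 2, 3), (5, 3, 2),
   (4, 4, 3), (5, 2, 4), (2, 5, 4)],
  [(3, 3, 0), (4, 3, 1), (3, 4, 2), (2, 4, 3), (2, 3, 1), (3, 2, 4), (4, 2, 3), (5, 3, 2),
   (5, 2, 4), (2, 5, 0)],
  [(4, 3, 0), (3, 4, 1), (2, 4, 2), (2, 3, 0), (4, 2, 2), (5, 3, 1), (4, 4, 2), (5, 2, 3),
   (3, 5, 3), (2, 5, 0)],
  [(3, 3, 0), (4, 3, 1), (3, 4, 2), (2, 4, 3), (2, 3, 1), (4, 2, 3), (5, 3, 4), (4, 4, 3),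
   (5, 2, 2), (3, 5, 0)],
  [(3, 3, 0), (4, 3, 1), (3, 4, 2), (2, 4, 1), (2, 3, 2)],
  [(3, 3, 0), (4, 3, 1), (3, 4, 2), (2, 4, 1), (2, 3, 3), (3, 2, 4)],
  [(3, 3, 0), (4, 3, 1), (3, 4, 2), (2, 4, 1), (2, 3, 3), (3, 2, 2), (4, 2, 4), (5, 3, 0),
   (4, 4, 3), (5, 2, 2)],
  [(3, 3, 0), (4, 3, 1), (3, 4, 2), (2, 4, 1), (2, 3, 3), (4, 2, 4), (5, 3, 0), (4, 4, 3),
   (5, 2, 3)],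
  [(3, 3, 0), (4, 3, 1), (3, 4, 2), (2, 4, 1), (2, 3, 3), (3, 2, 2), (4, 2, 4), (5, 3, 0),
   (4, 4, 4)],
  [(3, 3, 0), (4, 3, 1), (3, 4, 2), (2, 4, 1), (3, 2, 2), (4, 2, 3), (5, 3, 2), (4, 4, 3)],
  [(3, 3, 0), (4, 3, 1), (2, 4, 1), (2, 3, 2), (3, 2, 3), (5, 3, 2), (4, 4, 4), (5, 2, 3)],
  [(4, 3, 0), (3, 4, 1), (2, 3, 2), (3, 2, 1), (4, 2, 3), (5, 3, 3), (4, 4, 2)],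
  [(3, 3, 0), (4, 3, 1), (3, 4, 2), (2, 4, 3), (2, 3, 1), (3, 2, 2), (4, 2, 3), (5, 3, 0),
   (4, 4, 3)],
  [(3, 3, 0), (4, 3, 1), (3, 4, 2), (2, 4, 3), (2, 3, 1), (3, 2, 2), (4, 2, 3), (4, 4, 3),
   (5, 2, 2)],
  [(3, 3, 0), (4, 3, 1), (3, 4, 2), (2, 4, 3), (2, 3, 1), (3, 2, 2), (4, 2, 4), (4, 4, 4),
   (5, 2, 2)],
  [(3, 3, 0), (4, 3, 1), (3, 4, 2), (2, 4, 3), (2, 3, 1), (3, 2, 2), (4, 2, 4), (5, 3, 4),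
   (4, 4, 3), (5, 2, 2)],
  [(3, 3, 0), (4, 3, 1), (3, 4, 2), (2, 4, 3), (3, 2, 3), (4, 2, 4), (5, 3, 3), (4, 4, 4)],
  [(3, 3, 0), (3, 4, 1), (2, 4, 2), (3, 2, 3), (4, 2, 1), (5, 3, 0), (5, 2, 3)],
  [(3, 3, 0), (4, 3, 1), (3, 4, 2), (2, 4, 3), (2, 3, 1), (3, 2, 4), (4, 2, 2), (5, 3, 0),
   (5, 2, 3)],
  [(3, 3, 0), (3, 4, 1), (2, 4, 2), (2, 3, 3), (3, 2, 1), (4, 2, 2), (4, 4, 2), (5, 2, 1)],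
  [(3, 3, 0), (4, 3, 1), (3, 4, 2), (2, 4, 1), (2, 3, 3), (3, 2, 2), (4, 2, 4)],
  [(3, 3, 0), (4, 3, 1), (3, 4, 2), (2, 4, 3), (2, 3, 1), (3, 2, 2), (4, 2, 3)],
  [(3, 3, 0), (4, 3, 1), (3, 4, 2), (2, 3, 1), (3, 2, 2), (4, 2, 3)],
  [(3, 3, 0), (4, 3, 1), (3, 4, 2)]]

/-- The certificates for the exclusion of the patterns. -/
def certificates : List (List ℕ) := [
  [5234],
  [5230],
  [3793123621502243112971002867792047362614022193409369600218012220],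
  [157351878172472623235043529485202084386949531681824795760528675361413487382392935552506441891116080959980051508910336],
  [199910663475020196952],
  [3395032539930929684702847371486584073073172397949565296396000980703788],
  [197952019603254063092],
  [212808258265544832552],
  [650968460295878744463019599752469998688],
  [25746679014709],
  [21972233551301431310450988986615779665994823225523021023691760890424726273227315692383323022870058291193177435140407112613417666816067576261330273793282338162853253975680158448484583158312347325587652968834961869792756388157575562299905324,
  3170187700850010051183912018803998820380101811599884079428524193481832304697115261670615814201569603755678679061019539154425342670967137298382963426543919300015335227011267893416302472976338749636266869333007385155293270654213831991518587348,
  52786396477566012700011993006952532236883011224913276798280936717338274371750845251940073767676000389951136573021893388202134518209017070762486359951964324471623482067065403610285769930849464854355921042360143412827710989600108628108907162,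
  99666303650360875085669571998139938066154057527133424178404433547969976425330764976655720252356281731213395850206252343206016582215105063436517489913009483452911170362726571322062771548986830447776367775486370979632980403457935221610307798,
  8491001239946645450911651080850667669864819734867434308605637669632654756904142822153904173693197582340788382331354116250292273619917518838882746123237659363537051263129342369638209647737643442650143755501623789884938404124657613268805246,
  621232918252041470045526139454420494225812931847905025083381870494447124781502722182812713671837695487656010417316136091344231203726089328516371067331129103671837906775100677778281744294842114763202327236830910822317487113228449316369620888,
  48841061288558371767558570242145999580735559459994608261383305973601993880593239958648125304793832741370937528945973022005570727398965091960049691505875296497028104708109032953802871016577152702943879288238922052598249401404950187678584,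
  11812010091211003364049903523305534183202494915986687588776577596526582368408114488164655],
  [5503056029046353372750228151526572],
  [5357872637161157977226360601395679477106797023238114062164994742688113398797896166075264406606683456032108666985201680635707694097332709997066296799478719934984501367393562631396162911793355355083835312734205708807794028640939162976280,
  3095633726084931610955894082746404662540543864631756913517645386318777213885069292115872104362307449725076729751285328194325474413391446103649236006844179957116743940346978830230321766357080464309490589200727945199138887242417044742238803915,
  43689242110200837260589716566311586191484976854812620170191921103991990556213813427421810774610342899145523664208263828533596573179671450801816581774061873117167024492133404593220017746959471628601883861414430107433736891707393181780535365,
  236960821776293804121208913715290907679519451702644764638774155390568580203858074237955518142913245710280470485502610392741750662754175196618184950484281802897963146625424372193226979419462582806860918373263842437736549748965616078615870786,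
  3074274282603361301477416779125003451791415438428709174630544642922610431333305556960070635761837048438202632805800744943569672870696400818887830680789697832266285707780082214162799558415037892962917115873884643305889893373125063576877813,
  5868340532224077374526504430507416612465034789259603550679928780214786188673938511248328555384308621467417858299375631031581712006074613442580213955217735869152192167713761732917545260026983077883111108769693096146320103516257115595365,
  97223444150711861906130687113801568767163401768541150357952821576000847840940854890670815660096152247692141446325495403544916177496327236158235148412385097997410428190953103134667939452450384794258358056569583105174397512635360128528372207,
  2242642926573047281476296231446864253185851823883221629640822538666448921274331329284507088687169585711570674130669156829813751662727584307588341530671010747349368976204377090326393461823265505638294675858396950613407334704953601550586163778,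
  3116417071],
  [33096099015624861192408982368078264991735091126427746945519221239210909293576133436801805962652382624272215008900368479571178777456873660971221547974041230819841837959593052879183976746527253993108737085572759689743666992742800281816644,
  6133387230610809255605025903308747008333541210795804613496050156579697975806774472306157383747519493238491494173727544211129021133391249324633420744871751012010513721797178026474065680783820027527688689651087782841368368427050790152052813967,
  2052410491156768812219569940870351920036870321022404478739942199069323326572018956457576091558507675771028783625732889019290254354477578172154109865487905017758209388773046796963468333033695294709996856526156087830834040493404097281049258564,
  2830445939361779544480455250156397607688191927226523470658933063987846157378454633491610222190404023164479958324692929261749861088694484971965220189235246148709849403816939171251812374337695905762059242122619435038916888662870947191706857,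
  327511604763928557268721672969480304949336261524012694344315629677025203115399876084488551044634719588827047632440514957011122561480654017377053315675105308959505505237214601719375163035440124989536623369431447213829279861238091897891726329,
  2240506552879152215067949734476192262533512891623972549806306326073828271800740098113386410396695053691208215983406062357382405367111880213816961344694499926845042658743160624815794316960799350813405342848375302069158110307596660826921909,
  56547239565854810353202740568032607292255493638634766638876787562799365253365478203563998159950275469963396449993387661886996034678110223270629117924959778530104380616245930137504258171273200213899253802773036750157058006668937149705667561,
  8894995262136670996761767997678437457119503777292185320092663913596181524016906],
  [2310402777614495432637532800283206701738113580740919257678265297201276775106375749975815897117159966423681855011682250527524816080116090657481189891336570895545552117352485780362398779697045584435414808934696554855485756820441079062210500,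
  11502741243790756146184981848405075084175173351356575633058902137671139845276122427149938089195526632846026976556984682647031317533838954512416511253111389898024124508304172085048327354195679848581886846446798787992940003333384021431384877,
  467680301730112626521772108635285172641765539727885580823074695138709390674653169948373626772549656036402965393113780078925986390600720862958800163796485691974824303972016269507253745911811153308621457426787361701029550688106302364584514253,
  8906786487193654971032105717982222345164481634294685874876775804127093803464020019518716732060368187484043237027658578129050017000434482838327434093932129604528125334103866710615597496205394692420409625338185442507279846265903651204044265,
  574555571250553810294809529273889944152893476525410298665879181277447407924884256985857819416531902485677178505357279010545639732535841867594197638720518290169354096312021527989339248140393891854354574787396765916215194638092212417585312884,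
  14999645322620811027519489675257794676732157835674575574072712592715111977216891156261159965277416232552096062000367446758336802594821594014743126723312346306047147872213932345801109912945032071371395518849281808485468613949897876627408758,
  10311965680803837158841578003241984766367486278048472512627249922627034198151293136474690267838466106292473857711064013435845063054875532156065574204575388344506674852251854891805756207825056865193041701877737864607755324640369967123465792,
  3664882421237168257372414097340479969368365142398872332876939104012336521892729961728534233310055948326888278],
  [1116237420904209340015618488],
  [123022637122888309740463554325321295377314819999275582421147883307875057380096478180660481250462161369212983823018264196141182409673996729891295485269846651853756203183891884799293764362477381608549079279645497065056617060951273967194672500,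
  2233968562681019027382426559032754487414111267103924528183125526584759121546108617197904042891988774478279461147650271161089317447288289102747322135970489120151713473371906652348181337925569880826917175234647273542930891875499039528474283412,
  4960930425792982082540288346617720773201940147613385155017116645264241655936471512088887416008596047527716788303181158214803353604659206451343618151010134733134338134284564240186848852278017802792562801450279637574411511936545532087183040,
  42729283237346752681890416237796176262514990738232947602307227817220355633364325537918651336833721134663711646658341203983893763962289957165597998311994637624751143960390036576948026381165955763483620301761445284798258153808054597934828550,
  100642789047190924168619051656568024569564562866843953474528670903575752417004426232845193130746550980976184316611978106905681050575387416451016005743039022611620586818129328983360568970153497424035694795243327527598929913303464578790,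
  10204761394948153899082668864802509425386828403936629447795239126342643921871065686484627484095281964868813801126911017695],
  [4265257529620610123546019413368128472911262966127487123879594118828528237808212524411613798028185601592198683526752208124879489824697888616891704795312766481801605036471088217753376585622381220784324666508835173248116077795551535381673963568,
  7125228980613622588926995677966639793266873941167956698057225176995182595054702493915499178694044846646946152388305655812769703757858776366789642123560347838146365105366879657440770828539242530570165326434514467759281940390729679324200054350,
  4212157685678152214988210452298648695353831021405468414232936114496138632021397446102651289249640047736396666874908905428149209143155276583629918625297043936543960605451267508767080968408795440422419851637198288841524772234527794438498971860,
  8278978931958345898984778071541317997242983096116262790671799801596220362216409866880054707191348074574169396284135170956471331914528893928958665434488725177729963786799019689960610661986461307637965480447789874267438070923283527856224247118,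
  32840371149652011094493580872616228786336877841970047689555586673150667183049257016804384094977713124263003327233810353204919129001401848289261823789778925492871782490317055069505906695383910427740724876221331264998652939783940593615791809,
  7865575437231858878570683787806531584801248929011540014115905039521222001112630177480360647323507504209531410233731685108595445653209226517936732417228874136200013889525964364421402258396706184530126898193475907927905624681259596069,
  239950298122349114542955808576218771196266777331383056664104047408076056540204384698154150619682312062588599051026817938560369613238111842625196907470315699490637386253916071185765673037142914426569518475999174332357807672377708606930573663,
  232950944311329275480675461834266],
  [3976153588930971328485743579127564191727643584287741772839900982737484488860],
  [3394673879072022469890042453361687240222635947145884],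
  [811369213836276199805665087860985879826773450740182599796037782990804441309911935323747532514041550783523045453431973372094197277508287557828297301626438801380805744448430745770112523808915372876184398537769739167013100],
  [16700904480194112853466040082131096651117545447115966135460531131060786187910631780868461214995170291232648225721348711626208831527428295354199310127908542580518931800815699626814048562593672582174476229725261693155142184118223861879079784,
  191344301022777617176543414489300974090450519229394668098727892743992797061730203013130210541962488957445085518814429773906524673899792499108389780497506894017099162201829693365358247567540261416077738411367855894053162365874838885104821087,
  32560246697032977314207514646426355330700776275162645387316333045072722722808125023581064173156290577938614560345868454023108771455202131977693360215507189523157662168961439693396844771472499840319558326435183598294586771824960823613985350,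
  110861899372928386150603579556473021117550528291537427880264937169832919974581966637022916852256978320136596068815209511128168386555491479634879843322174709638798198640187111823370076121340644835916611644330846088681802497278368785575919281,
  5436065613525328833960879092902805835417069820895003193883971626601382954069407505216471102084146226934393703080161965548819734501349849694554442052224630041700363816451723875058552634936312521154245474340464699751566002844507063730232332,
  232946095163574524729301016301282],
  [27321364374709],
  [10424908800331007946622637897275617341873089399417938885283705565500945568258425714165060579593412986949833216557860015499892281857190007979712732545215130493463206371306064891614753435717821697542510549689596142986328172548557103879008,
  121742316559467832683418992175220889047161255015006013095558186780345052737695993792426499759692300467463592441415957686568749670781455666160714185180729356701431355763390394259938269912829969092996764182129058571263173660705104107035,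
  11296129561391054567534859767282818145034703871576405906126302278274044613464493438459469703129635074693250373441452644366052777880367480078361092448414823427508347330728373853400137898787760060832484473878172176637170185055528798459611,
  48612606819101248118629982666757521274360971564797614250388365860511685990601766918219599555823655060378052177848422478418637651274594718376007226218856700455481910090428162421701728593986049915426977111538939413799933157604609350903216415,
  761929805283038995536460952137259721389021508168153009219847130309615303077109817714729007686536918551200972476285909147277206718485869596258098415734414089647844121462],
  [197954255197607002468],
  [468437547522532236571793289563544822582485652481868717009092301059432410042724872],
  [49983601936322009486961363522817590607265740214113427997142281926820276414794564597211841444282662816149641197732334643434880928985269511057753400424333190016453798861848193652118858178657876198467371521449073137546441823379544119547041580,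
  183150453437400812911248444697080427467650227608264066038990631834911060216647081640075605846995751631869528639136003739223026216933321219358812159061543577185738034652671618506372504429492836829592243801162795141008672567240738523328240,
  103300114833803679984461935402146538482795049923645278370501493298186443192318712935817883178616020452340033974830904084375296196091810876888160374461339447202586422341040644444618154151755128670300021676903930568589924567401726790482602347,
  355408206343216680181963739655595273305669933496352424380159649425212176663474889065304151485228677130414438358594382815245126003080179486967477202581585323669916557582307167485730368327302465456265196832843040998378614751775393963071299110,
  2939517256365233439298688222117718838753461554935671354635081729923677113324982866308308261809643681092602245693847300400324581631813422107137580944259711622867275934607559709825104639081274287430207762347484732479489501538253719874229761611,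
  146881576378975483804211381998766317951013716760731674809709815887646111716381453688780822170406564965279485167064565502742052058561542752561085557638143025858040495017032024308774266437198494924974982184693585639783236212214386973900,
  1639664941282870882420831545838235103197195045615908767768468428943037886638186889850573687415828047670205590084690668086724885147631914307391940909859480767770005422855815986001362030714596049189999078847622128530066491500951389876195,
  9307559282659028565072099733234277570833697149755994550050943486499819628863624137380267194583892984908224805559672052771645572593003735875201255144890277074870752654028584772309091791129660626220109831630465879043727675614520976018412202347,
  4014303630029124395633006409974510717478891479680561781398484518112663433908242337852216081004997159634423450243456312800033285013368521494332363023003212901482379291109035976418261821930861876164701876626684778324782904252071901471808311605,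
  7870044747062278922942733610498485651593739915220370707451105334679612956825949353675587124262799870511600165298716426700976499203535591041148722629501555351146855154475544881031615756246933064429357417586402231650388850957673747966656,
  7327155149583512397626794277777347],
  [139603867944553075950567276],
  [227301865174498698449204558246045499664732099330253047241054127817247792073934380082626303450893356841176467464493708731198001988938649447222490969729993049589329204174799419262925929167459229795501033705376438984191099946112737013354668,
  310799194324869324046541684913509785964244978535010201950988916715108986462658974225178186160196095827802850211403610397078428076362829035984083837393092299752364059157972967445611914799563342714348697549365467788751952125547621185132567967,
  12024032376987426492199071047014900546684634017336770863404002123590641526636623983669976143729977700445833127562142035152366786991823360374383322021989680098798445930058213848265222805495005850816822473933693986684032564631115602473624870,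
  34716711053484978262343240428139451195],
  [53389725943685247953563940795674129321734798796518450133251242227521521776960424658021543694304850075256079974150819953283239546564651110191777323274096021764909542490132900559893864247043395174221266254828514637201409524245055717723576208,
  2748088510181789337250750797193082983811567904618631531266776544087436079581588201270313728482633186570541224355411153430553870538727490103776225543273368430336381781475161395032706657721810869218647994003954481821959479670885271520211323,
  135773562815455636439668022196332346844360698342076366683406752273971161838837093863906436602815421869],
  [16513062665336398766926998262584946750207247451001469252644589305714656861754198325095424432936847355340738995445056889305807485467007075867919726958733828694028787723984635916971688835227207058365080948274930426972248881279308986441286924,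
  33709899338331888919297579023393276667432151022587479147022525068908561891317242123479406612607883506736879975569103525540339761735449926501404101387145143573297577494839653169018821727301549499915245140261040653408713096357791657374097666,
  69985939808558843011508342561626683046843083468387599531809448407042620799156690263582322725068358789324493259227829993711036159043193986859083602372549729077706201394207455810367246010970078750712780069800245986338306905461684585270911722,
  518831296036481953566965339544014434400490197732912209680228143434638821360782418910401131304836084452289613680209860836533525727432408209109504594767713002793359049001916770472224958585816006288553206135251058053968541354036119393050648829,
  542099974306427129081567913334971962524938679119341097855966436425594097213338303545],
  [4372560798770243804367675245889074684740265024863685384985553381540023859335767044669737275561478396910296993307550661792671432216530667751980223538545413762836661971727373074226727000435948602180695554406756136274823067055723424949511637904,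
  58757516505258361841024334405437781075891423636282856606254825339594482457296309553637676328443956427986037734923476373301943488028725367882656292877207508202449774573734630513575032269012505501900852314463675181275446941305272578166038279,
  4841074347550559284512730602911108988815860891748565630120374206678103862982389285139053607858806849355854551209352106467854552267558746387856684670356821139417800675903746843592049275803073468779637805836319621962517102548273750596,
  26335297897999454484312034197648479462661105036816468997574488935865635650347059936050947980728909759849642225666080936901437050509350549779078908642017223785036345806760994030002042764585571565982736197361025758970169131435822907415246183,
  189037214066376060058269000832296561704085898065048966887203715509051812956989769955892256982268058337633496408602831600399540282128758059075301410594685760603218847880089846759030709957565743796522838470279171298405061107105012575749398141,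
  21047379123104943764018664309720732090391],
  [5257537465144036525052967347295661742208],
  [1044257070461928930450515652],
  [753828112700451176087291455522380],
  [8159495125444114546687923625612042736],
  [624600800438228454736492901589186887513320],
  [28785789553917],
  [42236558512374460005963506583294774269624998057420624654815580891512761813152605034930187490569262257565351834914053741040863536269088918136262825018002058983692717559072586783071446586186496388584403854674580246271785873024103064196050432,
  285454575810946996581803119762631616022729484788786989913582979045997740009456458915195268087532425461250838323644699948059441459308700845020316048407122389590990464440694204062865503377658119232539814603028957125307648895263766271046602,
  17092500909791846045695239611530634479003576899843939290141811160251855038877712768834136332345103285738363785061246923126649973049996170469452057869792721650460238042343155363100208067057337184689923999215603944805111834730378491719,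
  109408346125326579048778832008567431318080561514435081311825444719274982128802849831455828923244480561714019818722117357094811882840897798552380474200765945912428784709610211670335530308435294926575145911414799786797895784244309060763,
  222227234672075711824548621854742060771799133689591638033156316704433781876528687832509936042000691374443451705943610981881211572917708442402322250046780380069345190028552521070268066376828502762078726593292316236530627931030431519823,
  6156889947110142001056576628399630394392722302434051281170830567479810366619495130679770303538897876054293165264833728922815624821907670727413930518871516191792560767377421904186533374395377991013971525397717223451475380909026456466542824207,
  2182814297082938213223369970776156694954582727567689088523842916909385279191740987680364572507714445598427608129],
  [200568003904922258052],
  [6774555635627393938950408410847416390760185830652435990797564818470593843733860769528625315073849871414102377764995593631070196129828390773246413289597704212453762741122604371678238815742534492171201043355036927506963156803761683680117947808,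
  569321915042374367591372213205295901536933017396176193055731605864336713078917120301904573725795370337970098851572491885918668320099006914700251331624424502411952912952442425417797685946401197997828821601034229875441735055329639990146966450,
  48356265431887226431001253653152223812378503579738420609379681733692278119413020057598543922328578772591938360210287226129873171911016223301693522965206744113772805064859712472954450677841575545926959487564204729885471367276085651703380538,
  7410088109423783241995806051695346494123597745009435321036397309304232439431837871144327759980527465603690724397783688321844014338501148812484490526847579632945193821700019312974932910438444627546693932721009256803731627122305634941457610790,
  53127360387587459229282630308065003232496219669405973202129626009326171091132056185773246684543194315282176188194297339276809929921030080969681699476409295287087306567770970621808875394035204473899938561437955543910679008492623459238609132,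
  1919565253270174789688345064870919287830468478403381893655970728169549625761449634064640961521101317374874022502882383165545142942250571112109979134456290971867152877561403342709850622432015471782473039346359770641092423510414284217867705929,
  90102871263631543483260134150324425818290759791200418270905142989232200515364687624511505482588104130116158849357588808095704528390240537045662774162786055074637144355456545109955627009630653383606005651103167703618626430409805409681866476,
  44535422815591181105228616931779966442362283381516283837589924625385707937323830209853082633654862457559171538888753170523596079032685663468115363352698245678004416442275604877591982301836531742624598092632123441345109865466733816371489326,
  118557375566862636065743622182594816018181581006659358071599837625467928940740398762086440711137281347585449224349994257727234342062547633404891936857443729445477859428922383601896163009358327168997488366496669030975169055855804167043729,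
  3844020397233717102478702034140102535425327371714756557600289790625461170740221292784735306440946212147021204947725592771996228124243446983958309967291508431323406049252354329057409627855715453261610272598528510048175839730221283232001691,
  87677255125018971228592277],
  [106350289068791670811534265396399012771322733732411842862314729013854268084514268746280932382036382853763865543735014792811911482005441921897326247625545226373434236730242882672222672609215775838466318508383512740685011380540052433476460172,
  118462143720832433423270728276796395400213535428646431426464052234922275024799277443924195538819301073331954639243020777731369179474901480050502679908275543882697501797971516713231481155792302266402097312745213548299311011781812957944040132,
  2047525057506679377057739816830210166950092932937326937702128735703743589356132959293816473823450372670504311733204246065208748834896893935136749923888362152647348615903728471300387981886079759006116044802745450130656830472112660008961612484,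
  5201710434853815539302354554020105469409586243410909996140798558818762370667780923402411547533602253577479157682711214358268432821082610537582206485432938261425344808218356192925892102175365625393120405546650392534995700004599925238493442969,
  7467221082246936343615192899023733621330885688081510748550088594736931987098525889550347491566926983105412620653725180011519242368953314971595655116336029335836649371268923825273963287412334440777924408694800511160658606565577755441808987700,
  5262279107273396871145075848122504485428309216590024953713737076845684338615980966930837225143775934052043576253723630612580829574567014867200875225061931161289671988817524836121966683707064376370145520120233971539259216401041692463044578585,
  4852573746914239228564656639740781283849861971754900857890301036531179465734292150298230617604834496522700272832261],
  [678397112126630628033526356685526970064],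
  [16596130091344480514017812008955664233867648879013551061201398585897279003575647902662968605315865406594311165408165985167230119559508322582208165586654333164526106218931799787972573307161500013952381504569680393927011912444250271151410964,
  1724171389457029415765848181699619784078645681130058741329064954527987193496679130957705503725219096967027816846743572989487932595627781639325451967135843961515458221944045368376140860703564438473337155865058276340113485069789152298088471,
  117165087195116164373105300485879491741428813805],
  [1433306752542863932473811755639172711985662062839343692223735189204697034581139112294598225700266123173498461375601072639071151426504648750741535256563460238018770172801512377028476575900161154830154424380430421284298097521955311423117492,
  13285534710241368720159946788033499146490202187540532988407330625522758616628287812272062984904129136083438542549737929733868511424811616356463643694648332188346635017373654758280312551139925011853628271937248942014384743910949984288547767,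
  5033495728811968342958556864296646546300333766372211772476779812380633289086604237951644117074194958129359418978822764764581003561273446441632804622007328019751180336618593794432747835393990516659627652590263341516357261612025901341955085080,
  1488755076876353563456638859494333319630729545384137189277984461334451763646668358761823463278045842850086954480905600727340062416693304140320656845529412287234867754368179839623090525316075080219114524929536029163597995852123369414231505088,
  62630401987022233473940561270364887794229167324554147924084899456316362629446729532341036672666294552236218474795183431364190313885083577774895919996186153614534290209288608537132179022232844563065248908690362259134339917756813218431621136,
  77442572245250385931870298520851697579665325903085842261288403114059486612317754086875399775229472559899372066216192710665199224047281019747773989229536586941859564133403234079731788533855213171414122085938515891476648478481596387386539574],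
  [1117877453615060238326910368],
  [1354205108826051628141771536900980692820169013982541760205816295945102441215933613646616666836923579013349035879034629534948669594107032379186108721549936225217859644326056041652925269899592515299629290556749145215572856451312707377568,
  15148141407787],
  [399672412999561816077907187870196515618306586185459524739907308971463411760635863527962829564],
  [2345956593458151804255118307567517002599111824507096058023412123097218508380742131688017970303194744723191147600029511170968895931067891396681118685033687934361925112565065167883305810136888690200135627708699200657408679263276327925397166132,
  138056958362817582173868948569332789104260211750944445826066905093254456388887595289189391721848550086061100412104330888014830796401031241465054310490964311016561568500074887585405597262222927129813308274989296596185631851827265288934308283,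
  47857007553524166714165753592426938578213957682580923039659171157580184572133836161271229848522912924352360384984129143904251022574284674662155146915487331456574794520138029913630738235624778064713381726925341782609077931051307784446409,
  9506046380498093716406511555084463864758608844843233522158725202346252945624819188174010317790606826402462914321417786063777928714780069080459572236790763909508857835362370253734397330659062643631256774284210287542563983996341580097045591,
  3328030481847844558759545639899527678576278761428200275671509906818161887448097512730021671268878458997998900032111479543655910762795940072291420627827914488905114913151087158270338467034730336639849867219256268190174481673631496077524826008,
  3217510634587412900175493],
  [64297137744288655244144624801734786295952667234211778480667676796394851727939542849086672377238624691913527596220590766167177188194949687285112375260825899725160945682843937452414076091269618331760664798529436751748587681762015152940876,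
  45196253972733606678147275802955984853937286317781717050032064923760951111060536600544390387315568389573077890309300522121264824399567884718718477924143],
  [28008597897040578738768311085224645106990780534119112880252418487202144150179894072762222147970815963638720897625576594464714274907117334637571592359309057859067359938976492246440821696337183387401850766861205914714743476842578333420,
  646029162283442923068978086806034151558169615737793386571105419759773644844670111999058103086882189749127334638544481910464882614891444411256576798413000926170810027444221515613953755773072339883549026352299906585394281342481565961281045591,
  15767782],
  [4573226170124976555527195129084139117438890264424062873697018377470678996127677718471267194796917169372159175749987243464829349468922684087342150171389254500564287709214525204407005474925707203116928114066304086891707702389399394944074920304,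
  1452288086765168270768515101034155756637699555264384528034710615544389798492342200632762174000383748097317357624330511467324587599462957486728631152351191401877286508837879241823338667873996211623983705165593672343618210250806805731085169,
  1925198381368644509018909971037419821337767264333197053443881820076525838865930781515084093354390268173211563667187288239030236997611785536934221111133707931079698535909170509143498979219968108629564298311455525493797997680137465102235,
  12222554207350237864150245012077026118102094130769731865689658070245901964343706590888840440488741732985867495180706005850039833121596941910937483517701321554091665840641943723975096783607955477445363286081615639503021759866167254121305915,
  31337201597857093492761920971600844731296086982657114313671563693742812082564359980066944131762962580754011820224954867293481108532704916220811531909372379431405473814283567822509170720701565531219902165486516809808337916123980725485255883,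
  280801336104262643489805552910746506490883247442921553605994985898339228209872729264290382402029537767617880453898990779446250837828985896591266252179847335419619341118592057631905024231631613642041677009222261476494222265233932075370783,
  222321349548685836993169393151014717473364633246800357497890319208898751355534566236637875335702408635525668373769691356445436481476280828747741216841780981609322257398491365522833597135641224293998954133580194204639961085839208521727936707,
  11999052273850220486404587866559900747840610030406067398933728977791181755472079867806189494981832561832538644683364302628862377675823255822631311721532028118843258368562060969417178440080640467885304420944210927857665624315366563239160,
  9133911614534450252285314256838164925621974431560258959679696164557202381043734752960676700052886040325007299101261053210570368546641563274801127972937368833356632873718142475688230737419941726512910794633682437802416410566356545856536129059,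
  76097883040982894961765166744145916561481812259564334276861128458741364847713390326348904897758804383137913721944258726818953744487873175338911901034563555732849676960287353890715273007150650441562292345320674226717841827130331456536129059,
  16584938059649630322125283423865215359608827465655667290705770844716472783159048418693880371856965015626322646477309467903390607647245219185486737329282716647006892266283628800456656216927109344152558933055870527876096273725438136437650632,
  1425376056221607874967421158401668941426545289607789137512636945867885227913490323757469652478671233047438219824211409446333130154],
  [30067466745117],
  [8626034283222717219116595016169722484],
  [140081562448168212044634692106688844484146671090955218215828],
  [26835548313019975115060258119286443234699030281510472370107851826431352494066593356487701121388703336806604461681861290082087171698459714973962027384729055343232322026956320232388436598653007587563030028283714506355546805864809581616833804,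
  2672744588477365059781216753267823548483931092091305288362987122423461004925491401877709197802239557800144635598633011740273855467823876835754704431707041273000185500801314401964395825719150884514812436844303348400057356711124637425455752460,
  52001519593678783646872405054512114579740083899825435670208934166],
  [9799856700929866714231177790550036202565323943969229318460240059617610840304079782111720418489750522068348614332299225903175178517219483789287030659320627126434659593340386837135816551675404486327934796684108591443391945762541334536,
  488610241110212130627676457566335924356929193582092967518191680385971274506641204523187652111441670310562002977029579667044309455667704676449940402923023282086246089366871067751120638551352063735159102752114432273791984536385995527509060843,
  84454891919533816294023807722925606287132102620632801085936632330891802699985593637874873445702174632373453962052652104247603676526875558943231123739353599452333178915644029645108118213719867521813291537776694867484050005234510399827309226,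
  20399702546892712253080973963728563224469433138621093023050504917087858936730437031732473856822637818585095777153168875953777864222719029147524248857249008864184229658605295881037003783563689149186742901022913498380747997952753221252581628,
  7553589231753381487998803512358424054],
  [455154264438491232107602203257361896096083065941649025656744107590256362632],
  [191995362069399988874479248890210363186444702784972417555296634501685565976777684503763010505401797224520229352943797510539952067020759452046317274681616141998994097820526076623426423561934233740961218044042713196145893442643595642916,
  117925442992569984250550014935956645600029134903541489517238141725760618894759336031920056662120992656241715834989880956087191650976974336606862413632758533248215295565511462660696295153849585718017059645753470567581309939701224940763455,
  369690629301256344465050287516240069981470979325853842805018684018445150501226668926126274383953482310808844059297083037975196744627008704559045875914454061392233236493372923902831258960871326299605156159139203430452421784392032548190295,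
  117183349547925249882525344488391377731918820058166236514553589346484635607402439514226133243212186162334563295],
  [1039115336040920206680129808],
  [30034893911453175889711626365829127292200934513851818528],
  [10479199960293814674011240136082684785497477035897103450264858129917029752531620316],
  [731647220726580484553679547444426715774665500449122337449193504772],
  [1966432293683927709306531720391657544775652480075365345144022812852264466373967039251517420241077659269757451986673611172970306274049103692645749766767140590216841150131109222803678319600412461898202452499746180036743825867420395691684429508,
  1715889686729232024495663033576511076546629441612405856317686086495148903856352021078576078123622788984045284306809307954941729034627626903243864929278848741219610005025006364605149280507183651836251099027066183883673902316866542060077347,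
  247511752888737436249817995479466561642237386387407157474074235297828624201736475628186365447380292562762607736435361911721413654892228658871970052829723162788112438070337347747287511511264260373991623917142579118025461483085130755923823265,
  99192412907335161947205575715344046020791347288243867842700434351053111092276520158413894658127425209529771061827586217194651947849982294178245887737172672094588248143852338792169616700005954412515821837829089737006104886170957080648781907,
  1586233216981097549066848134490484546047480271628655466196901626992624261141069937279218392637005395212822937069626907622683175996542566673097194432748334412518819386336465983117303600146854518835205488613094090889777719809962717104110377100,
  197753004410313520588890416219028928955364038755150790543561889314106199841313438788305909802495603858334624342013681892879416641394614643772761244052023639698150288045188251123559598920774865],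
  [15420173554662693490544095406364796426674485207494140321651817734881016973064140926282096058597630216994078734487313066387747264812692483208182450561410515125933694175980984898313545051948767046105508807610040749328987747093471887888270284,
  138945969130703134197789683554756018000928087776871505363850687519986141200874539854709736686320239960085683580243334555450433492063675863418068928196155912335358882586799600109658150775835162765877894435316785373559349369232514613490231968,
  73214014400908013989064636710277038607182698235603136555885991450338362510244799082857118353214057121911758131531639935066266916099521579291039921225535979401640998484958212995359920042553006864299535739886223163803208818024351817989,
  7425559398587769803618899208719005783573864809428777366860823468995832215733675913908439613837235161638115220163389404147129718938955531046412085482143925266671030753470611697949275094196066030693088793296533518886302766461018538281729184723,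
  86550181138162593011501972753964951876682675231987810097354678703057194638271162245663341773917690312235964334925862920838653247634921412339099951548761448122163377984171475794034042467468784622621681547591475411704470028650696150901332758,
  432987151965628341993006413602329658847828843405100050274056139000558893573389179823041966733597777708084621537465478872032139009266612586672865788100267724264228064414697270815694589748978905770861278542066092841300915642196265422921,
  2314929198152425696809678134963551217979532350253879613683477375931408769749107648273424588637448844144944091424557262413077933661271596697501704151021597265759326798804400851033388085269649924731677911245841406722238091682196228268433032035,
  31623698157218222065286121487637393597074382737660433758873928102677311312581429224224984276460281078251499417104397274342070698717008735022199540138],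
  [9486554768619120857553897072448933589986174938639424407832567287026850155346884473505636179596804515821667661309171150478590508211826943081183070489126023685256077667069405486553778883670586692113313334659277527324824074240872367232937004,
  357438653135373593805297922577784600932633476043222181157183594050881104469630156161572644160182614958971446648893409678680277608806400384204885807061756106288633167377382015474475205593219545877636987026734765977],
  [17711711208995216641966483569843764110684859267359979877208152],
  [1596324105996938774784782167951699010601360207458765447827545942843136239774324663809283058431177909316792],
  [21246578025905371185261266471240905827234216063955754514664],
  [330647035863485730647213453319924545753080564246380673924173610384933017317816383650329014839059210279161740274447749538786653602414363462404375149995252677020076255923180391418901094893914457093893756556794518937585498380158629220321345968,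
  171949300256801708266918433383429933555239052444836080162],
  [6148051598988250443976442599766564984174075306562371609868482889680621226117344332236930744782580204196882094235978146280251910167532552443866027705703975528191578510286209490886365774379017489647919914769749323958873615221727590514784,
  1016177354302281763656940502596786295957316115381453502328648448264835458161715164076864607011497767953629629650561197179271985262236712017303590453075856990469124984228206640194518647435194907163485826917485346561022714281147343220911,
  37463305647151564313600379204609313652054830327668017165368314460987702838858183878213577823322207],
  [6606002603008495280569041667527924827581840570286584531210562795002271364504690877559331919514365276685552706746562686152240788538178902307794048072405690597832712979764319847900904435441228609460361948883198415891447564058769335252457277480,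
  1943290477489816188720824462777019770135736471601768664424903371281298314181075141509781547769881916018395337756287085472385346777453833087144693180538912243630564231228608180924396145702677647154080510923477343032488696983322840792061715998,
  8920193665720275335700612026401587434547639336212751316545210510452995194827187759828827599619808672797644174998703875840596197268209554307694728917896242539826992790446433519227236102505226750874128265213219597993375595057580544244170153,
  16096850345644727287932153892615172197690368203680378170465508840521210834611585855130387838965366344431265378949087161761356336321683477336521816924924484622134869796696236840865393545223205721986],
  [212982024046637934136],
  [6338041025121335281691553117771383515574959827062739981405916720572481151671541739306098698794745423818340281606057479367366704813470961647916181798625336280633932396592695489767202429404157172102719108572501350803626556707182602032242388,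
  5155085808250167493204465471626674488059503107150965156622940030109092794563084152324103850384998800740482130283652603404363974443430588363304144271784319688458252708004228184016809681133905356445818966528739721828275891525030834945170239,
  5243999150936212415840588444819765796577326879577787894626502086309935479128243209409171817502839265707701340134255395329946939590519761231541436435795453054990807164826142416632853823894204597121005146518936533351719137802168795254601505,
  22905467228798230627340686231608283048892054603746274413686266509046425077064845096344582801243609398042489161720409731260537895806230079957637958832053629477712910525714991430439131838310057313558443734128390633196269355141668323349057,
  11055931568413163969379402509138769905791925353944722113074825296256384074617100574856140428195498871609017389009722405130488280485582017856113475770420335768454789176714771768578550806555227753601842399286236653429319137091870718416513935,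
  17516749625342085932004700431032854483628929350886680177847546601447205745],
  [15124945919762294140276962252668809655859579721274593308406252438801332673015862489894098997784490196124192367789529245248945627133072977363125084752986931313228170412943916431117316884339707621924373331731955542681838888968281239344242388,
  70357379993313100091627090030577153629796310182349103572368935317393002751105216542213294545929130167405386770777207290314162716758982825709139855683495169934272577124831911441164437698602120172253437917509690561076760232006163331137347111,
  5025213366086460048493438407096332735162260650831974219705275559114684127010637801255968890383994679311232020492285676700550267230625975561650928019304404285667369131769481968389566463937591545221344709594015314539219023006695208181,
  1952130639054744590634232693480056518613992572463808021021558102578580536745181434906320019061313316883020820525895425668695747557525287797380863653082272642998291204076971377710037234071172851672363487845072331134706052377082741260507761323,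
  482934226270867857669996783451734635222825541517735181943802703363005967917700689662536349664544990316976785044169489742706994272583465789951424771614006695230774769927361791331543885458391631701508750931294364342270521174287065433599767940,
  4260267226318802720485469256729740604299339008174381745274531455908150514038526617484210650420876883172378386492985228935557419119043059520558510080813247312054617383478916195211814764772258266008797435519260939788774011864779173114844,
  381633937973620636263570239],
  [3699997200515559160638659163464983736520994089817902214643268940922448705129283806979652408836627113908205608939105188878057103269804643394444610150162029930425029374985646236274122302416909981407552584670641021537311519229598315798401997880,
  3063320240715387076563132845116557059256904085109422932593888035780726237965432165032849408624825788891279732078055017249819024351987119389197396243409503766297037550281662424504820947348829254199995338328314658791027731718882032280209712,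
  267045763111603762636885184945426968351128558059644995249386941717413892439342205],
  [2587158842425510670534272864582792077256258800689885968979090725820525229170890001504556142818579127425090714748694704257240842557464441685962728761763391953699049689329760343147145056758238659246261651733730817902994373976040097665997880,
  168649277400144537817148981865296581368125276813155917369328457536113337937583196934112272104166825706397813192352839272374197303120878251006779424732259030400162896265187848027228543181614079814928249025033630206305],
  [31838348167613],
  [28493568691827987917582598213321957507904678817332636],
  [916735849828405629182960948688560163577866810565520126551576934556592808595266118706844917433797479010808613897785498994712499610502845339704455307157632815122690982117157985068244000421930078308878368933091805932580545721995789172009327064,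
  1135412939495493754668114387314699283984049136996828649069470321228952494821476980888979472828733074677375921922555438823736913728323610189891571602724203641335485968674950414902116190840052403014454733215408084984395550626303866813907626195,
  6878379648496133152041610382719327937403820997855500904199962483690534859825758771093813653122263092989964527122797106765881447393498648676048975470695627238172510179174524211447962320593884322937183785240065236977925233356005998844174969183,
  38804242308074518751891168168582010631947891402676053063626835225465392321039373342536166358801274817720498333132874630579916711777515436645274742012322136022005839087252299270609395325224310516902474844129667583398507556140420589160977440,
  39637780071930858579676544843414364859944604560620805966658128151282845199707094406665583966993893063170151443406206087355142958814079194093889898428784714135054578033901683321560873986620869249787165375626035929996431331705606566698402971,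
  20627342248994928138393337735759405294334270817792760630701771812482080563992593513062954506484041177273667409556537645087878697267882654887206272887150280246053122443940312761625241801202587708895521022698768907507716392775296440497376],
  [31443072184465],
  [128769816267115852029713473734759332875296037362916808800799169551792892],
  [1039972522698085616081641872],
  [340905166712646952004574360885921102148239285142469650416594508212115248395934404794488239865044021768830754948404949110548221260213103108928362417318632426855659789077905035124442499448058865263527599474370486474449064692871390944332,
  92199551817601852378999190367148978864112296264058508426492977721680578430650755494309281699048978080248698388239503934148111262643688443759048573337463944410975790098459268654004262776771642755954698603435578549228337674473823452171,
  382588394501292635692969087],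
  [226043105948762869434101578044313651347109000213504120866277744011168224175589725890006037355213881805810623679531825647638944978412221652970288965725658269362595045587699791738090500795592815589593716816588546091398263963685994429380,
  677244950841472692943118463115467050158454760986575350449160543684389273820590678083797996932581615117311286021025075572539730032017309902368497460255093366988828688881907150167606903543519139733614758193117097998060041489760519167113298071,
  43394789538325162228114410521167070523189536709224034217512760681875171259708582346824309200802499698423729286308149958830199673689733682801978411236140778569814322164686882651817469537885593823846147990733212305161832836205402463810717593,
  42858286852228782415582287388512017752806541134596325823273250440817693174165663653706788370784749511312730294170404217482419560958151975710233915244078309667512602899719954901394957989772786318484751964821590815029317166389353919600760,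
  112733862752797913193728753834180592824540042951798179246120217777297812346925974961936852269280381894046053192600330117253663396728231782693498449691888955729447326457481610583740652390854007896382563301987237203862241112143176125216238295,
  124178086069647569384166200272450259910222578304510452933409631944316166040340933102598248363792],
  [3358839850192654989514000216160807113099592534071094280],
  [2449399883573317014956255737343555554538494033136076981493677878707165508426683420575376],
  [305641567392457959208978611932589930675217008862395202678551826313404107040169522984709438027603273228389189358156344104],
  [25547389540925488796777879394651801886791755472578613224938544024305703738826743085465320738740961826002154736012423423686709057926340671971729609050332876546189469375250299620900714504905476132459954443866750958158661047738448910823439108,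
  435743933202927755623166267762469411151835928601574728779039530627236656071209480532365608153835546681990505027302027177375529918340374518520880369157612771267963840025978564977088106052275896938665805082013948211501979620525709738270184176,
  5878735130429135966159873225055422479569175410672968495768329211205515669174169576937515205697587838757672213610763632400366062272248664673902432521765632070528901478218975816785826590178583040974780888282657518007501341118009983167362104,
  3080345576356415796645297930139167772795999822780347189483918599949009113404875869841479555],
  [64232491350609394012012256918523994931722201016267268249233647131105710127709814467034677103973449125809443677631180359472542794413528779752689680917059039605025144408069172402169375575548210811905472895055366200058664652517853625680,
  3906530164088809228068428719846402676996995367041980931381364520710968464330325719753117015108040066218033123104721762984730260922654228390371846465712393386090650808506370685268534000059755706474164858642996778997691049245745003377155,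
  271411121242912463323266249151911714784536343929736134670012169674366274291884596778997691049245745003377155],
  [3515031820357317985546638828310996459180550918952],
  [404802571091021074289650902615167796584210578229751292215991905430509841956453885644959893808535053261604670183744400867296886115624679351405256809025505328414814722804908333768097121973548607806914625073824506019957693726329508877591952904,
  4041753860383997569840212915683645045700920326335029485597446273841396661624522097063954303971529908334917991261979258282388420012137247055706762759169055627262443256506493134252189274492289499185138620869161734465878608430976410916496,
  328111054813005088517844717864674893930914939500914994602644106301489348041853003922632116601246071858135598735041111909852577728402514447],
  [160665491306466113042889815903742352429689467275111234739047663936086278099030669960637098742848852816962834824505225168072509448443981424061341857585089763594748130922680622151663720567957785735914948795332490087614945004855325242208,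
  580538983181540772137492489169089162273324236916611083059006318796540293755192696122288513297511323388027873045655783740992989623159423379515902068034132598218979446992995347882987373643987345249296262389634432533130296167977885599021407691,
  31392425763521419595137861923493902493199050575330336131171975400630721601041113598],
  [125832463432853872192052110114034108903882217228159970411783595408227389862035868839139466091866889002356390822525073921377222001529449661790093373197335568839603564393627206660224231063440144322207764594930939099181858704285937171532123168,
  23368806405476728474401925764806343713548934958560097639886572510279035182447060582397477064277324225513916805335125670631106979746277188733387530521349312781331978162220670536977983574006548665610129401183562343831417404776974086531,
  34256219415381257727550125736321377895571717188895584833965929345492194764892441181447331949276373686304694640251357063178858374889887386105371120201864532204318365735767522806467959580393604578451110505501824808191804071242057076387,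
  533432403320823558677608321647090811215409254059865621395107547334345765515597373205651077883514847163238435700993052857824232228580447921778199354384811084310758726289846450129555],
  [89246619840898157560162531564532428492819120571448409191175692923352992420],
  [213802160239387522680],
  [3517789206025238147505361543967369266553975016636],
  [31569805999460605108118948052677056713056029253899118168397758952291246914275255834624451653776456292547575997538671375872087732035602056778300811327935089610415937453667319308036134871592718288759363928710054594018723468118943112784,
  1752698970045154011580201869335767868199130572595892119547109181937789215417508937702526176358986102215384845674727542107314150735982032507787237269031143672511487830186327546663576159773893631246966966987511268262617228314505380117056311163,
  17482724533093450002532269146804623376110659297823553406982570981360956581772022311031204712073733776746993546655737041010925066604292437831147417497527367695],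
  [11994902727395214609960371449832221116066581706865577505899325686021358514170405377407299997741416880970818942757385011213167394511914858115107009504396582899397058211820390320870974783733166042103937109317144321977534103312822160179320856,
  18719703085265726078397125326032002787877085569210529880062861344875692957573083117940580195128849003742022418217007565956062938259753391555688568087388202424652237596222176423660352370865903019188114389927003136969575407128602306008,
  10969947361598589010102048542943517485270120358789824151112948174677565147696997450268752976908295234659852831755852637083160783186600347425114990183794742306876374638717908365883711797348440385785020792416540960835939482743444290544899031,
  1930327364099962218347050839944668791080864045322897545399708150941708412239670154962200159604685215875972753454128813298546266698273577254846813585831103311829401945203678538322722762782455087315760724517452459369515604534533134358587,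
  4204106509333437326441601507531181570099705113023806063033981174584962455180135452147956221580239701598785620655965576148343484787402494770382771490395941416983083247003578299187542899535007748396332377896497738857694881651480093991285404811,
  244796929440320121550090584062265214133878695447588647722913761569376054568124031151358567264089664899578483072928228432473885132934754554647331363176559251623028383751187201686567935701329605261538476942984121328579718007336814463219668686,
  973164977915266863604345420395289348561296781391604090022188657518883790419847968438826310281165937649457644327748585],
  [35765605838113975962391196750551995076742269673077086902159713576249377426665733933426453828196514198497902040386412875804177022508192561396603606042305549137451619281686604773415857380138971914247056941183820924913561708144260987334687732,
  806799094723059249972321215450473453132883984323181183609996679361733044043610605815963632314072959530403400507887064590655485158054271643688162464297964025419641617575857765726453138308443915557528493203655065968790462305386022283003746,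
  19602729716647763413713073091682841647253985605674468517148325203546043318587770418153372274305585720476620962233474403233476664189883073409609140470486116561151359154741758870853525573173804408951381412407430535708117281294594284132536547,
  15391643131248679021932011902534272629390139112929806572383179035626795922752592702037934968441381668682619766711707],
  [13284310423620833893848230777125713796701579098908313608368145723940940480],
  [439927056846306898371009511361846704321660216823630776955729157112516],
  [199561651097988157363170221551706351180147077336671278583635254438441798387445202600710235396543672509876570816096070990059786873352180399230243167644341101553553110726613532500003156353559068580792958325142832888576227398262962058245940,
  490770168689198619852371943481494108552652781769310755464208664684874491860796253882883861610627601808411],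
  [14476129654660522040655948649143939979468136511777403164498692604302682598385690295522734256985030958901046589228038020115456244069877655445590417184357901231204704055343920645575847325713824420618134372502480735802250102047388037713904,
  83040715772857185635922071913551044818193014425109870950150521714023751304037493755151126575649254189103458595729595207772129724977870179144689454657961888885603431514276079536425731423180454133447400141836927360274868849799779618768500971,
  112124862759781626985422143814716979064792953470943554898238268854407449752669922108195411894479250631490930287993206031988195241184183260970174163943821745504633491185733897550716306823486796974270869707530196119],
  [1883546270958297921704741979600814650783220838578335211558903406992835035956227482494968205333401646962070492179995509661955181300884855807194477632764468056377822685568520259544519683249790071722806124099665206884026741749250049413713904,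
  9559768645129631691484754501435052313618429518539408235928791888116673952720009351349750770577148145013632957354346608324523353745033514049249900373338431556498749103276146656030849402345629980882993749721305248091690836698320195405458723663,
  9477398925912530613902281812318960900505319850712252354165083360233980661820085566594438733382548656953568797623202627455164589756162343104604278160646698277043616072079571779054489675676188176972432765754395469884987386171912833994946745456,
  1422014891668004434643995942623777862323535378012624721741006661864061981248401078736393625275412707450778317033643539545538160268253646539157880054659402035217822095423142415724788457535890298628145216850747453030967521290508051851200,
  410272444751267201483675789569544643603354768809631310161254731252764729812582714128783428215769117937558701781590472747832153725141107334617567155870575471995578661358679117726383191497207],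
  [80167481387149972361589906225205744001597958145090715887208979851455400336778664570074365128984103451582721869942873474886700060293056260126501469705682539776052405451942403884054524786099809996091638081442854691066756263252084502669592,
  1797071620994785138620893152651348550660617325561268428979161437780814891183781282415298567888517827548548472334570477683346557128323643335775798631468175103507257767774848573348063606201336488855224753699078438186638142386631791319823,
  1275864989364726195453080325042915874663157092695541647511069837785192953791855253300463587830367274841303094546413018658382111544120135632582417127225974792328772116186535739152559013835509669091011138146977749315053962706285754950045159,
  3636843868163850857521967862772296747888926586807184204663289847024764368007835840211888670664406569882504962130219858940311572805105455342898996164218944208383572496026689183540407699027796283397964731172449185643300140170919379258763679,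
  8292969203929949096706535909004270213661025299160228474416738588642239311396268482315575468354537797289546084082644005515975507942218910056193981016763963481138443934554726984381126760155],
  [1195489866511647346961846976585808095739431831210577198603986313333287628306563087409022483397409966202899615116306696199395370596246317576615466288754845469666609045365468995051301769744539018372068965130393252220658235425813401991920,
  18655263590894836345360833246942031156210406864466190138038658105218238748027416791736556482069664904613681303474888784000308789733271601849028053043264092354980748170460726098363606927293520354841059558355116768726709875665617403306209643,
  274761879088002700765731203625783112917315698719938198248209],
  [174204229739857663544819074394468494742202330408927610393721489843520091845579070415352796383282204831034000929585334093090553161104300477227705935789665491403456882628665558844584882530989150386185419721918420103848812250139499982734499716,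
  2448948536195522044544846006160847065380198963179342650718216849381963043519826145508238614467561297175101105599847966660288175777624202736087671667556590240144520054018703455166273321124526711856648221066912203033126668220034210327943864,
  11917669761928692826998729947674558996917396452748803267732226601689776157759303760569521263665003951788296808237538919233078202989651370476393600180516277522028884599034286543571519184736160044299175781916204801276910017278521204649068253,
  4548980884706833502197939420000687143867781094258729853012109585503577779729997172798023402423578268452373423878499307218585196733474048216507943039025330370331662797012844937050952529474305026907753315396151161492492260773527546081895687256,
  81917284964164185753703365630906356467538966511547943518406188604234008060821503180617940394685879375888269358768023124825121399198325666152674036071789973030372941943263923784290102729150453591177665777201138788404211989252359779235255606,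
  17093784815527473370150546890321526384617765548084726269278314347336857576323316461206601984216308313836532785],
  [8507194890555257298900989438560084937982481217029288738413791933107339166000394988250299560055074610846352405079739006336020773589437884250992145983343056629832865648196122097897788625982803292885377519695743949717625316879490888543700420,
  111316942423194258048255327513505953818887908568955624900497797114906660746161056928938404231444806725017323868189557203816612111048384293956549768405930656983232867821278476098481155023649554596584997897238940],
  [180763414819106287239334016],
  [5261690330593633356195441348137537721312],
  [1499119275752434968313645787648087506326384888218964784595068989712380951550370285121527202618207712111600347777620704973683667806422298854940568356080465646349990945426755526942579376391473033324660715867924314807640951959610503242388,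
  335573333161815674092049732106256985348281670877208250287047339217221842812282457373051759373421372034828829375105732162393959499201259814839196557988504244635973370718818605269363180716566731563233330301314830134871401557442035179847060331,
  182541701819392972026753677366105510791816458547506897821],
  [231816695183355686427085564656708112266185130494365104243160317290968051034271851641308472817819638325649734477308012100387626603586565057137215176526362234266109447298362471817858445740733214637377355276098920575643889050770530287175992276,
  3372185876584121741871198248980],
  [35381856527517],
  [174363932209389759270991936],
  [5084464763096351309148375982385027295351862820],
  [36166914553917],
  [36068500849917],
  [1475629529225276087157239134190547406716094211168532809005278957682578128630460040782039056757406949898767133287379117973715629714488252419279863989427832305804454430056626717350850258685934262568709760090178129608090995759571752661612144,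
  1112672630296328309695221556690005122270911160502878356018405013620582504313426337019894039435551169244580959305730382180958698734169177009540797512101413590790974340184540343429917028768409948623759356337871921470078776526565808050298617,
  138034700221594713773809354245776021528142132440507898337915990790155163282427448148972812664836473624154930028060787182204330117825888366390845647094246081890129465051641211547690734811901676669021632210903379280089112358864249682573117,
  34856929150148304177952258880657102907808425030372733048343888436108436542221024760052704612696659794913782245987753069478105176797067381398133002236278149014768914965004746743804454792143599332648008607519283554596297212784655522391176947,
  37735589630357965335796447159119499819059834305318372408961695403294761906041029216698869233305344168096815745824496226455443001450541816072133340832691057041316240754258280174198081185898012248491376532278878658834086745401089062248663,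
  35489373475447949649163418853944361526834771352947518220746136463157408905516903589809207065442731122818160340045920258636179596452189490756722402466180520105126885357822697510162295119133636209137759588911278073628563601237512857026966383],
  [98598276723726950410625664564924445872218873759898218176502399709735956046793220925428367945581681674268464431447338183782351021532367445829994100223072494528687004139758946125132892471954194243035417713206374715601451398194304470179664],
  [391847490010178417548925329038368186604626290384359963618116500253968363124747927879758642388882177871219274467546186234832415424297822474384189016292387777087324612179971009348422884680195692536740127982122367777037200068629667553324,
  75506595888167879209050850165678062991459507872990654522262350580035966540136443390639319535085306859529854691216022300693797136798678496769557598837062642897922029044248767578801334081508438682595008369010323153219630693239958054722502267,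
  45524795715729773764816340823579311330041029010173483056680119505509961899615346220323350254123834116475141887633074859974027774871143549643218564764966081728426638983990],
  [427089978394081768857851428909662285331257016351026914091488459675579890248096428018688930348],
  [104893684704817108981574784459936112856387947693224295339225677776793084234894281047058741920782413412237269430417166814633257328650930958144967611017987886392751475909798350979503655872710686426322285915344320682132192600531305722654940880,
  2714893576358133531795651700798103530131619942806276266377896950807207999627607954058135796845946310652148693939150603107023286938950253783744691209382020732218129512335895793110294820043923018645301291658526120563190372068428738340366263848,
  11330947202369393734625044723752441648360094484399282657030827068118077951779970650034491265862616520331059751693013358254954970234817861048618903570986817193964712057834118831192746122578588697304009983361953414191472426395728834044634240,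
  403356096060070778756066031396795278318694908415621517137389516529375753978275251418507289056230945585513299068992633805086543590033710570029081876632086504795557938873893325043292816282634351824522856358025775710223922588977170530223273624,
  7212554083807969102016055985412634494340484892377162790140788195711949009991604],
  [21501470174727676545498903814549413787068990998857554802239381869798634921707966732355086399056927331870231143596043183134390992355649935359771924027992953374656604180040441227050577837106776947766323013530954767791721609256222575836,
  129987349185815192843212335115281841319096296922846166185274269441217933680285268154793497594982401364475592992986982151573034578983142190814321477712383437844233537979397210881404942499050820271296592753445312530581351462598303475795],
  [37350168580317],
  [156262702834157661599726750278596460359767538338018585585540678435998479427283414345955372014555955685990341571910234323266610747818982030420512527138180880],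
  [1010186643011315367557464876724330798864764375822680249055755786342861727996],
  [229381350149487361209044332188292037990799462824023409207167315691258008006586873352230450298219174924511137326163173711951845622189534818534704442612650745928],
  [1550094807204823002700080296467849095686018609500949174950468714948790055103690608183149873211593445172937332946985209541806425626056456310993958090591392865769512262831099676420015197169155230129963224077199944236778541529633151092046052004,
  46217883870043230031460866719283345255307060525801179135422424010057073324609584632875014612338448673514272348327145760844270350744803123120620369148665339680614819521163623270657966748812024062278707868348152573519266653839803178366717,
  261552720135737067329336075803378844353222440107896146456798649140892362257493695477182332259098044969495491117048832859980312729997541354812096294416342463348993335654489854354272728369033338488692005675737779216303722133219623836564219567,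
  31297855099945662360005732371727653544601315456272667975832012859508908283579480818393621765422556431106792788440007682058479388567595388051217617238715549158374398635051220496976156046752471170054378948568630464336825703958027655879330980,
  35091150798748875542065208392493476718211805377321049810247814726407831496546163939378113027381906423249152025990448062052740452805495071896621618004710973046802313998075710511395979100428513375459916307862898696399473056773635309481,
  4182716318176021618982454159335078698957250006031830653576992627660318310843],
  [7890519984760728886056061315907777570557616174434605119485667646741131899354023647064592704430746603721120584897801070593125418130632263130116432465919608319057145233112080481696606887578723252525007811331802435225080171657441107446991920,
  10390099135024982990637329227855365415565569412677155],
  [7161909904330375235443285483226428289341087898737822046617153329666888758840982682277163175601186869322238047210578182398448086955562703492862918518898959546988246261282310966499684320239785974630743398139746563779144374418790904581456800,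
  520347930885174368448807],
  [190177024311404477249383196],
  [1552459561140467944337995810396],
  [3400208588072696670950549947300576299498593986617477916],
  [2141039302190920297560714225558663844777432873271852699723257808838915151818208048014480],
  [2141039302142596239646454051494191549536530312154469538060751064719459815471097173843920],
  [682044938766570116622714318290729100383171488114627210051196412794284722012316486803388116646867302489850960304004502528042948324308079470336430407124927085976425888747135570053811719109288987843298014597606913010870297737858640235655883724,
  970653319902319444521544698536006752078293900589840207663658784323683679827929323831628055419781841649425044933440371405840096733745330027725432165865373380400186817801460981998906831893256190273761293132277744499185340813216338883860,
  97719898093613078391092412343782786772654914967637217077927110104668740233570196918319953654099017323235654298550423766179892572895658045240570657573627562645155172807031264602167126144535120428864848492626818571090438519954831339847,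
  848712020052689036991084387820393584826774640144246733021568191233923601302201689157981397695192019907277788962902579569929969628449594772791888848555506338183607287704317956544976522332396024131933729873817303445463404887968435192431868415,
  347631263881305059616467697380899962941752021152505755652948580855938455375999391456305],
  [569879073135046910276045979644598193659100483748025855779330735355004250762737151845321504911617753842058647287669394321073335373424568299101872148],
  [49279247965711434211216264605435794389662580390516860657370847868320738208528774521256452553598267190904057131658021431489499272363056262176780167308991195961643557413337182656951433437055495600222475157700591593221473853626391499945514844,
  206672000780481068909671973372272485243230918981917098502543538924668820863025635898015826532671774122271638344654660716795498508270497171857576357753358779391328775285308126855427403959733269308108205884148747088849446412172364589337431733,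
  33506325613768393436580241009505795548674917621274848756169262140144320911383448764265617453956997458184932804316625628034376835690944474196344978557358482647166906898263],
  [541740036919223572733465882193273121785438001744],
  [27052639585824700359091586153301283182509107871714986660278761928935260413235429513873177534225880393661278845512722209512944578102778894349083645160379263539708319885273788958609100106100073066501464979865338372533600],
  [3384708997979621055547900006964436893255767480873056252],
  [2746036820246133974118099501881830851531186354292391113101155111374985999870378405952084452314748110799971942981085558408217459692048160546136608578243580100864588624707715094501162184124176528022073683104743334941528119341293040886230069600,
  2792575048792310427257462381674536879009606815925326019074974412157284860850822710799731899009936698991070712959690432406185456612662598057743048553395557396375196628240566024935370483208801869343286777259524492385634102317093089379109,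
  55867167806955180264466465723836704132551679304349031296090822915758639946299254569028241383071427155224680887913894213043340468354738059260393809712431294501119516451328705259426467102440370738346371452263538993813611077964530271522980883,
  4077395377127419219419173876141119801953627704125194718038791219053240330528055265688793896737155801885669674940609397342659311335073286569569980397652111137073478735341861624941201324962465959814741458450047289973298336369808767701711810235,
  190748039980922609164579003803873882686499078528615017425459801664576169230310397822481300700923676545448683823366709],
  [10134929419345526134812309938146946954757249749412459746299661900397013680804296660213588205192025186501449716672549153023473472155140820701335845528421743064166186534651213390166597888938672443316218882208097020382696891580840786143879416,
  110372871062153492270657600606441508122702660543371336586246381660060106838297593238686004321124406328878315058758969670281105806442710],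
  [694763774228853990401141657667855741014867968992095130414860273357150787531112],
  [10669898826986362091520179756766139574728968051930261994533913261033158401259681397203184943570838137861358091814677706841092516648263763272967077207740630870401192156419203549168924698019098648143773285571476083847000277173604322467553324,
  37232939389348268864130563891872144673809417553831653123114785600571261593670973413697496745085808813549448152389161655074506126793205044597889822967411223707106703709559726875299988481056306386059359844342188429860280265166470499517,
  615248546105009571786664498263],
  [9320983954902755112001052764926102092059528328905961475412396219408669054314543820938174938753658464391334812465841236956141305472384273461253933992368744735272733747020903376212108679896251233358931669514734189928278647314699759669404,
  2456943556631024162927274576402765815932246390137841337216294447258117005733355725261891928432364025004414126247383235927299143182626815712786861517142555937852425647392384710195648075921136822228854472250080358830510373882285580935563834643,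
  3870118385268880700650446837819887093920814519187260622849739452001955580290734877662531115363162342793883729314390733800436536138087933564452400836320044683356088337324947819874864947946481077746398127759171093764021972527590427904,
  93743857465833258404010466377260892179489966004740506077160605030081968781924446773484719088129426058812508270324655242324798265607675682462855226939485776435],
  [39217863405109],
  [174858024141973972505122504],
  [121040174751525432456439991582939513809082908513774985198534055802444920567436],
  [2157210384866486055668647612154589802744691212035444100],
  [11821134188138164244654010998540996912984686974577907323621162925157409288460822612151645912725314082161052],
  [904162186656967409061424073250857316234253100334424721583650252248471034660533589437144286983032292600785411532775799412064899577705221672726851548318442078165715650195772903484695016450755257257031233292053406727585487414931598389216518160,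
  109431271676060619395338704733482042026561150598221498686288148507697751596209791349442253799103263302485076686944642826233778068380098509944763593502827490824523231780901223908850309787768609183180890433792859211004442345804555390888,
  9780636152031054229326732145514622270572973911369679666688841686648178355616663639911976424425500534192620271726289676604530170402370580703741264393385066505240191596120044365852878813257371530463936550400970012378527334024922895998954411,
  31648087739552519948711677580375049184131984567338342462338374580415176659032461797035880955979196490487527888526134105356510687746443204661648445896343635300546887480311751517936336608222330430760827142408950412847532579012925801405460171,
  162647803826042688675231964976933790225425543057838040243857536461907121736],
  [16575219494004615305134802310211330581667375746652425747956224],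
  [2113555492840811483427398326632222170538948854440710760251742996004723019852184582740439290313198292],
  [1328249904638835711161377696597406633519912280511299109018460300194790073438254788765096547089865616237651822851910237276797520059592688746322830832753083834668567571960145048003458350052688363024845043480282193701676941905461677904084180884,
  284258972180047397846878165681110418589759751007538301731678245765101899990429613284789286073924093883295434329113964936808866829941275844],
  [16561519658285052835849179655879792585567533326793781475653260],
  [16847282386347426210717421731025500175087552054739277835385550973900],
  [53525089957649545961988198619812212446737100389961458007408450423530903256976895394410187958107981454666829288993033360651765129796004324916536641013436646979558346624386605873448652036943933085190058357483618064007269187143489960552175564,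
  1608346473334717549912915995638655728749382251271506881008047541013745387694509724532408304245988672110659337296421843476362407422031423902161284365101014424696684000081917100098220563936756774476047941216859618188312062416625559200043873958,
  34163570519256019778366891732043731616356662405891585542],
  [99753434043673466120644034120260425210028153975607996771558165549223399475276330152358705335071198537902642667833152051209593200134517059057745517229603092007245930724624765454445829890125481202448680310593416712723747907774143385991920,
  1135729209914380528142079142377953564166126485344855197121997773049616141302350294559446815972415000337362169388397254386742570557226742939549079442112299550207225921927053731530378046099945990144628884581282586314960738649621882273215,
  4656228874784494731425898183511802065344332991165852598770024167343437992873321618563648838932011020301998748420170686510444154744875116649239722115500929235554060385145784613172314666210194914013663541499161653424762719197453924143,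
  6098802544832306686507865013190649592293687603962582297815341600448940844649709101632890360271183],
  [970886138349368701003687991834897189885134938103740560191378513802651458485685679583776725890224260513493429388617638418541228765117324668263343463525375354949731890049801962125146065370916360819569126408585490881121568],
  [81502194750036513260558659975475524606364740999856666007332596331522314603584680601466481224065325235760938231674746926058992260],
  [12856364446814981512812473993465386942495673401852116181753708654133832633896218839769652456096],
  [79646370850962678914639438479931411453913486838006359569145276472816263959174766478096],
  [129107747664928140291143159494476016],
  [9621453532467465496946546232824640871745123766867636810825464679698744097452679777641168611118707822327606560852],
  [14076074731936423699053103827741356517518243234336632241492233966816],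
  [2835205816445488441724831621261555151062669890413112780],
  [3163079781574809250878517652955351882499785871399742260],
  [40891986407237],
  [90303912987572813271247957788129232897348916242147267140384216281055982572602999829301717770599821521444992048],
  [7444008160914877117216930031722738701957001980730366949337721811954398706443814849272216098572921959466516172565966326205706086333025402095480601549983212141238220463016247356290654965477112332091732750882744580893731786842272345007026968,
  1644505211388731021129960318256594134736924350719432400169177146418739520814492198828601576348954674378229756634753354879165569135902858612507037224408060835299126161480220367241819756778371291874766308489255496851889720930935684692135161180,
  442668441048717237365967523827702858333101552252299525899706797349814547449633071851543958054962342645119657823625609331003495006371395436948073752491965931874309069518266623577001236905069224408384707706304570402643581298914763735410763,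
  235025568801040520437968895230207991511020930605062107635553603092541745619387392435457971889471251187169286372606486409296074250900596046736142399138767157820715308670515996895697020776051126857117414817104297147503977386086837797595159,
  253023301039221627844500310496048583827834979141403390929357062271346050410355652443222011308587014712453653215494492935],
  [851060442327053576723536566213594412657034025659225430190522336190343604405053449017080677349989368233368413817235803778485876801739291708923826085381832732769423026773576433087626310614866308005987312822627113067842262019034504516132344092,
  2171474051983588115756967983622083635692486782534978995267828317589690536897275641625605750417951776726647420724601427898803277366942522056603073392980757387005956426993626035623232785731483675345550525121887614306360226077408162371122600,
  1989113961880280063729630903532445578941298343],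
  [964780737475103498988696359443071439011269950520113607316010563791393690446334354736859264428738951925307580272156956100231084791893607408878493351995311518428168826514763264161373549902560172756445922747494744280773870113975994313869875260,
  16532043686712502177068140955006538673619389857325588285575814797467690612531370499693499626827733932699238909939677989193718851400125583843321199760833180232269547746029910605795140323420833013777720729353301604683748658448116480757739,
  248705529840644035463690113878923981329019399407683444371883227711688582101171180298463058518435401633065376579859213429383757630683946311323958908125859657458147303108950614045705325956422525811607438729283714881136226477992177807947],
  [90770820875369072056789485030426260469971105475624527715810672],
  [102704280639036963418308904365798844273431581917957503496076770492804979746005763927871826652763994689631676366485197201228863634747769639991185701767314079456270122407112085540433561242805253985053219378872843137182787057796656979556712,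
  55799005832686157611517256590543014221484450146079272713062605333602601860643393859961789461467379764116656115614855656042991066709671706561445943765323712889653220043321594024050490840438027673774727143176460226387582862501243258052267,
  3215516034116966315912172288029782825288529617363597115990676705169288839721316944356755051979802368369363018943889635863479268630378972625935385522091955652963478713323268932925629746391575020564301389524202891315489527199089092501090979715,
  125846536174334767186117489244931913542083219327841060707000334330671772006736668199286808003658447660332851796400696784030535293445],
  [3578922579325178748978682029178650266346674357768419260179759264917382248457677275338562558118941330960786699186928643951767153992441787782966340],
  [438336974460439405226521983684213094075526594930017984164943265692318343213527300],
  [2180164169461803932233007102246894335343686165850658125966108210036802566436506844224374769958940435543268],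
  [3364024993162449521796375820261917449876836307748614384],
  [421367732706392407043824739197068463461529016447814604120391877852273473182358549304173236642741912],
  [451345990922935270656109479453317630412011582385538411361386070482490148532716480],
  [12112839682432413844894029449241179604217374413204621593429559332258875011101001267056294222099858709299019336112494353789516922267799554698301747917318028],
  [1065575061802732791023472641742503586354484381175137105324050636162186287673242252],
  [432055478051855747911986930214013919114953495822839828750580191641739519922924413114188966340],
  [25944019909944646910469800501513544156311572588145838163212601591799484440551759914342605512399115402097364613686215118154696009964949869954891940666315355394769713462836550924328256872273140059778458419210178473920],
  [10494271479085490322847012797004752794625020572227228779209462325736229803720910964760376693240789349275435888525559129704151756205219443483594029127595943603009646853563303005075059129395190329346492288051875775790067786986674831922694940468,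
  2444896261267958932634625030744454553805999688758774112874576713542946739464419230763014033608480526979709937429417549473376443697571316235743285885237934628157061864],
  [674828793016247936364724428784205103956436],
  [58632255634781461372557802730836347749962604309057330071434762687169577024750303110604760008656061131103718101463322450161387883347783662152099528743543290082701792334716936478250612082762025731062344922906137820430663862059566851878491744,
  16985852485607653494472360970096979988791489808938289952255763085001045605813870497518133054399969128176289652543884757303997124672345568498012361220839267618320983727442432378043851146166772325055942276536130711447755792076659312158424047,
  33557368792217232875331295081564329707872637],
  [220426809562178925709476176],
  [431254306151910564257631789432973070849719193843979927990155353924223086995507912689182204599679879975349103437853860856611411418671138476992226025331629316962263587308946353726095851729234088939541784366283761009563109685440934426066320,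
  3462490529726721247975860113665300124723710461723],
  [12904978077962206223051483096582912440689781680466828495956063526568862800470099073021416888915868719016889718118384248123769070682784145191671336161982380042639961412744271526434193034874526607699855757609436822586716574865767052275016988,
  515524548840742277843628237211394340613777159726953471508924110594356453834369703532741124596102761368173652656170062641986018657038082449521235685655703032122737866701805727388225679127441403524236998820837882716165190206741813436409997628,
  660082866577587614980066263579699471386839765811817766442716403601629647110374779388271573355294297695032433839142902270245397027648071824949220051281504814825124899320984916077752993849445061859430912572154190544451343310670978930240234,
  7468389131838843069189772550270209763845237032739949415906381110806221047896377596624679437140300713673745328585876452745742398177407813437628786374426832263168445731842444530974677502943558433244959877772354248209777331],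
  [16834655007553400728050638376902607513743898458116755354722957552554380846113538297087182538923822410617609960286758135069587701189159021572477331921685231748571789113077193126216310613377551265026889777663907010775647319605055014480,
  2692179965307902732559380961868772435288836532001077060057471105157646742113495995185787186921721887651552194500856246802851710423448757372556219198960741477812293154730006231724524839566113795827208969264997180554279310816304393607227235,
  322739546204477557883841424351400004725711101803970516984370308111925603549056286689682029969263648498800030761229941460942392702854592412808569519717116063234973541914838723105166168836578106715760400142011796944835619690435950852024061323,
  4008955269091269586716691480267466608665855962133161749045786963826020942987086217864596461643685327668606656231350573930580496997218347247314509865808501318690017218112068888934523515008017293971285447509555265534211259681686520505232276659,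
  18857640463194591129307487071577593339002138281898735646589267206878003372825882765037507688602962743461973862692858207065756032947249163364760650208529718878689671019571556730082828311054339678121362042450317793305694044514226485017041118,
  9645526123023153184996191583186147566189267120432163174211986378780765805727828849416368725666582919539855588554421486117268032927838303535134085695737197755366316793403729483450790019026973694810953985791393640719468651651419831036278,
  4257300955],
  [954848641097237364766878454942818623044650117968410354969962419255459865917776066551167299923867522194359936444843354390356823347158667655861349562995220243503283858092547890808375942861307547482776755444436418727386650632967748404892816452,
  64460160039304472735540159533610555883719166118643335249560031666065577701415311003723965252956864499114344572167968618557790189455652333771764982195871230466852269008422383203985501922713344118504179200412339674760206263185270900683046582,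
  12673049705389584633535584413480498817701136447208518718],
  [89215821825813710029764893410542743858856488357349606637440295217113345153785819187032],
  [80746840708890488446052613492608996912636075173615894818666165123979545943297480658640557784300262498016273070609783673482868030835249527992947568223354999211209361000240696185834354508179328592708289136212812712147703862410424143336671008,
  21041531551072910621480866272751575439632266849526894527749871405227433475689127588363048553627095888683059684418341362180628734213086968241107731179548528352501767101522095614942223279631779288828918046781033726301559786007128263080,
  236270956266875651305035036389559611],
  [121066704339521606393584925687950221319642665284137301488437734003977609933489151876349777678991862240619723660775519003381462051332138707767147078498725971036774383356480116892697925171103089224304038430551166597281780394595555812562992104],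
  [2201715115355308720093009603650483726953421513335126003220459311722236669622519845507482966276],
  [136996303178960046929326630462173152815784434151624896494186047151992072],
  [317145747146914235120765843567323352298502095425567118940770177744219388161554921026632548908293088451763857525441114036729180944019008430027005049261641341856952611807443068474713677814504110065954757567042354945973960144633982791170810484,
  16280160792228447724412673895742948952898272439202140745559179940],
  [959631535026957515133242502862015481761909907685956183909527278514670429595442434120888261525335528958154641762250495992206158901178654125532149911155892614544547910513354000904],
  [5138601068718655765202472944722326396300744106024822995361353517489724025138055806534522014010096047387448893138038914031001343208566315648129535063137791343428474125491014731288936392112628],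
  [683316293527791895663737512478382663590069242204],
  [18565872026257082867791932459029565390556713349010843382948553738504],
  [30741071078091155515062793680169366944018746294423303892687495613813481310330795895214634134417491950865116083190177169730305531476539816607708215108394582115593582210384065099784723057847709986001726359239651634334018873412734310480,
  94021764927629994751250667258041700670513828518247545388888427261261619388253419535],
  [214839705808202109037819399455298126817080118182206922251729681636031717911874823308159159137261994937288605831265187902841600460053965596190965953902965431076],
  [669963806710609318505368768165634735031701272790003219034051521123492689449683760701639307383681868128172135408842408334960512199747046156188101671613449541031735520305843981281234219155632943212878808003285729185290019682992088],
  [16939199210800323677205932449672201910829592399674324116624661421216],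
  [150500601940701031793388270139422572193474533190776408499849480676721241301449059215165620086986308519711669277894989879141351316206544217381130400600491979091933967926530035719237271912414139592046749456097057123374870025276728362816,
  235317602448559676341652727536836557495386307610636031140594467523253119780690432552407562008965776221790736212619992408913903541126127144728321348153272296777167729847027606069771973362311323],
  [3443174008829818493905529276831698714559467061853176442992420],
  [23592865783151756933723223706344481143788295827628457617581317028532638064812579869783566699380342234275106387072163204326383676260646268448904017447523142962736063433723346195914785069894388320780091209849322758485420349064],
  [706494840850470014243676013050514914811284206200],
  [66778047182644477587960384961599322668161282944473130233255316029189683266969423145719293320411707322132022946235308473034564196273795695224739922976806418603858888485706241199019363569089460986856706180305327948118787342958163144565816288,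
  87098219558120137269383992573872],
  [79658346979674555912573895291915605005009136227289077056921224398036320200242248],
  [18100092998721050939430525191528110047002929187999909618428392542140948672],
  [1084802053051157821608791316760343681995204940777778761326253833105803985160970133328535178558613436117772440787263560837336891061738178048097239609457269179462383679151620594131663114853213085052],
  [65306052947171935027237336583964266649506837381552040956205613768610121717630527330219830006515548776956448329536380645208629867534199948767340865999612923455802526954259836920048321006915155191252267923569834514698261391646135981182310480,
  165697281004239644783780931862549219191505453334630686504792178829407685983764624759955163420839963611170097780640282744496642180027236],
  [26216705769961270633588806771295055139702509617075213079421951542754820035748998109170961235887382285333531386101390577921689305431535228828615745002799289504976756465792779254884637662187896618826381504523957125898268358189916839800],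
  [67506205946116723979294617484845661031628835708841390224836938225633423911910672888374637465314279481725569854678887793170665561726536727443731794419839361485635233590324542422977953901449365767334382205146959237369292966999710122613991912,
  453266428177679001451426090047173915697223452],
  [28966003714249751842808072334819237597238224740306622590956039279725877479782073219524808767204318944286944170843403619159282516529142399519974282067005782447486083868165235113782611406765314009574473582881458062958022732238421933448,
  275269001881200635250544617293665195258701097335881851229169056478169987169297711604911132734386220312715463266291318661767537352572864145311470569086834234749639517255759781308688223329379103828241399621628936708048162815750781086249793463,
  5036109723]]

/-- The exclusion of the `i`th pattern is certified. -/
def Certified (i : ℕ) : Prop :=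
  run patternList i 100000 1 (certificates.getD i []) [start (patternList.getD i [])] = true

instance (i : ℕ) : Decidable (Certified i) := inferInstanceAs (Decidable (_ = true))

set_option maxRecDepth 100000 in
lemma certified : ∀ i < 220, Certified i := by
  decide +kernel

lemma wellFormed_patternList : ∀ i < 220, WellFormed (patternList.getD i []) := by
  decide +kernel

lemma excluded_patternList {𝒞 : Set (ℤ × ℤ → Fin 5)} (h𝒞 : LatticeClass 𝒞) {i : ℕ}
    (hi : i < 220) : Excluded 𝒞 (patternList.getD i []) := by
  induction i using Nat.strong_induction_on with
  | _ i ih =>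
    have h := certified i hi
    unfold Certified at h
    exact excluded_of_refuted_start h𝒞 (wellFormed_patternList i hi)
      (refuted_of_run h𝒞 (fun j hj => ⟨wellFormed_patternList j (hj.trans hi), ih j hj
        (hj.trans hi)⟩) _ _ _ _ h _ (List.mem_singleton_self _))

lemma getD_patternList_last : patternList.getD 219 [] = [(3, 3, 0), (4, 3, 1), (3, 4, 2)] := by
  decide +kernel

lemma exists_perm_map_triple : ∀ x y z : Fin 5, x ≠ y → x ≠ z → y ≠ z →
    ∃ σ : Equiv.Perm (Fin 5), σ x = 0 ∧ σ y = 1 ∧ σ z = 2 := by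
  intro x y z hxy hxz hyz
  have key : ∀ x y z : Fin 5, x ≠ y → x ≠ z → y ≠ z →
      ∃ a b c : Fin 5, Equiv.swap a 2 (Equiv.swap b 1 (Equiv.swap c 0 x)) = 0 ∧
        Equiv.swap a 2 (Equiv.swap b 1 (Equiv.swap c 0 y)) = 1 ∧
          Equiv.swap a 2 (Equiv.swap b 1 (Equiv.swap c 0 z)) = 2 := by decide +kernel
  obtain ⟨a, b, c, h⟩ := key x y z hxy hxz hyz
  exact ⟨((Equiv.swap c 0).trans (Equiv.swap b 1)).trans (Equiv.swap a 2), h⟩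

theorem LatticeClass.notMem {𝒞 : Set (ℤ × ℤ → Fin 5)} (h𝒞 : LatticeClass 𝒞)
    (ψ : ℤ × ℤ → Fin 5) : ψ ∉ 𝒞 := by
  intro hψ
  obtain ⟨σ, h0, h1, h2⟩ := exists_perm_map_triple (ψ (0, 0)) (ψ (1, 0)) (ψ (0, 1))
    (h𝒞.proper ψ hψ (0, 0) (1, 0) (by decide)).symm
    (h𝒞.proper ψ hψ (0, 0) (0, 1) (by decide)).symm
    (by simpa using (h𝒞.proper ψ hψ (1, 0) (-1, 1) (by decide)).symm)
  have hex := excluded_patternList h𝒞 (show 219 < 220 by norm_num)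
  rw [getD_patternList_last] at hex
  refine hex _ (h𝒞.frame_origin hψ σ) ?_
  simp [Fits, h0, h1, h2]

/-- If a proper 5-coloring of `T[a×b]` (`a, b ≥ 7`) contains a pair
(two distinct vertices with a common neighbor receiving the same color), then it
is nice. -/
theorem statement_14 (a b : ℕ) (ha : 7 ≤ a) (hb : 7 ≤ b)
    (φ : ZMod a × ZMod b → Fin 5) (hφ : Proper (triGrid a b) φ)
    (hpair : ∃ x y w : ZMod a × ZMod b, x ≠ y ∧
      (triGrid a b).Adj w x ∧ (triGrid a b).Adj w y ∧ φ x = φ y) :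
    Nice a b φ := by
  by_contra hnice
  exact (latticeClass_obstructions ha hb).notMem (fun p => φ (toTorus a b p))
    ⟨φ, 0, (1, 0), (0, 1), Equiv.refl _, ⟨hφ, hnice⟩, by decide, fun p => by
      rw [frameMap_std, zero_add, Equiv.refl_apply]⟩

end KempePaper
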